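/- arXiv:1811.11417 — 10 statements merged into one kernel-verified Lean document; each statement's English description precedes it below -/
import Mathlib

section
/- Let x > 0 be a feasible interim rule within a winner-selection environment (f, M) where M is a non-separable matroid. Fix a tight set of types S, and let Ŝ be a minimal tight set that strictly contains S if such a set exists, and otherwise let Ŝ be the set T of all types. If there exist dice (D_t)_{t∈S} implementing the restriction x_S in (f, M|S), then there exist dice (D'_t)_{t∈Ŝ} implementing the restriction x_Ŝ in (f, M|Ŝ). -/
/-!
Statement 3: Let `x > 0` be a feasible interim rule within a winner-selection environment
`(f, M)` with `M` a non-separable matroid.  Fix a tight set of types `S`, and let `Ŝ` be a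
minimal tight set strictly containing `S` if one exists, and the set of all types
otherwise.  If there are dice `(D_t)_{t ∈ S}` implementing `x_S` in `(f, M|S)`, then there
are dice `(D'_t)_{t ∈ Ŝ}` implementing `x_Ŝ` in `(f, M|Ŝ)`.

Formalization conventions are as in the other statements (candidates `Fin n`, all types
form `T` with owner map `cand`, independent prior `f`).  "Dice only for the types of `S`"
is modeled by requiring the dice of all types outside `S` to be the point mass at `-1`
(such types roll a negative score and therefore never win and never influence the greedy
selection); the interim condition is required for the types of `S` only.
-/

open MeasureTheory Finset

namespace Stmt3

variable {n : ℕ} {T : Type} [Fintype T] [DecidableEq T]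

/-- Greedy winning predicate with permutation tie-breaking. -/
def Wins (M : Matroid (Fin n)) (s : Fin n → ℝ) (π : Equiv.Perm (Fin n)) (i : Fin n) : Prop :=
  i ∈ M.E ∧ 0 < s i ∧
    i ∉ M.closure {j | 0 < s j ∧ (s i < s j ∨ (s i = s j ∧ π i < π j))}

/-- Probability that candidate `i` wins under independent die rolls `d` with uniform
tie-breaking. -/
noncomputable def winProb (M : Matroid (Fin n)) (d : Fin n → Measure ℝ) (i : Fin n) : ℝ :=
  (∑ π : Equiv.Perm (Fin n), ((Measure.pi d) {s | Wins M s π i}).toReal) / (Nat.factorial n)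

/-- Valid type profiles. -/
def profiles (cand : T → Fin n) : Finset (Fin n → T) :=
  Finset.univ.filter fun p => ∀ i, cand (p i) = i

/-- Conditional winning probability of type `t` under the dice-based rule. -/
noncomputable def diceInterim (cand : T → Fin n) (f : T → ℝ) (M : Matroid (Fin n))
    (D : T → Measure ℝ) (t : T) : ℝ :=
  ∑ p ∈ (profiles cand).filter (fun p => p (cand t) = t),
    (∏ j ∈ Finset.univ.erase (cand t), f (p j)) * winProb M (fun j => D (p j)) (cand t)

/-- `A` is a winner-selection rule with feasible sets `Feas` implementing `x` for `f`. -/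
def ImplementsRule (cand : T → Fin n) (f : T → ℝ) (Feas : Finset (Fin n) → Prop)
    (A : (Fin n → T) → Finset (Fin n) → ℝ) (x : T → ℝ) : Prop :=
  (∀ p S, 0 ≤ A p S) ∧ (∀ p, ∑ S : Finset (Fin n), A p S = 1) ∧
  (∀ p S, A p S ≠ 0 → Feas S) ∧
  ∀ t : T, ∑ p ∈ (profiles cand).filter (fun p => p (cand t) = t),
      (∏ j ∈ Finset.univ.erase (cand t), f (p j)) *
        (∑ S ∈ Finset.univ.filter (fun S : Finset (Fin n) => cand t ∈ S), A p S) = x t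

/-- A matroid is separable if it is the direct sum of two matroids on a nontrivial
partition of its ground set. -/
def Separable (M : Matroid (Fin n)) : Prop :=
  ∃ X : Set (Fin n), X.Nonempty ∧ (M.E \ X).Nonempty ∧ X ⊆ M.E ∧
    ∀ I : Set (Fin n), I ⊆ M.E → (M.Indep I ↔ M.Indep (I ∩ X) ∧ M.Indep (I \ X))

/-- The rank of a set in a matroid: the largest cardinality of an independent subset. -/
noncomputable def rk (M : Matroid (Fin n)) (X : Set (Fin n)) : ℕ :=
  sSup {k | ∃ I : Finset (Fin n), ↑I ⊆ X ∧ M.Indep ↑I ∧ I.card = k}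

/-- `R(S)`: the expected rank of the set of candidates whose realized type lies in `S`. -/
noncomputable def Rval (cand : T → Fin n) (f : T → ℝ) (M : Matroid (Fin n))
    (S : Finset T) : ℝ :=
  ∑ p ∈ profiles cand, (∏ j, f (p j)) * (rk M {i | p i ∈ S} : ℝ)

/-- A set of types is tight if its Border constraint holds with equality. -/
def Tight (cand : T → Fin n) (f : T → ℝ) (M : Matroid (Fin n)) (x : T → ℝ)
    (S : Finset T) : Prop :=
  Rval cand f M S = ∑ t ∈ S, f t * x t

/-- The active types. -/
noncomputable def Tplus (f : T → ℝ) (x : T → ℝ) : Finset T :=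
  Finset.univ.filter fun t => 0 < f t * x t

/-- Barrier sets: the inclusion-minimal nonempty tight sets of active types if a nonempty
tight set of active types exists; otherwise the set of all active types. -/
def IsBarrier (cand : T → Fin n) (f : T → ℝ) (M : Matroid (Fin n)) (x : T → ℝ)
    (S : Finset T) : Prop :=
  ((∃ C, C ⊆ Tplus f x ∧ C.Nonempty ∧ Tight cand f M x C) ∧
    (S ⊆ Tplus f x ∧ S.Nonempty ∧ Tight cand f M x S ∧
      ∀ C, C ⊆ Tplus f x → C.Nonempty → Tight cand f M x C → C ⊆ S → C = S))
  ∨ ((¬ ∃ C, C ⊆ Tplus f x ∧ C.Nonempty ∧ Tight cand f M x C) ∧ S = Tplus f x)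

/-- The candidates having a type in `S`. -/
def candSet (cand : T → Fin n) (S : Finset T) : Set (Fin n) :=
  {i | ∃ t ∈ S, cand t = i}

set_option linter.unusedSectionVars false


lemma measurableSet_wins (M : Matroid (Fin n)) (π : Equiv.Perm (Fin n)) (i : Fin n) :
    MeasurableSet {s : Fin n → ℝ | Wins M s π i} := by
  have hZ : Measurable (fun s : Fin n → ℝ =>
      {j | 0 < s j ∧ (s i < s j ∨ (s i = s j ∧ π i < π j))}) := by
    rw [measurable_set_iff]
    intro j
    apply measurableSet_setOfPred.1
    have h1 : MeasurableSet {s : Fin n → ℝ | 0 < s j} :=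
      measurableSet_lt measurable_const (measurable_pi_apply j)
    have h2 : MeasurableSet {s : Fin n → ℝ | s i < s j} :=
      measurableSet_lt (measurable_pi_apply i) (measurable_pi_apply j)
    have h3 : MeasurableSet {s : Fin n → ℝ | s i = s j} :=
      measurableSet_eq_fun (measurable_pi_apply i) (measurable_pi_apply j)
    exact h1.inter (h2.union (h3.inter (MeasurableSet.const _)))
  have h0 : MeasurableSet {s : Fin n → ℝ | 0 < s i} :=
    measurableSet_lt measurable_const (measurable_pi_apply i)
  have h4 : MeasurableSet {A : Set (Fin n) | i ∉ M.closure A} := Set.Finite.measurableSet (Set.toFinite _)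
  exact (MeasurableSet.const _).inter (h0.inter (hZ h4))

/-- Interim probabilities for dice presented as push-forwards. -/
noncomputable def Xv (cand : T → Fin n) (f : T → ℝ) (M : Matroid (Fin n))
    (ν : T → Measure ℝ) (g : T → ℝ → ℝ) (t : T) : ℝ :=
  ∑ p ∈ (profiles cand).filter (fun p => p (cand t) = t),
    (∏ j ∈ Finset.univ.erase (cand t), f (p j)) *
      ((∑ π : Equiv.Perm (Fin n), (Measure.pi (fun j => ν (p j))).real
        {u | Wins M (fun j => g (p j) (u j)) π (cand t)}) / (Nat.factorial n))

lemma diceInterim_map (cand : T → Fin n) (f : T → ℝ) (M : Matroid (Fin n))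
    (ν : T → Measure ℝ) (hν : ∀ t, IsProbabilityMeasure (ν t))
    (g : T → ℝ → ℝ) (hg : ∀ t, Measurable (g t)) (t : T) :
    diceInterim cand f M (fun t => (ν t).map (g t)) t = Xv cand f M ν g t := by
  unfold diceInterim Xv winProb
  refine Finset.sum_congr rfl fun p _ => ?_
  congr 2
  refine Finset.sum_congr rfl fun π _ => ?_
  have : ∀ j, IsProbabilityMeasure ((ν (p j)).map (g (p j))) := fun j =>
    Measure.isProbabilityMeasure_map (hg _).aemeasurable
  rw [← Measure.pi_map_pi (fun j => (hg (p j)).aemeasurable)]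
  rw [Measure.map_apply _ (measurableSet_wins M π _)]
  · rfl
  · exact measurable_pi_lambda _ fun j => (hg (p j)).comp (measurable_pi_apply j)

lemma wins_restrict (M : Matroid (Fin n)) (hME : M.E = Set.univ) (R : Set (Fin n))
    (s : Fin n → ℝ) (hs : ∀ j, 0 < s j → j ∈ R) (π : Equiv.Perm (Fin n)) (i : Fin n) :
    Wins (M.restrict R) s π i ↔ Wins M s π i := by
  unfold Wins
  rw [Matroid.restrict_closure_eq M (fun j hj => hs j hj.1) (by rw [hME]; exact Set.subset_univ _)]
  constructor
  · rintro ⟨h1, h2, h3⟩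
    exact ⟨by rw [hME]; trivial, h2, fun h => h3 ⟨h, h1⟩⟩
  · rintro ⟨h1, h2, h3⟩
    exact ⟨hs i h2, h2, fun h => h3 h.1⟩

lemma rk_eq (M : Matroid (Fin n)) (X : Set (Fin n)) : (rk M X : ℕ∞) = M.eRk X := by
  obtain ⟨I, hI⟩ := M.exists_isBasis' X
  have hbd : ∀ k ∈ {k | ∃ I : Finset (Fin n), ↑I ⊆ X ∧ M.Indep ↑I ∧ I.card = k},
      (k : ℕ∞) ≤ M.eRk X := by
    rintro k ⟨J, hJ, hJi, rfl⟩
    have := hJi.encard_le_eRk_of_subset hJ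
    rwa [Set.encard_coe_eq_coe_finsetCard] at this
  apply le_antisymm
  · apply hbd
    apply Nat.sSup_mem
    · exact ⟨0, ∅, by simp, by simp, rfl⟩
    · refine ⟨n, ?_⟩
      rintro k ⟨J, hJ, hJi, rfl⟩
      simpa using Finset.card_le_univ J
  · rw [hI.eRk_eq_encard]
    have hf : I.Finite := Set.toFinite I
    rw [hf.encard_eq_coe_toFinset_card]
    apply Nat.cast_le.2
    apply le_csSup
    · refine ⟨n, ?_⟩
      rintro k ⟨J, hJ, hJi, rfl⟩
      simpa using Finset.card_le_univ J
    · exact ⟨hf.toFinset, by simpa using hI.subset, by simpa using hI.indep, rfl⟩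

lemma card_le_rk (M : Matroid (Fin n)) (X : Set (Fin n)) (I : Finset (Fin n))
    (h : (I : Set (Fin n)) ⊆ X) (hI : M.Indep (I : Set (Fin n))) : I.card ≤ rk M X := by
  have := hI.encard_le_eRk_of_subset h
  rw [Set.encard_coe_eq_coe_finsetCard, ← rk_eq] at this
  exact_mod_cast this

open Classical in
lemma greedy_card {α : Type*} [LinearOrder α] (M : Matroid (Fin n)) (hME : M.E = Set.univ)
    (key : Fin n → α) (hk : Function.Injective key) (Y : Finset (Fin n)) :
    (Y.filter (fun i => i ∉ M.closure {j | j ∈ Y ∧ key i < key j})).card = rk M (Y : Set (Fin n)) := by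
  induction Y using Finset.induction_on_min_value key with
  | empty =>
    have := rk_eq M (∅ : Set (Fin n))
    simp at this
    simp [this]
  | insert a s ha hmin ih =>
    have hlt : ∀ x ∈ s, key a < key x := fun x hx =>
      lt_of_le_of_ne (hmin x hx) (fun h => ha (by rw [hk h]; exact hx))
    have e1 : ∀ i ∈ s, {j | j ∈ insert a s ∧ key i < key j} = {j | j ∈ s ∧ key i < key j} := by
      intro i hi
      ext j
      simp only [Set.mem_ofPred_eq, Finset.mem_insert]
      constructor
      · rintro ⟨rfl | h, h2⟩
        · exact absurd h2 (not_lt.2 (hmin i hi))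
        · exact ⟨h, h2⟩
      · rintro ⟨h, h2⟩
        exact ⟨Or.inr h, h2⟩
    have e2 : {j | j ∈ insert a s ∧ key a < key j} = (s : Set (Fin n)) := by
      ext j
      simp only [Set.mem_ofPred_eq, Finset.mem_insert, Finset.mem_coe]
      constructor
      · rintro ⟨rfl | h, h2⟩
        · exact absurd h2 (lt_irrefl _)
        · exact h
      · intro h
        exact ⟨Or.inr h, hlt j h⟩
    rw [Finset.filter_insert]
    have e3 : s.filter (fun i => i ∉ M.closure {j | j ∈ insert a s ∧ key i < key j})
        = s.filter (fun i => i ∉ M.closure {j | j ∈ s ∧ key i < key j}) := by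
      apply Finset.filter_congr
      intro i hi
      rw [e1 i hi]
    rw [e3, e2]
    by_cases hc : a ∈ M.closure (s : Set (Fin n))
    · rw [if_neg (not_not.2 hc), ih]
      have h1 := rk_eq M (s : Set (Fin n))
      have h2 := rk_eq M ((insert a s : Finset (Fin n)) : Set (Fin n))
      rw [Finset.coe_insert, ← M.eRk_closure_eq, Matroid.closure_insert_eq_of_mem_closure hc,
        M.eRk_closure_eq, ← h1] at h2
      rw [Finset.coe_insert]
      exact_mod_cast h2.symm
    · rw [if_pos hc, Finset.card_insert_of_notMem (by simp [ha]), ih]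
      have h1 := rk_eq M (s : Set (Fin n))
      have h2 := rk_eq M ((insert a s : Finset (Fin n)) : Set (Fin n))
      rw [Finset.coe_insert, Matroid.eRk_insert_eq_add_one ⟨by rw [hME]; trivial, hc⟩, ← h1] at h2
      rw [Finset.coe_insert]
      exact_mod_cast h2.symm

open Classical in
/-- If the scores of `Y` are positive and above the others, the number of winners in `Y` is the
rank of `Y`. -/
lemma greedy_top (M : Matroid (Fin n)) (hME : M.E = Set.univ) (s : Fin n → ℝ)
    (π : Equiv.Perm (Fin n)) (Y : Finset (Fin n)) (hpos : ∀ i ∈ Y, 0 < s i)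
    (htop : ∀ i ∈ Y, ∀ j, j ∉ Y → s j < s i) :
    (Y.filter (fun i => Wins M s π i)).card = rk M (Y : Set (Fin n)) := by
  let key : Fin n → ℝ ×ₗ Fin n := fun i => toLex (s i, π i)
  have hk : Function.Injective key := by
    intro a b h
    have : (s a, π a) = (s b, π b) := toLex.injective h
    exact π.injective (congrArg Prod.snd this)
  rw [← greedy_card M hME key hk Y]
  congr 1
  apply Finset.filter_congr
  intro i hi
  have : {j | 0 < s j ∧ (s i < s j ∨ (s i = s j ∧ π i < π j))} = {j | j ∈ Y ∧ key i < key j} := by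
    ext j
    simp only [Set.mem_ofPred_eq, key, Prod.Lex.toLex_lt_toLex]
    constructor
    · rintro ⟨h1, h2⟩
      refine ⟨?_, h2⟩
      by_contra hj
      have := htop i hi j hj
      rcases h2 with h2 | h2 <;> linarith [h2]
    · rintro ⟨h1, h2⟩
      exact ⟨hpos j h1, h2⟩
  unfold Wins
  rw [this, hME]
  simp [hpos i hi]

/-- Reindexing. -/
lemma sum_reindex (cand : T → Fin n) (f : T → ℝ) (h : (Fin n → T) → Fin n → ℝ) (C : Finset T) :
    ∑ t ∈ C, f t * (∑ p ∈ (profiles cand).filter (fun p => p (cand t) = t),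
      (∏ j ∈ Finset.univ.erase (cand t), f (p j)) * h p (cand t)) =
    ∑ p ∈ profiles cand, (∏ j, f (p j)) * ∑ i ∈ Finset.univ.filter (fun i => p i ∈ C), h p i := by
  have h1 : ∀ t ∈ C, f t * (∑ p ∈ (profiles cand).filter (fun p => p (cand t) = t),
      (∏ j ∈ Finset.univ.erase (cand t), f (p j)) * h p (cand t)) =
      ∑ p ∈ profiles cand, if p (cand t) = t then (∏ j, f (p j)) * h p (cand t) else 0 := by
    intro t _
    rw [← Finset.sum_filter, Finset.mul_sum]
    refine Finset.sum_congr rfl fun p hp => ?_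
    have hp' := (Finset.mem_filter.1 hp).2
    rw [← Finset.mul_prod_erase Finset.univ (fun j => f (p j)) (Finset.mem_univ (cand t)), hp']
    ring
  rw [Finset.sum_congr rfl h1, Finset.sum_comm]
  refine Finset.sum_congr rfl fun p hp => ?_
  have hp' : ∀ i, cand (p i) = i := (Finset.mem_filter.1 hp).2
  rw [← Finset.sum_filter, Finset.mul_sum]
  symm
  refine Finset.sum_bij (fun i _ => p i) ?_ ?_ ?_ ?_
  · intro i hi
    simp only [Finset.mem_filter, Finset.mem_univ, true_and] at hi
    simp [hi, hp' i]
  · intro a _ b _ hab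
    rw [← hp' a, ← hp' b]
    exact congrArg cand hab
  · intro t ht
    simp only [Finset.mem_filter] at ht
    exact ⟨cand t, by simp [ht.1, ht.2], ht.2⟩
  · intro i _
    rw [hp' i]

lemma meas_wins_g (M : Matroid (Fin n)) (g : T → ℝ → ℝ) (hg : ∀ t, Measurable (g t))
    (p : Fin n → T) (π : Equiv.Perm (Fin n)) (i : Fin n) :
    MeasurableSet {u : Fin n → ℝ | Wins M (fun j => g (p j) (u j)) π i} := by
  have : Measurable (fun (u : Fin n → ℝ) j => g (p j) (u j)) :=
    measurable_pi_lambda _ fun j => (hg (p j)).comp (measurable_pi_apply j)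
  exact this (measurableSet_wins M π i)

open Classical in
lemma top_sum (cand : T → Fin n) (f : T → ℝ) (M : Matroid (Fin n)) (hME : M.E = Set.univ)
    (ν : T → Measure ℝ) (hν : ∀ t, IsProbabilityMeasure (ν t))
    (g : T → ℝ → ℝ) (hg : ∀ t, Measurable (g t)) (C : Finset T)
    (H : ∀ p ∈ profiles cand, (∀ j, f (p j) ≠ 0) → ∀ u : Fin n → ℝ,
      (∀ i, p i ∈ C → 0 < g (p i) (u i)) ∧
      ∀ i j, p i ∈ C → p j ∉ C → g (p j) (u j) < g (p i) (u i)) :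
    ∑ t ∈ C, f t * Xv cand f M ν g t = Rval cand f M C := by
  unfold Xv Rval
  rw [sum_reindex cand f (fun p i => (∑ π : Equiv.Perm (Fin n),
    (Measure.pi (fun j => ν (p j))).real {u | Wins M (fun j => g (p j) (u j)) π i})
      / (Nat.factorial n)) C]
  refine Finset.sum_congr rfl fun p hp => ?_
  by_cases h0 : ∏ j, f (p j) = 0
  · rw [h0]; simp
  congr 1
  have hne : ∀ j, f (p j) ≠ 0 := fun j => Finset.prod_ne_zero_iff.1 h0 j (Finset.mem_univ j)
  set Y : Finset (Fin n) := Finset.univ.filter (fun i => p i ∈ C) with hY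
  have hYs : {i | p i ∈ C} = (Y : Set (Fin n)) := by ext i; simp [hY]
  rw [hYs, ← Finset.sum_div, Finset.sum_comm]
  have key : ∀ π : Equiv.Perm (Fin n), ∑ i ∈ Y, (Measure.pi (fun j => ν (p j))).real
      {u | Wins M (fun j => g (p j) (u j)) π i} = rk M (Y : Set (Fin n)) := by
    intro π
    have e1 : ∀ i ∈ Y, (Measure.pi (fun j => ν (p j))).real
        {u | Wins M (fun j => g (p j) (u j)) π i} =
        ∫ u, ({u | Wins M (fun j => g (p j) (u j)) π i}.indicator 1 u : ℝ)
          ∂(Measure.pi (fun j => ν (p j))) := fun i _ =>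
      (integral_indicator_one (meas_wins_g M g hg p π i)).symm
    rw [Finset.sum_congr rfl e1, ← integral_finsetSum]
    · have e2 : ∀ u : Fin n → ℝ, ∑ i ∈ Y,
          ({u | Wins M (fun j => g (p j) (u j)) π i}.indicator 1 u : ℝ) =
          rk M (Y : Set (Fin n)) := by
        intro u
        have := greedy_top M hME (fun j => g (p j) (u j)) π Y
          (fun i hi => (H p hp hne u).1 i (by simpa [hY] using hi))
          (fun i hi j hj => (H p hp hne u).2 i j (by simpa [hY] using hi) (by simpa [hY] using hj))
        rw [← this, Finset.card_filter]
        push_cast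
        refine Finset.sum_congr rfl fun i _ => ?_
        simp [Set.indicator_apply]
      simp only [e2]
      simp
    · intro i _
      exact (integrable_const (1:ℝ)).indicator (meas_wins_g M g hg p π i)
  rw [Finset.sum_congr rfl (fun π _ => key π)]
  rw [Finset.sum_const, Finset.card_univ, Fintype.card_perm, Fintype.card_fin, nsmul_eq_mul]
  field_simp

lemma border (cand : T → Fin n) (f : T → ℝ) (hf0 : ∀ t, 0 ≤ f t) (M : Matroid (Fin n)) (x : T → ℝ)
    (hfeas : ∃ A, ImplementsRule cand f (fun S => M.Indep ↑S) A x) (C : Finset T) :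
    ∑ t ∈ C, f t * x t ≤ Rval cand f M C := by
  obtain ⟨A, hA0, hA1, hAF, hAx⟩ := hfeas
  have : ∑ t ∈ C, f t * x t = ∑ t ∈ C, f t * (∑ p ∈ (profiles cand).filter (fun p => p (cand t) = t),
      (∏ j ∈ Finset.univ.erase (cand t), f (p j)) *
        (fun (p : Fin n → T) i => ∑ S ∈ Finset.univ.filter (fun S : Finset (Fin n) => i ∈ S), A p S) p (cand t)) :=
    Finset.sum_congr rfl fun t _ => by rw [← hAx t]
  rw [this.trans (sum_reindex cand f (fun (p : Fin n → T) i =>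
    ∑ S ∈ Finset.univ.filter (fun S : Finset (Fin n) => i ∈ S), A p S) C)]
  unfold Rval
  refine Finset.sum_le_sum fun p hp => ?_
  refine mul_le_mul_of_nonneg_left ?_ (Finset.prod_nonneg fun j _ => hf0 _)
  simp only [Finset.sum_filter (s := (Finset.univ : Finset (Finset (Fin n))))]
  rw [Finset.sum_comm]
  calc _ ≤ ∑ W : Finset (Fin n), A p W * (rk M {i | p i ∈ C} : ℝ) := by
        refine Finset.sum_le_sum fun W _ => ?_
        rw [← Finset.sum_filter, Finset.sum_const, nsmul_eq_mul, mul_comm]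
        by_cases hW : A p W = 0
        · simp [hW]
        · refine mul_le_mul_of_nonneg_left ?_ (hA0 p W)
          have hi := hAF p W hW
          refine Nat.cast_le.2 (card_le_rk M _ _ ?_ (hi.subset ?_))
          · intro i hi; simp at hi; exact hi.1
          · intro i hi; simp at hi; exact hi.2
    _ = _ := by rw [← Finset.sum_mul, hA1, one_mul]

/-- The scores used in the construction. -/
noncomputable def sc (S Shat : Finset T) (f : T → ℝ) (L : ℝ) (lam : T → ℝ) (t : T) (u : ℝ) : ℝ :=
  if t ∈ S then (if 0 < u then L + Real.sigmoid u else if 0 < f t then L else -1)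
  else if t ∈ Shat then lam t + Real.sigmoid u else -1

lemma sigmoid_meas : Measurable Real.sigmoid := Real.sigmoid_monotone.measurable

lemma sc_meas (S Shat : Finset T) (f : T → ℝ) (L : ℝ) (lam : T → ℝ) (t : T) :
    Measurable (sc S Shat f L lam t) := by
  unfold sc
  split_ifs
  · exact Measurable.ite measurableSet_Ioi (sigmoid_meas.const_add L) measurable_const
  · exact Measurable.ite measurableSet_Ioi (sigmoid_meas.const_add L) measurable_const
  · exact sigmoid_meas.const_add _
  · exact measurable_const

/-- Noise. -/
noncomputable def nz (S Shat : Finset T) (D : T → Measure ℝ) (t : T) : Measure ℝ :=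
  if t ∉ S ∧ t ∈ Shat then volume.restrict (Set.Icc 0 1) else D t

lemma nz_prob (S Shat : Finset T) (D : T → Measure ℝ) (hD : ∀ t, IsProbabilityMeasure (D t)) (t : T) :
    IsProbabilityMeasure (nz S Shat D t) := by
  unfold nz
  split_ifs
  · constructor; simp
  · exact hD t

lemma nz_noatoms (S Shat : Finset T) (D : T → Measure ℝ) (t : T) (h : t ∉ S) (h2 : t ∈ Shat) :
    NullSingletonClass (nz S Shat D t) := by
  unfold nz
  rw [if_pos ⟨h, h2⟩]
  infer_instance

/-- Original dice presented as push-forwards. -/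
lemma D_eq (S Shat : Finset T) (D : T → Measure ℝ) (hD : ∀ t, IsProbabilityMeasure (D t))
    (hDout : ∀ t ∉ S, D t = Measure.dirac (-1)) :
    D = fun t => (nz S Shat D t).map (fun u => if t ∈ S then u else -1) := by
  funext t
  by_cases h : t ∈ S
  · simp [h, nz]
  · have := nz_prob S Shat D hD t
    simp [h, Measure.map_const, hDout]

lemma sc_lt_of_notMem (S Shat : Finset T) (f : T → ℝ) (L : ℝ) (hL : 0 < L) (lam : T → ℝ)
    (hlam : ∀ t ∉ S, t ∈ Shat → 0 < f t → lam t + 1 ≤ L) (t : T) (ht : t ∉ S) (hft : 0 < f t)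
    (u : ℝ) : sc S Shat f L lam t u < L := by
  unfold sc
  rw [if_neg ht]
  split_ifs with h
  · linarith [hlam t ht h hft, Real.sigmoid_lt_one u]
  · linarith

lemma wins_S_iff (cand : T → Fin n) (f : T → ℝ) (M : Matroid (Fin n))
    (S Shat : Finset T) (L : ℝ) (hL : 0 < L) (lam : T → ℝ)
    (hlam : ∀ t ∉ S, t ∈ Shat → 0 < f t → lam t + 1 ≤ L)
    (p : Fin n → T) (i : Fin n) (hi : p i ∈ S) (hp : ∀ j, j ≠ i → 0 < f (p j))
    (u : Fin n → ℝ) (hu : 0 < u i) (π : Equiv.Perm (Fin n)) :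
    Wins M (fun j => if p j ∈ S then u j else -1) π i ↔
      Wins M (fun j => sc S Shat f L lam (p j) (u j)) π i := by
  have hsi : sc S Shat f L lam (p i) (u i) = L + Real.sigmoid (u i) := by
    simp [sc, hi, hu]
  have hσ := Real.sigmoid_pos (u i)
  have hset : {j | 0 < (if p j ∈ S then u j else -1) ∧ (u i < (if p j ∈ S then u j else -1)
        ∨ (u i = (if p j ∈ S then u j else -1) ∧ π i < π j))} =
      {j | 0 < sc S Shat f L lam (p j) (u j) ∧
        (L + Real.sigmoid (u i) < sc S Shat f L lam (p j) (u j) ∨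
        (L + Real.sigmoid (u i) = sc S Shat f L lam (p j) (u j) ∧ π i < π j))} := by
    ext j
    simp only [Set.mem_ofPred_eq]
    by_cases hji : j = i
    · subst hji
      simp [hsi, hi]
    by_cases hj : p j ∈ S
    · by_cases huj : 0 < u j
      · have hsj : sc S Shat f L lam (p j) (u j) = L + Real.sigmoid (u j) := by
          simp [sc, hj, huj]
        have : 0 < L + Real.sigmoid (u j) := by linarith [Real.sigmoid_pos (u j)]
        simp [hsj, hj, huj, this, Real.sigmoid_lt_iff]
      · have hsj : sc S Shat f L lam (p j) (u j) = L := by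
          simp [sc, hj, huj, hp j hji]
        rw [hsj]
        simp only [hj, if_true]
        constructor
        · rintro ⟨h, _⟩; exact absurd h huj
        · rintro ⟨_, h | h⟩
          · linarith
          · linarith [h.1]
    · have := sc_lt_of_notMem S Shat f L hL lam hlam (p j) hj (hp j hji) (u j)
      simp only [hj, if_false]
      constructor
      · rintro ⟨h, _⟩; linarith
      · rintro ⟨_, h | h⟩
        · linarith
        · linarith [h.1]
  unfold Wins
  simp only [hsi, hi, if_true]
  rw [hset]
  have : 0 < L + Real.sigmoid (u i) := by linarith
  simp [hu, this]

lemma S_ok (cand : T → Fin n) (f : T → ℝ) (hf0 : ∀ t, 0 ≤ f t)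
    (M : Matroid (Fin n)) (hME : M.E = Set.univ)
    (x : T → ℝ) (S Shat : Finset T) (hS : Tight cand f M x S)
    (ν : T → Measure ℝ) (hν : ∀ t, IsProbabilityMeasure (ν t))
    (himp : ∀ t ∈ S, Xv cand f M ν (fun t u => if t ∈ S then u else -1) t = x t)
    (L : ℝ) (hL : 0 < L) (lam : T → ℝ)
    (hlam : ∀ t ∉ S, t ∈ Shat → 0 < f t → lam t + 1 ≤ L) :
    ∀ t ∈ S, Xv cand f M ν (sc S Shat f L lam) t = x t := by
  have hfpos : ∀ t, f t ≠ 0 → 0 < f t := fun t h => lt_of_le_of_ne (hf0 t) (Ne.symm h)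
  have hle : ∀ t ∈ S, x t ≤ Xv cand f M ν (sc S Shat f L lam) t := by
    intro t ht
    rw [← himp t ht]
    unfold Xv
    refine Finset.sum_le_sum fun p hp => ?_
    have hpt : p (cand t) = t := (Finset.mem_filter.1 hp).2
    by_cases h0 : ∏ j ∈ Finset.univ.erase (cand t), f (p j) = 0
    · rw [h0]; simp
    refine mul_le_mul_of_nonneg_left ?_ (Finset.prod_nonneg fun j _ => hf0 _)
    refine div_le_div_of_nonneg_right ?_ (by positivity)
    refine Finset.sum_le_sum fun π _ => ?_
    refine measureReal_mono ?_
    intro u hu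
    have hpos : ∀ j, j ≠ cand t → 0 < f (p j) := fun j hj =>
      hfpos _ (Finset.prod_ne_zero_iff.1 h0 j (by simp [hj]))
    have hui : 0 < u (cand t) := by
      have := hu.2.1
      simpa [hpt, ht] using this
    exact (wins_S_iff cand f M S Shat L hL lam hlam p (cand t) (by rw [hpt]; exact ht) hpos u hui π).1 hu
  have hsum : ∑ t ∈ S, f t * Xv cand f M ν (sc S Shat f L lam) t = ∑ t ∈ S, f t * x t := by
    rw [top_sum cand f M hME ν hν _ (sc_meas S Shat f L lam) S ?_]
    · exact hS
    · intro p hp hne u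
      have h1 : ∀ i, p i ∈ S → L ≤ sc S Shat f L lam (p i) (u i) := by
        intro i hi
        unfold sc
        rw [if_pos hi, if_pos (hfpos _ (hne i))]
        split_ifs
        · linarith [Real.sigmoid_pos (u i)]
        · exact le_rfl
      refine ⟨fun i hi => lt_of_lt_of_le hL (h1 i hi), fun i j hi hj => ?_⟩
      exact lt_of_lt_of_le (sc_lt_of_notMem S Shat f L hL lam hlam (p j) hj (hfpos _ (hne j)) (u j)) (h1 i hi)
  intro t ht
  by_cases hft : f t = 0
  · rw [← himp t ht]
    unfold Xv
    refine Finset.sum_congr rfl fun p hp => ?_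
    have hpt : p (cand t) = t := (Finset.mem_filter.1 hp).2
    by_cases h0 : ∏ j ∈ Finset.univ.erase (cand t), f (p j) = 0
    · rw [h0]; simp
    congr 2
    refine Finset.sum_congr rfl fun π _ => ?_
    congr 1
    ext u
    have hpos : ∀ j, j ≠ cand t → 0 < f (p j) := fun j hj =>
      hfpos _ (Finset.prod_ne_zero_iff.1 h0 j (by simp [hj]))
    by_cases hui : 0 < u (cand t)
    · exact (wins_S_iff cand f M S Shat L hL lam hlam p (cand t) (by rw [hpt]; exact ht) hpos u hui π).symm
    · constructor
      · intro h
        have := h.2.1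
        simp [sc, hpt, ht, hui, hft] at this
        linarith
      · intro h
        have := h.2.1
        simp [hpt, ht, hui] at this
  · have heq := (Finset.sum_eq_sum_iff_of_le (fun t ht =>
      mul_le_mul_of_nonneg_left (hle t ht) (hf0 t))).1 hsum.symm t ht
    exact (mul_left_cancel₀ hft heq).symm

lemma ae_pair_ne (μ : Fin n → Measure ℝ) (hμ : ∀ i, IsProbabilityMeasure (μ i)) (i j : Fin n)
    (hij : j ≠ i) (hna : NullSingletonClass (μ i)) (φ w : ℝ → ℝ) (hφ : Measurable φ)
    (hinj : Function.Injective φ) (hw : Measurable w) :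
    ∀ᵐ u ∂(Measure.pi μ), φ (u i) ≠ w (u j) := by
  have hind := (ProbabilityTheory.iIndepFun_pi (μ := μ) (X := fun _ => id)
    (fun _ => aemeasurable_id)).indepFun hij
  have hmap := (ProbabilityTheory.indepFun_iff_map_prod_eq_prod_map_map
    (measurable_pi_apply j).aemeasurable (measurable_pi_apply i).aemeasurable).1 hind
  have e1 : (Measure.pi μ).map (fun u => u j) = μ j := (measurePreserving_eval μ j).map_eq
  have e2 : (Measure.pi μ).map (fun u => u i) = μ i := (measurePreserving_eval μ i).map_eq
  have hB : MeasurableSet {q : ℝ × ℝ | φ q.2 = w q.1} :=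
    measurableSet_eq_fun (hφ.comp measurable_snd) (hw.comp measurable_fst)
  have hnull : ((μ j).prod (μ i)) {q : ℝ × ℝ | φ q.2 = w q.1} = 0 := by
    rw [Measure.measure_prod_null hB]
    refine Filter.Eventually.of_forall fun a => ?_
    refine Set.Subsingleton.measure_zero ?_ _
    intro b hb c hc
    exact hinj (Eq.trans hb (Eq.symm hc))
  have hm2 : (Measure.pi μ).map (fun u => (u j, u i)) = (μ j).prod (μ i) := by
    rw [← e1, ← e2]; exact hmap
  rw [← hm2, Measure.map_apply (by fun_prop) hB] at hnull
  rw [ae_iff]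
  simpa using hnull

lemma ae_single_ne (μ : Fin n → Measure ℝ) (hμ : ∀ i, IsProbabilityMeasure (μ i)) (i : Fin n)
    (hna : NullSingletonClass (μ i)) (φ : ℝ → ℝ)
    (hinj : Function.Injective φ) (c : ℝ) :
    ∀ᵐ u ∂(Measure.pi μ), φ (u i) ≠ c := by
  have : ∀ᵐ a ∂(μ i), φ a ≠ c := by
    rw [ae_iff]
    refine Set.Subsingleton.measure_zero ?_ _
    intro b hb c hc
    simp at hb hc
    exact hinj (hb.trans hc.symm)
  exact (Measure.quasiMeasurePreserving_eval μ i).ae this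

lemma sc_cont (S Shat : Finset T) (f : T → ℝ) (L : ℝ) (t : T) (u : ℝ) :
    Continuous (fun lam => sc S Shat f L lam t u) := by
  unfold sc
  split_ifs
  · exact continuous_const
  · exact continuous_const
  · exact continuous_const
  · exact (continuous_apply t).add continuous_const
  · exact continuous_const

lemma Xv_cont (cand : T → Fin n) (f : T → ℝ) (M : Matroid (Fin n))
    (S Shat : Finset T) (ν : T → Measure ℝ) (hν : ∀ t, IsProbabilityMeasure (ν t))
    (hna : ∀ t ∉ S, t ∈ Shat → NullSingletonClass (ν t)) (L : ℝ) (t : T) (htS : t ∉ S)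
    (htH : t ∈ Shat) :
    Continuous (fun lam => Xv cand f M ν (sc S Shat f L lam) t) := by
  unfold Xv
  refine continuous_finsetSum _ fun p hp => ?_
  have hpt : p (cand t) = t := (Finset.mem_filter.1 hp).2
  refine continuous_const.mul (Continuous.div_const ?_ _)
  refine continuous_finsetSum _ fun π _ => ?_
  set i := cand t with hi
  set μ : Fin n → Measure ℝ := fun j => ν (p j) with hμ
  have hμp : ∀ j, IsProbabilityMeasure (μ j) := fun j => hν _
  have e : ∀ lam : T → ℝ, (Measure.pi μ).real {u | Wins M (fun j => sc S Shat f L lam (p j) (u j)) π i}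
      = ∫ u, ({u | Wins M (fun j => sc S Shat f L lam (p j) (u j)) π i}.indicator 1 u : ℝ)
        ∂(Measure.pi μ) := fun lam =>
    (integral_indicator_one (meas_wins_g M _ (sc_meas S Shat f L lam) p π i)).symm
  simp only [e]
  rw [continuous_iff_continuousAt]
  intro lam0
  refine continuousAt_of_dominated (bound := fun _ => 1) ?_ ?_ (integrable_const _) ?_
  · exact Filter.Eventually.of_forall fun lam =>
      ((integrable_const (1:ℝ)).indicator
        (meas_wins_g M _ (sc_meas S Shat f L lam) p π i)).aestronglyMeasurable
  · refine Filter.Eventually.of_forall fun lam => Filter.Eventually.of_forall fun u => ?_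
    refine (norm_indicator_le_norm_self _ _).trans ?_
    simp
  · have h1 : ∀ j, ∀ᵐ u ∂(Measure.pi μ), j ≠ i →
        sc S Shat f L lam0 (p i) (u i) ≠ sc S Shat f L lam0 (p j) (u j) := by
      intro j
      by_cases hji : j = i
      · exact Filter.Eventually.of_forall fun u h => absurd hji h
      have := ae_pair_ne μ hμp i j hji (by simp only [hμ, hpt]; exact hna t htS htH) Real.sigmoid
        (fun b => sc S Shat f L lam0 (p j) b - lam0 t) sigmoid_meas Real.sigmoid_injective
        ((sc_meas S Shat f L lam0 (p j)).sub_const _)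
      filter_upwards [this] with u hu _ h
      apply hu
      rw [← h, hpt]
      simp [sc, htS, htH]
    have h2 : ∀ j, ∀ᵐ u ∂(Measure.pi μ), p j ∉ S → p j ∈ Shat →
        sc S Shat f L lam0 (p j) (u j) ≠ 0 := by
      intro j
      by_cases hj : p j ∉ S ∧ p j ∈ Shat
      · have := ae_single_ne μ hμp j (hna _ hj.1 hj.2) Real.sigmoid Real.sigmoid_injective
          (- lam0 (p j))
        filter_upwards [this] with u hu _ _ h
        apply hu
        simp [sc, hj.1, hj.2] at h
        linarith
      · exact Filter.Eventually.of_forall fun u h h' => absurd ⟨h, h'⟩ hj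
    filter_upwards [ae_all_iff.2 h1, ae_all_iff.2 h2] with u hu1 hu2
    have hc : ∀ j, ContinuousAt (fun lam => sc S Shat f L lam (p j) (u j)) lam0 := fun j =>
      (sc_cont S Shat f L (p j) (u j)).continuousAt
    have hpos : ∀ᶠ lam in nhds lam0, ∀ j, (0 < sc S Shat f L lam (p j) (u j) ↔
        0 < sc S Shat f L lam0 (p j) (u j)) := by
      rw [Filter.eventually_all]
      intro j
      by_cases hj : p j ∉ S ∧ p j ∈ Shat
      · rcases lt_or_gt_of_ne (hu2 j hj.1 hj.2) with h | h
        · filter_upwards [(hc j).eventually_lt_const h] with lam hl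
          constructor <;> intro h' <;> linarith
        · filter_upwards [(hc j).eventually_const_lt h] with lam hl
          constructor <;> intro h' <;> linarith
      · refine Filter.Eventually.of_forall fun lam => ?_
        have : sc S Shat f L lam (p j) (u j) = sc S Shat f L lam0 (p j) (u j) := by
          unfold sc
          by_cases h1 : p j ∈ S
          · simp [h1]
          · have h2 : p j ∉ Shat := fun h => hj ⟨h1, h⟩
            simp [h1, h2]
        rw [this]
    have hcmp : ∀ᶠ lam in nhds lam0, ∀ j,
        ((sc S Shat f L lam (p i) (u i) < sc S Shat f L lam (p j) (u j) ∨
          (sc S Shat f L lam (p i) (u i) = sc S Shat f L lam (p j) (u j) ∧ π i < π j)) ↔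
        (sc S Shat f L lam0 (p i) (u i) < sc S Shat f L lam0 (p j) (u j) ∨
          (sc S Shat f L lam0 (p i) (u i) = sc S Shat f L lam0 (p j) (u j) ∧ π i < π j))) := by
      rw [Filter.eventually_all]
      intro j
      by_cases hji : j = i
      · refine Filter.Eventually.of_forall fun lam => ?_
        rw [hji]
        simp
      · rcases lt_or_gt_of_ne (hu1 j hji) with h | h
        · filter_upwards [(hc i).eventually_lt (hc j) h] with lam hl
          simp [h, hl]
        · filter_upwards [(hc j).eventually_lt (hc i) h] with lam hl
          simp [not_lt_of_gt h, not_lt_of_gt hl, ne_of_gt h, ne_of_gt hl]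
    have hw : ∀ᶠ lam in nhds lam0, (Wins M (fun j => sc S Shat f L lam (p j) (u j)) π i ↔
        Wins M (fun j => sc S Shat f L lam0 (p j) (u j)) π i) := by
      filter_upwards [hpos, hcmp] with lam h1 h2
      unfold Wins
      simp only [h1, h2]
    refine (continuousAt_const (y := ({u | Wins M (fun j => sc S Shat f L lam0 (p j) (u j)) π i}.indicator
      1 u : ℝ))).congr ?_
    filter_upwards [hw] with lam hl
    by_cases hh : Wins M (fun j => sc S Shat f L lam0 (p j) (u j)) π i
    · classical simp [Set.indicator_apply, hl, hh]
    · classical simp [Set.indicator_apply, hl, hh]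

lemma Xv_mono (cand : T → Fin n) (f : T → ℝ) (hf0 : ∀ t, 0 ≤ f t) (M : Matroid (Fin n))
    (S Shat : Finset T) (ν : T → Measure ℝ) (hν : ∀ t, IsProbabilityMeasure (ν t))
    (L : ℝ) (lam lam' : T → ℝ) (t : T) (ht : lam' t = lam t) (hle : ∀ t', lam t' ≤ lam' t') :
    Xv cand f M ν (sc S Shat f L lam') t ≤ Xv cand f M ν (sc S Shat f L lam) t := by
  unfold Xv
  refine Finset.sum_le_sum fun p hp => ?_
  have hpt : p (cand t) = t := (Finset.mem_filter.1 hp).2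
  refine mul_le_mul_of_nonneg_left ?_ (Finset.prod_nonneg fun j _ => hf0 _)
  refine div_le_div_of_nonneg_right ?_ (by positivity)
  refine Finset.sum_le_sum fun π _ => ?_
  refine measureReal_mono ?_
  intro u hu
  have hi : sc S Shat f L lam' (p (cand t)) (u (cand t)) =
      sc S Shat f L lam (p (cand t)) (u (cand t)) := by
    simp only [sc, hpt, ht]
  have hj : ∀ j, sc S Shat f L lam (p j) (u j) ≤ sc S Shat f L lam' (p j) (u j) := by
    intro j
    unfold sc
    split_ifs <;> first | exact le_rfl | linarith [hle (p j)]
  obtain ⟨h1, h2, h3⟩ := hu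
  refine ⟨h1, by simpa only [hi] using h2, fun h => h3 (M.closure_subset_closure ?_ h)⟩
  rintro j ⟨hj1, hj2⟩
  simp only [Set.mem_ofPred_eq, hi]
  refine ⟨lt_of_lt_of_le hj1 (hj j), ?_⟩
  rcases hj2 with h | h
  · exact Or.inl (lt_of_lt_of_le h (hj j))
  · rcases (hj j).lt_or_eq with h' | h'
    · left; exact lt_of_eq_of_lt h.1 h'
    · right; exact ⟨h.1.trans h', h.2⟩

lemma Xv_low (cand : T → Fin n) (f : T → ℝ) (M : Matroid (Fin n))
    (S Shat : Finset T) (ν : T → Measure ℝ)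
    (L : ℝ) (lam : T → ℝ) (t : T) (htS : t ∉ S) (htH : t ∈ Shat) (hl : lam t = -1) :
    Xv cand f M ν (sc S Shat f L lam) t = 0 := by
  unfold Xv
  refine Finset.sum_eq_zero fun p hp => ?_
  have hpt : p (cand t) = t := (Finset.mem_filter.1 hp).2
  have : ∀ π : Equiv.Perm (Fin n),
      {u : Fin n → ℝ | Wins M (fun j => sc S Shat f L lam (p j) (u j)) π (cand t)} = ∅ := by
    intro π
    ext u
    simp only [Set.mem_ofPred_eq, Set.mem_empty_iff_false, iff_false]
    intro h
    have := h.2.1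
    simp only [hpt, sc, htS, htH, if_true, if_false, hl] at this
    linarith [Real.sigmoid_lt_one (u (cand t))]
  simp [this]

lemma Xv_restrict (cand : T → Fin n) (f : T → ℝ) (M : Matroid (Fin n)) (hME : M.E = Set.univ)
    (ν : T → Measure ℝ) (g : T → ℝ → ℝ) (C : Finset T) (hg : ∀ t ∉ C, ∀ u, g t u ≤ 0) (t : T) :
    Xv cand f (M.restrict (candSet cand C)) ν g t = Xv cand f M ν g t := by
  unfold Xv
  refine Finset.sum_congr rfl fun p hp => ?_
  have hpp : ∀ i, cand (p i) = i := (Finset.mem_filter.1 (Finset.mem_filter.1 hp).1).2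
  congr 2
  refine Finset.sum_congr rfl fun π _ => ?_
  congr 1
  ext u
  show Wins (M.restrict (candSet cand C)) (fun j => g (p j) (u j)) π (cand t) ↔
    Wins M (fun j => g (p j) (u j)) π (cand t)
  refine wins_restrict M hME _ (fun j => g (p j) (u j)) (fun j hj => ?_) π _
  by_contra hn
  have : p j ∉ C := fun h => hn ⟨p j, h, hpp j⟩
  exact absurd hj (not_lt.2 (hg _ this _))

lemma finish (cand : T → Fin n) (f : T → ℝ) (M : Matroid (Fin n)) (hME : M.E = Set.univ)
    (x : T → ℝ) (S Shat : Finset T) (hSS : S ⊆ Shat)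
    (ν : T → Measure ℝ) (hν : ∀ t, IsProbabilityMeasure (ν t)) (L : ℝ) (lam : T → ℝ)
    (h : ∀ t ∈ Shat, Xv cand f M ν (sc S Shat f L lam) t = x t) :
    ∃ D' : T → Measure ℝ, (∀ t, IsProbabilityMeasure (D' t)) ∧
      (∀ t ∉ Shat, D' t = Measure.dirac (-1)) ∧
      ∀ t ∈ Shat, diceInterim cand f (M.restrict (candSet cand Shat)) D' t = x t := by
  have hout : ∀ t ∉ Shat, sc S Shat f L lam t = fun _ => -1 := by
    intro t ht
    funext u
    have : t ∉ S := fun h => ht (hSS h)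
    simp [sc, ht, this]
  refine ⟨fun t => (ν t).map (sc S Shat f L lam t), ?_, ?_, ?_⟩
  · intro t
    exact Measure.isProbabilityMeasure_map (sc_meas S Shat f L lam t).aemeasurable
  · intro t ht
    simp only [hout t ht, Measure.map_const]
    simp
  · intro t ht
    rw [diceInterim_map cand f _ ν hν _ (sc_meas S Shat f L lam), Xv_restrict cand f M hME]
    · exact h t ht
    · intro t' ht' u
      rw [hout t' ht']
      norm_num

lemma tight_insert (cand : T → Fin n) (f : T → ℝ) (M : Matroid (Fin n))
    (x : T → ℝ) (S : Finset T) (hS : Tight cand f M x S) (t : T) (htS : t ∉ S) (hft : f t = 0) :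
    Tight cand f M x (insert t S) := by
  unfold Tight at *
  rw [Finset.sum_insert htS, hft, zero_mul, zero_add, ← hS]
  unfold Rval
  refine Finset.sum_congr rfl fun p _ => ?_
  by_cases h0 : ∏ j, f (p j) = 0
  · rw [h0]; simp
  have hne : ∀ j, f (p j) ≠ 0 := fun j => Finset.prod_ne_zero_iff.1 h0 j (Finset.mem_univ j)
  have : {i | p i ∈ insert t S} = {i | p i ∈ S} := by
    ext i
    have : p i ≠ t := fun h => hne i (by rw [h, hft])
    simp [this]
  rw [this]

lemma nonloop (cand : T → Fin n) (f : T → ℝ) (M : Matroid (Fin n)) (x : T → ℝ)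
    (hfeas : ∃ A, ImplementsRule cand f (fun S => M.Indep ↑S) A x) (t : T) (hx : 0 < x t) :
    cand t ∉ M.closure ∅ := by
  obtain ⟨A, hA0, hA1, hAF, hAx⟩ := hfeas
  rw [← hAx t] at hx
  obtain ⟨p, _, hp⟩ := Finset.exists_ne_zero_of_sum_ne_zero hx.ne'
  obtain ⟨W, hW, hW0⟩ := Finset.exists_ne_zero_of_sum_ne_zero (right_ne_zero_of_mul hp)
  have hI := hAF p W hW0
  have hm : cand t ∈ W := (Finset.mem_filter.1 hW).2
  have := hI.subset (Set.singleton_subset_iff.2 (Finset.mem_coe.2 hm))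
  rw [Matroid.indep_singleton] at this
  exact this.not_isLoop

lemma zero_top (cand : T → Fin n) (f : T → ℝ) (hf0 : ∀ t, 0 ≤ f t)
    (M : Matroid (Fin n)) (hME : M.E = Set.univ) (x : T → ℝ) (hx : ∀ t, 0 < x t ∧ x t ≤ 1)
    (hfeas : ∃ A, ImplementsRule cand f (fun S => M.Indep ↑S) A x)
    (S : Finset T) (ν : T → Measure ℝ) (hν : ∀ t, IsProbabilityMeasure (ν t))
    (t : T) (htS : t ∉ S) :
    x t ≤ Xv cand f M ν (sc S (insert t S) f 1 (fun _ => 3)) t := by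
  have hnl := nonloop cand f M x hfeas t (hx t).1
  obtain ⟨A, hA0, hA1, hAF, hAx⟩ := hfeas
  rw [← hAx t]
  unfold Xv
  refine Finset.sum_le_sum fun p hp => ?_
  have hpt : p (cand t) = t := (Finset.mem_filter.1 hp).2
  have hpp : ∀ i, cand (p i) = i := (Finset.mem_filter.1 (Finset.mem_filter.1 hp).1).2
  refine mul_le_mul_of_nonneg_left ?_ (Finset.prod_nonneg fun j _ => hf0 _)
  have h1 : ∀ π : Equiv.Perm (Fin n), {u : Fin n → ℝ |
      Wins M (fun j => sc S (insert t S) f 1 (fun _ => 3) (p j) (u j)) π (cand t)} = Set.univ := by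
    intro π
    ext u
    simp only [Set.mem_univ, iff_true]
    have hsi : sc S (insert t S) f 1 (fun _ => 3) (p (cand t)) (u (cand t)) =
        3 + Real.sigmoid (u (cand t)) := by simp [sc, hpt, htS]
    have hp0 := Real.sigmoid_pos (u (cand t))
    refine ⟨by rw [hME]; trivial, ?_, ?_⟩
    · simp only [hsi]; linarith
    · have : {j | 0 < sc S (insert t S) f 1 (fun _ => 3) (p j) (u j) ∧
          (sc S (insert t S) f 1 (fun _ => 3) (p (cand t)) (u (cand t)) <
            sc S (insert t S) f 1 (fun _ => 3) (p j) (u j) ∨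
          (sc S (insert t S) f 1 (fun _ => 3) (p (cand t)) (u (cand t)) =
            sc S (insert t S) f 1 (fun _ => 3) (p j) (u j) ∧ π (cand t) < π j))} = ∅ := by
        ext j
        simp only [Set.mem_ofPred_eq, Set.mem_empty_iff_false, iff_false]
        rintro ⟨_, h⟩
        by_cases hj : j = cand t
        · rw [hj] at h; simp at h
        · have hne : p j ≠ t := fun e => hj (by rw [← hpp j, e])
          have hlt : sc S (insert t S) f 1 (fun _ => 3) (p j) (u j) < 3 := by
            have := Real.sigmoid_lt_one (u j)
            unfold sc
            simp only [Finset.mem_insert, hne, false_or]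
            split_ifs <;> linarith
          rw [hsi] at h
          rcases h with h | h
          · linarith
          · linarith [h.1]
      rw [this]
      exact hnl
  simp only [h1]
  have h2 : (∑ π : Equiv.Perm (Fin n), (Measure.pi (fun j => ν (p j))).real Set.univ) /
      (Nat.factorial n : ℝ) = 1 := by
    simp only [probReal_univ]
    rw [Finset.sum_const, Finset.card_univ, Fintype.card_perm, Fintype.card_fin, nsmul_eq_mul]
    field_simp
  rw [h2, ← hA1 p]
  exact Finset.sum_le_sum_of_subset_of_nonneg (Finset.filter_subset _ _) fun W _ _ => hA0 p W

lemma gap (U : Finset T) (lam : T → ℝ) :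
    ∃ k : ℕ, k ≤ U.card ∧ ∀ t ∈ U, ¬ (2 * (k : ℝ) < lam t ∧ lam t ≤ 2 * k + 1) := by
  by_contra hcon
  push Not at hcon
  haveI : Nonempty T := ⟨(hcon 0 (Nat.zero_le _)).choose⟩
  choose! F hF using hcon
  obtain ⟨a, ha, b, hb, hab, heq⟩ := Finset.exists_ne_map_eq_of_card_lt_of_maps_to
    (s := Finset.range (U.card + 1)) (t := U) (f := F) (by simp)
    (fun k hk => (hF k (by simpa [Nat.lt_succ_iff] using hk)).1)
  have h1 := hF a (by simpa [Nat.lt_succ_iff] using ha)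
  have h2 := hF b (by simpa [Nat.lt_succ_iff] using hb)
  rw [heq] at h1
  rcases lt_or_gt_of_ne hab with h | h
  · have : (a : ℝ) + 1 ≤ b := by exact_mod_cast h
    linarith [h1.2.2, h2.2.1]
  · have : (b : ℝ) + 1 ≤ a := by exact_mod_cast h
    linarith [h2.2.2, h1.2.1]

theorem peel_tight_set
    (n : ℕ) (T : Type) [Fintype T] [DecidableEq T]
    (cand : T → Fin n) (f : T → ℝ)
    (hf0 : ∀ t, 0 ≤ f t)
    (hf1 : ∀ i : Fin n, ∑ t ∈ Finset.univ.filter (fun t => cand t = i), f t = 1)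
    (M : Matroid (Fin n)) (hME : M.E = Set.univ) (hM : ¬ Separable M)
    (x : T → ℝ) (hx : ∀ t, 0 < x t ∧ x t ≤ 1)
    (hfeas : ∃ A, ImplementsRule cand f (fun S => M.Indep ↑S) A x)
    (S Shat : Finset T) (hS : Tight cand f M x S)
    (hShat :
      (Tight cand f M x Shat ∧ S ⊂ Shat ∧
        ∀ C, Tight cand f M x C → S ⊂ C → C ⊂ Shat → False) ∨
      ((∀ C, Tight cand f M x C → ¬ S ⊂ C) ∧ Shat = Finset.univ))
    (D : T → Measure ℝ) (hD : ∀ t, IsProbabilityMeasure (D t))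
    (hDout : ∀ t ∉ S, D t = Measure.dirac (-1))
    (hDimp : ∀ t ∈ S, diceInterim cand f (M.restrict (candSet cand S)) D t = x t) :
    ∃ D' : T → Measure ℝ, (∀ t, IsProbabilityMeasure (D' t)) ∧
      (∀ t ∉ Shat, D' t = Measure.dirac (-1)) ∧
      ∀ t ∈ Shat, diceInterim cand f (M.restrict (candSet cand Shat)) D' t = x t := by
  have hSS : S ⊆ Shat := by
    rcases hShat with h | h
    · exact h.2.1.1
    · rw [h.2]; exact Finset.subset_univ _
  have hmin : ∀ C, Tight cand f M x C → S ⊂ C → C ⊆ Shat → C = Shat := by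
    intro C hC h1 h2
    rcases hShat with h | h
    · by_contra hne
      exact h.2.2 C hC h1 (Finset.ssubset_iff_subset_ne.2 ⟨h2, hne⟩)
    · exact absurd h1 (h.1 C hC)
  set ν := nz S Shat D with hνdef
  have hν : ∀ t, IsProbabilityMeasure (ν t) := nz_prob S Shat D hD
  have hna : ∀ t ∉ S, t ∈ Shat → NullSingletonClass (ν t) := nz_noatoms S Shat D
  have himp : ∀ t ∈ S, Xv cand f M ν (fun t u => if t ∈ S then u else -1) t = x t := by
    intro t ht
    have h1 := hDimp t ht
    have h2 : diceInterim cand f (M.restrict (candSet cand S)) D t =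
        diceInterim cand f (M.restrict (candSet cand S))
          (fun t => (ν t).map (fun u => if t ∈ S then u else -1)) t :=
      congrArg (fun E => diceInterim cand f (M.restrict (candSet cand S)) E t)
        (D_eq S Shat D hD hDout)
    have hm : ∀ t : T, Measurable (fun u : ℝ => if t ∈ S then u else -1) := by
      intro t
      split_ifs
      · exact measurable_id
      · exact measurable_const
    rw [h2, diceInterim_map cand f _ ν hν (fun t u => if t ∈ S then u else -1) hm,
      Xv_restrict cand f M hME ν _ S (by intro t' ht' u; simp [ht'])] at h1
    exact h1
  by_cases hz : ∃ t ∈ Shat, t ∉ S ∧ f t = 0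
  · obtain ⟨t, htH, htS, hft⟩ := hz
    have hSh : insert t S = Shat := hmin _ (tight_insert cand f M x S hS t htS hft)
      (Finset.ssubset_insert htS) (Finset.insert_subset htH hSS)
    have hcont : Continuous (fun r : ℝ => Xv cand f M ν (sc S Shat f 1 (fun _ => r)) t) :=
      (Xv_cont cand f M S Shat ν hν hna 1 t htS htH).comp (continuous_pi fun _ => continuous_id)
    have hlow := Xv_low cand f M S Shat ν 1 (fun _ => -1) t htS htH rfl
    have htop := zero_top cand f hf0 M hME x hx hfeas S ν hν t htS
    rw [hSh] at htop
    obtain ⟨r, _, hr⟩ := intermediate_value_Icc (show (-1:ℝ) ≤ 3 by norm_num) hcont.continuousOn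
      (show x t ∈ Set.Icc _ _ from ⟨by simp only [hlow]; exact (hx t).1.le, htop⟩)
    refine finish cand f M hME x S Shat hSS ν hν 1 (fun _ => r) ?_
    intro t' ht'
    by_cases h : t' ∈ S
    · refine S_ok cand f hf0 M hME x S Shat hS ν hν himp 1 one_pos _ ?_ t' h
      intro t2 h2 h3 h4
      rw [← hSh] at h3
      have : t2 = t := by simpa [h2] using h3
      rw [this, hft] at h4
      exact absurd h4 (lt_irrefl _)
    · have : t' = t := by
        rw [← hSh] at ht'
        simpa [h] using ht'
      rw [this]
      exact hr
  push Not at hz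
  have hfU : ∀ t ∈ Shat, t ∉ S → 0 < f t := fun t h1 h2 =>
    lt_of_le_of_ne (hf0 t) (Ne.symm (hz t h1 h2))
  set U := Shat \ S with hU
  set N : ℝ := 2 * (U.card : ℝ) + 2 with hN
  have hN0 : 0 < N := by positivity
  set X : (T → ℝ) → T → ℝ := fun lam t => Xv cand f M ν (sc S Shat f (N + 1) lam) t with hX
  have hXc : ∀ t ∈ U, Continuous (fun lam => X lam t) := by
    intro t ht
    rw [hU, Finset.mem_sdiff] at ht
    exact Xv_cont cand f M S Shat ν hν hna (N + 1) t ht.2 ht.1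
  let K : Set (T → ℝ) := Set.Icc (fun _ => -1) (fun _ => N) ∩ ⋂ t ∈ U, {lam | X lam t ≤ x t}
  have hK : IsCompact K := isCompact_Icc.inter_right
    (isClosed_biInter fun t ht => isClosed_le (hXc t ht) continuous_const)
  have hKne : K.Nonempty := by
    refine ⟨fun _ => -1, ⟨le_rfl, fun _ => ?_⟩, ?_⟩
    · show (-1:ℝ) ≤ N
      linarith
    · simp only [Set.mem_iInter]
      intro t ht
      rw [hU, Finset.mem_sdiff] at ht
      show X _ t ≤ x t
      simp only [hX]
      rw [Xv_low cand f M S Shat ν (N + 1) (fun _ => -1) t ht.2 ht.1 rfl]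
      exact (hx t).1.le
  obtain ⟨lam, hlamK, hmax⟩ := hK.exists_isMaxOn hKne
    (f := fun lam => ∑ t ∈ U, lam t) (by fun_prop)
  have hl1 : ∀ t, -1 ≤ lam t := hlamK.1.1
  have hl2 : ∀ t, lam t ≤ N := hlamK.1.2
  have hl3 : ∀ t ∈ U, X lam t ≤ x t := by
    have := hlamK.2
    simp only [Set.mem_iInter] at this
    exact this
  have hSok : ∀ t ∈ S, X lam t = x t :=
    S_ok cand f hf0 M hME x S Shat hS ν hν himp (N + 1) (by linarith) lam
      (fun t _ _ _ => by linarith [hl2 t])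
  suffices hUok : ∀ t ∈ U, X lam t = x t by
    refine finish cand f M hME x S Shat hSS ν hν (N + 1) lam fun t ht => ?_
    by_cases h : t ∈ S
    · exact hSok t h
    · exact hUok t (by rw [hU, Finset.mem_sdiff]; exact ⟨ht, h⟩)
  by_cases hcap : ∃ t ∈ U, lam t = N
  · obtain ⟨t0, ht0, hlt0⟩ := hcap
    obtain ⟨k, hk, hgap⟩ := gap U lam
    set C := S ∪ U.filter (fun t => 2 * (k : ℝ) + 1 < lam t) with hC
    have hkr : (k : ℝ) ≤ U.card := by exact_mod_cast hk
    have hk0 : (0 : ℝ) ≤ k := Nat.cast_nonneg k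
    have ht0C : t0 ∈ C := by
      rw [hC, Finset.mem_union, Finset.mem_filter]
      right
      refine ⟨ht0, ?_⟩
      rw [hlt0]; linarith
    have hCU : ∀ t ∈ C, t ∉ S → t ∈ U ∧ 2 * (k : ℝ) + 1 < lam t := by
      intro t ht htS
      rw [hC, Finset.mem_union, Finset.mem_filter] at ht
      exact ht.resolve_left htS
    have hsum : ∑ t ∈ C, f t * X lam t = Rval cand f M C := by
      refine top_sum cand f M hME ν hν _ (sc_meas S Shat f (N + 1) lam) C ?_
      intro p hp hne u
      have hhi : ∀ i, p i ∈ C → 2 * (k : ℝ) + 1 < sc S Shat f (N + 1) lam (p i) (u i) := by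
        intro i hi
        have hσ := Real.sigmoid_pos (u i)
        have hfi : 0 < f (p i) := lt_of_le_of_ne (hf0 _) (Ne.symm (hne i))
        unfold sc
        by_cases h : p i ∈ S
        · rw [if_pos h, if_pos hfi]
          split_ifs <;> linarith
        · obtain ⟨h1, h2⟩ := hCU _ hi h
          rw [hU, Finset.mem_sdiff] at h1
          rw [if_neg h, if_pos h1.1]
          linarith
      refine ⟨fun i hi => by linarith [hhi i hi], fun i j hi hj => lt_of_le_of_lt ?_ (hhi i hi)⟩
      have hjS : p j ∉ S := fun h => hj (Finset.mem_union_left _ h)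
      unfold sc
      rw [if_neg hjS]
      split_ifs with h
      · have hjU : p j ∈ U := by rw [hU, Finset.mem_sdiff]; exact ⟨h, hjS⟩
        have h1 : lam (p j) ≤ 2 * k + 1 := by
          by_contra hc
          exact hj (Finset.mem_union_right _ (Finset.mem_filter.2 ⟨hjU, not_le.1 hc⟩))
        have h2 : lam (p j) ≤ 2 * k := by
          by_contra hc
          exact hgap _ hjU ⟨not_le.1 hc, h1⟩
        linarith [Real.sigmoid_lt_one (u j)]
      · linarith
    have hle : ∀ t ∈ C, f t * X lam t ≤ f t * x t := by
      intro t ht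
      refine mul_le_mul_of_nonneg_left ?_ (hf0 t)
      by_cases h : t ∈ S
      · exact (hSok t h).le
      · exact hl3 t (hCU t ht h).1
    have hb := border cand f hf0 M x hfeas C
    have hCt : Tight cand f M x C := by
      refine le_antisymm ?_ hb
      rw [← hsum]
      exact Finset.sum_le_sum hle
    have hSC : S ⊂ C := by
      refine Finset.ssubset_iff_subset_ne.2 ⟨Finset.subset_union_left, fun h => ?_⟩
      rw [← h] at ht0C
      rw [hU, Finset.mem_sdiff] at ht0
      exact ht0.2 ht0C
    have hCS : C ⊆ Shat := by
      refine Finset.union_subset hSS ((Finset.filter_subset _ _).trans ?_)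
      rw [hU]; exact Finset.sdiff_subset
    have hCe := hmin C hCt hSC hCS
    have heq := (Finset.sum_eq_sum_iff_of_le hle).1 (hsum.trans hCt)
    intro t ht
    rw [hU, Finset.mem_sdiff] at ht
    exact mul_left_cancel₀ (hfU t ht.1 ht.2).ne' (heq t (by rw [hCe]; exact ht.1))
  · push Not at hcap
    intro t ht
    by_contra hne
    have hlt : X lam t < x t := lt_of_le_of_ne (hl3 t ht) hne
    have hltN : lam t < N := lt_of_le_of_ne (hl2 t) (hcap t ht)
    have hupd : Continuous (fun r : ℝ => X (Function.update lam t r) t) :=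
      (hXc t ht).comp (continuous_const.update t continuous_id)
    have hev : ∀ᶠ r in nhds (lam t), X (Function.update lam t r) t < x t := by
      refine hupd.continuousAt.eventually_lt_const ?_
      simpa using hlt
    have hev2 : ∀ᶠ r in nhds (lam t), r < N := eventually_lt_nhds hltN
    have hev3 : ∃ᶠ r in nhds (lam t), lam t < r := by
      have : (nhdsWithin (lam t) (Set.Ioi (lam t))).NeBot := inferInstance
      exact (Filter.Eventually.frequently (f := nhdsWithin (lam t) (Set.Ioi (lam t)))
        self_mem_nhdsWithin).filter_mono nhdsWithin_le_nhds
    obtain ⟨r, hr3, hr1, hr2⟩ := (hev3.and_eventually (hev.and hev2)).exists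
    have hupd_le : ∀ t', lam t' ≤ Function.update lam t r t' := by
      intro t'
      by_cases h : t' = t
      · rw [h]; simpa using hr3.le
      · simp [h]
    have hmem : Function.update lam t r ∈ K := by
      refine ⟨⟨fun t' => (hl1 t').trans (hupd_le t'), fun t' => ?_⟩, ?_⟩
      · by_cases h : t' = t
        · rw [h]; simpa using hr2.le
        · simpa [h] using hl2 t'
      · simp only [Set.mem_iInter]
        intro t' ht'
        show X _ t' ≤ x t'
        by_cases h : t' = t
        · rw [h]; exact hr1.le
        · exact (Xv_mono cand f hf0 M S Shat ν hν (N + 1) lam _ t' (by simp [h]) hupd_le).trans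
            (hl3 t' ht')
    have h1 := hmax hmem
    simp only [Set.mem_ofPred_eq] at h1
    have h2 : ∑ t' ∈ U, lam t' < ∑ t' ∈ U, Function.update lam t r t' :=
      Finset.sum_lt_sum (fun t' _ => hupd_le t') ⟨t, ht, by simpa using hr3⟩
    linarith

end Stmt3
end

section
/- Let f_1, …, f_m : X → ℝ be Borel measurable functions on a measurable space X, and let μ be a probability measure on X such that each f_i is integrable with respect to μ. Then there exists a probability measure φ on X with finite support such that ∫_X f_i dφ = ∫_X f_i dμ for all i = 1, …, m; moreover, there is such a φ whose support consists of at most m+1 points. -/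
/-!
Statement 6 (Theorem B.11 of Lasserre): Let `f 1, …, f m : X → ℝ` be Borel measurable
functions on a measurable space `X`, and let `μ` be a probability measure on `X` such
that each `f i` is integrable with respect to `μ`.  Then there exists a probability
measure `φ` on `X` with finite support — a finite convex combination of at most `m + 1`
Dirac measures — such that `∫ f i dφ = ∫ f i dμ` for all `i`.
-/

open MeasureTheory

universe u

theorem aux_sep {E : Type*} [NormedAddCommGroup E] [NormedSpace ℝ E] [FiniteDimensional ℝ E]
    {C : Set E} (hC : Convex ℝ C) (hne : C.Nonempty) (h0 : (0 : E) ∉ C) :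
    ∃ l : E →L[ℝ] ℝ, l ≠ 0 ∧ ∀ a ∈ C, l a ≤ 0 := by
  by_cases hi : (interior C).Nonempty
  · obtain ⟨l, hl, h⟩ := geometric_hahn_banach_of_nonempty_interior_point hC
      (fun h => h0 (interior_subset h)) hi
    exact ⟨l, hl, by simpa using h⟩
  · rw [hC.interior_nonempty_iff_affineSpan_eq_top,
      AffineSubspace.affineSpan_eq_top_iff_vectorSpan_eq_top_of_nonempty _ _ _ hne] at hi
    obtain ⟨l, hl, hk⟩ := Submodule.exists_le_ker_of_lt_top _ (lt_top_iff_ne_top.2 hi)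
    obtain ⟨c, hc⟩ := hne
    have key : ∀ a ∈ C, l a = l c := fun a ha => by
      have := hk (vsub_mem_vectorSpan ℝ ha hc)
      simpa [sub_eq_zero] using this
    have hl' : LinearMap.toContinuousLinearMap l ≠ 0 := by
      simpa using hl
    rcases le_total (l c) 0 with h | h
    · exact ⟨LinearMap.toContinuousLinearMap l, hl', fun a ha => by simpa [key a ha] using h⟩
    · exact ⟨-LinearMap.toContinuousLinearMap l, neg_ne_zero.2 hl',
        fun a ha => by simpa [key a ha] using h⟩

theorem aux_zero {X : Type*} [MeasurableSpace X] (μ : Measure X) [IsProbabilityMeasure μ] (n : ℕ) :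
    ∀ {E : Type u} [NormedAddCommGroup E] [NormedSpace ℝ E] [FiniteDimensional ℝ E]
      (_ : Module.finrank ℝ E = n) {C : Set E} (_ : Convex ℝ C) (g : X → E)
      (_ : Integrable g μ) (_ : ∀ᵐ x ∂μ, g x ∈ C) (_ : ∫ x, g x ∂μ = 0), (0 : E) ∈ C := by
  induction n using Nat.strong_induction_on with
  | _ n ih =>
  intro E _ _ _ hn C hC g hg hgC hg0
  by_contra h0
  obtain ⟨x0, hx0⟩ := hgC.exists
  obtain ⟨l, hl, hle⟩ := aux_sep hC ⟨_, hx0⟩ h0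
  have hint0 : ∫ x, -l (g x) ∂μ = 0 := by
    rw [integral_neg, l.integral_comp_comm hg, hg0]; simp
  have hae : ∀ᵐ x ∂μ, l (g x) = 0 := by
    have h1 := (integral_eq_zero_iff_of_nonneg_ae (f := fun x => -l (g x)) (μ := μ)
      (by filter_upwards [hgC] with x hx; simpa using hle _ hx)
      (l.integrable_comp hg).neg).1 hint0
    filter_upwards [h1] with x hx
    simpa using hx
  let K : Submodule ℝ E := LinearMap.ker (l : E →ₗ[ℝ] ℝ)
  have hK : K < ⊤ := by
    rw [lt_top_iff_ne_top]
    intro h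
    apply hl
    have := LinearMap.ker_eq_top.1 h
    ext x
    exact congrArg (fun f : E →ₗ[ℝ] ℝ => f x) this
  have hlt : Module.finrank ℝ K < n := hn ▸ Submodule.finrank_lt hK.ne
  obtain ⟨p, hp⟩ := LinearMap.exists_leftInverse_of_injective K.subtype (by simp)
  have hpK : ∀ y (hy : y ∈ K), p y = ⟨y, hy⟩ := fun y hy =>
    congrArg (fun f : K →ₗ[ℝ] K => f ⟨y, hy⟩) hp
  let P : E →L[ℝ] K := LinearMap.toContinuousLinearMap p
  have := ih _ hlt (E := K) rfl (C := K.subtype ⁻¹' C) (hC.linear_preimage K.subtype)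
    (fun x => P (g x)) (P.integrable_comp hg)
    (by
      filter_upwards [hgC, hae] with x hx hx'
      have : P (g x) = ⟨g x, hx'⟩ := hpK _ hx'
      simpa [this] using hx)
    (by rw [P.integral_comp_comm hg, hg0]; simp)
  exact h0 (by simpa using this)

theorem aux_mem {X : Type*} [MeasurableSpace X] (μ : Measure X) [IsProbabilityMeasure μ]
    {E : Type*} [NormedAddCommGroup E] [NormedSpace ℝ E] [FiniteDimensional ℝ E]
    {C : Set E} (hC : Convex ℝ C) (g : X → E)
    (hg : Integrable g μ) (hgC : ∀ x, g x ∈ C) : ∫ x, g x ∂μ ∈ C := by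
  have := aux_zero μ _ (E := E) rfl (hC.translate_preimage_left (∫ x, g x ∂μ))
    (fun x => g x - ∫ x, g x ∂μ) (hg.sub (integrable_const _))
    (Filter.Eventually.of_forall fun x => by simpa using hgC x)
    (by rw [integral_sub hg (integrable_const _)]; simp)
  simpa using this

theorem finitely_supported_measure_matching_moments
    {X : Type*} [MeasurableSpace X] (m : ℕ) (f : Fin m → X → ℝ)
    (hf : ∀ i, Measurable (f i))
    (μ : Measure X) (hμ : IsProbabilityMeasure μ)
    (hint : ∀ i, Integrable (f i) μ) :
    ∃ φ : Measure X, IsProbabilityMeasure φ ∧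
      (∃ (k : ℕ) (p : Fin k → X) (w : Fin k → ENNReal),
        k ≤ m + 1 ∧ (∑ j, w j = 1) ∧ φ = ∑ j, w j • Measure.dirac (p j)) ∧
      ∀ i, ∫ x, f i x ∂φ = ∫ x, f i x ∂μ := by
  have := hμ
  have hF : Integrable (fun x i => f i x) μ := Integrable.of_eval hint
  have hmem := aux_mem μ (convex_convexHull ℝ (Set.range fun x i => f i x)) _ hF
    (fun x => subset_convexHull ℝ _ ⟨x, rfl⟩)
  obtain ⟨ι, _, z, w, hz, hai, hw, hw1, hsum⟩ := eq_pos_convex_span_of_mem_convexHull hmem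
  have hcard : Fintype.card ι ≤ m + 1 := by
    have h1 := hai.card_le_finrank_succ
    have h2 := Submodule.finrank_le (vectorSpan ℝ (Set.range z))
    rw [Module.finrank_fin_fun] at h2
    omega
  let e := (Fintype.equivFin ι).symm
  choose q hq using fun j => hz ⟨j, rfl⟩
  have hs1 : ∑ j, ENNReal.ofReal (w (e j)) = 1 := by
    rw [e.sum_comp (fun i => ENNReal.ofReal (w i)),
      ← ENNReal.ofReal_sum_of_nonneg (fun i _ => (hw i).le), hw1, ENNReal.ofReal_one]
  refine ⟨∑ j, ENNReal.ofReal (w (e j)) • Measure.dirac (q (e j)), ⟨?_⟩,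
    ⟨_, fun j => q (e j), fun j => ENNReal.ofReal (w (e j)), hcard, hs1, rfl⟩, fun i => ?_⟩
  · simpa using hs1
  · have hsm := (hf i).stronglyMeasurable
    rw [integral_finsetSum_measure]
    · simp only [integral_smul_measure, integral_dirac' _ _ hsm]
      rw [e.sum_comp (fun j => (ENNReal.ofReal (w j)).toReal • f i (q j)),
        ← eval_integral (fun i => hint i), ← hsum, Finset.sum_apply]
      refine Finset.sum_congr rfl fun j _ => ?_
      rw [ENNReal.toReal_ofReal (hw j).le, ← hq j]
      rfl
    · intro j _
      refine Integrable.smul_measure ?_ ENNReal.ofReal_ne_top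
      exact integrable_dirac' hsm (by simp)
end

section
/- (Border's theorem) In a single-winner environment with n candidates whose types are drawn independently from distributions f_1, …, f_n on finite type sets T_1, …, T_n, an interim rule x is feasible if and only if for all subsets S_1 ⊆ T_1, …, S_n ⊆ T_n: Σ_{i=1}^n Σ_{t∈S_i} f_i(t)·x_i(t) ≤ 1 − Π_{i=1}^n (1 − Σ_{t∈S_i} f_i(t)). -/
open Finset

namespace Stmt7

variable {n : ℕ} {T : Type} [Fintype T] [DecidableEq T]

/-- Valid type profiles. -/
def profiles (cand : T → Fin n) : Finset (Fin n → T) :=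
  Finset.univ.filter fun p => ∀ i, cand (p i) = i

/-- `A` is a winner-selection rule with feasible sets `Feas` implementing `x` for `f`. -/
def ImplementsRule (cand : T → Fin n) (f : T → ℝ) (Feas : Finset (Fin n) → Prop)
    (A : (Fin n → T) → Finset (Fin n) → ℝ) (x : T → ℝ) : Prop :=
  (∀ p S, 0 ≤ A p S) ∧ (∀ p, ∑ S : Finset (Fin n), A p S = 1) ∧
  (∀ p S, A p S ≠ 0 → Feas S) ∧
  ∀ t : T, ∑ p ∈ (profiles cand).filter (fun p => p (cand t) = t),
      (∏ j ∈ Finset.univ.erase (cand t), f (p j)) *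
        (∑ S ∈ Finset.univ.filter (fun S : Finset (Fin n) => cand t ∈ S), A p S) = x t

lemma key (cand : T → Fin n) (F : (Fin n → T) → ℝ) (w : T → ℝ)
    (a : (Fin n → T) → Fin n → ℝ) :
    ∑ t, w t * (∑ p ∈ (profiles cand).filter (fun p => p (cand t) = t), F p * a p (cand t))
      = ∑ p ∈ profiles cand, F p * ∑ i, w (p i) * a p i := by
  simp_rw [Finset.sum_filter, Finset.mul_sum]
  rw [Finset.sum_comm]
  refine Finset.sum_congr rfl fun p hp => ?_
  have hp' : ∀ i, cand (p i) = i := by simpa [profiles] using hp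
  have h1 : ∑ t, (w t * if p (cand t) = t then F p * a p (cand t) else 0)
      = ∑ t ∈ univ.filter (fun t => p (cand t) = t), F p * (w t * a p (cand t)) := by
    rw [Finset.sum_filter]
    refine Finset.sum_congr rfl fun t _ => ?_
    split_ifs <;> ring
  rw [h1]
  refine Finset.sum_bij' (fun t _ => cand t) (fun i _ => p i) ?_ ?_ ?_ ?_ ?_
  · simp
  · intro i _; simp [hp']
  · intro t ht; simpa using ht
  · intro i _; exact hp' i
  · intro t ht
    have : p (cand t) = t := by simpa using ht
    rw [this]

lemma hit (cand : T → Fin n) (f : T → ℝ)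
    (hf1 : ∀ i : Fin n, ∑ t ∈ Finset.univ.filter (fun t => cand t = i), f t = 1)
    (S : Finset T) :
    ∑ p ∈ profiles cand, (∏ j, f (p j)) * (if ∃ i, p i ∈ S then 1 else 0)
      = 1 - ∏ i : Fin n, (1 - ∑ t ∈ S.filter (fun t => cand t = i), f t) := by
  have e1 : ∑ p ∈ profiles cand, ∏ j, f (p j) = 1 := by
    have h := Finset.prod_univ_sum (fun i : Fin n => univ.filter (fun t => cand t = i))
      (fun _ t => f t)
    have hP : profiles cand = Fintype.piFinset
        (fun i : Fin n => univ.filter (fun t => cand t = i)) := by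
      ext p; simp [profiles]
    rw [hP, ← h]; simp [hf1]
  have e2 : ∑ p ∈ profiles cand, (∏ j, f (p j)) * (if ∃ i, p i ∈ S then 0 else 1)
      = ∏ i : Fin n, (1 - ∑ t ∈ S.filter (fun t => cand t = i), f t) := by
    have h := Finset.prod_univ_sum
      (fun i : Fin n => univ.filter (fun t => cand t = i ∧ t ∉ S)) (fun _ t => f t)
    have h3 : ∀ i, 1 - ∑ t ∈ S.filter (fun t => cand t = i), f t
        = ∑ t ∈ univ.filter (fun t => cand t = i ∧ t ∉ S), f t := by
      intro i
      rw [← hf1 i, ← Finset.sum_filter_add_sum_filter_not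
        (univ.filter (fun t => cand t = i)) (fun t => t ∈ S), Finset.filter_filter,
        Finset.filter_filter]
      have : S.filter (fun t => cand t = i) = univ.filter (fun t => cand t = i ∧ t ∈ S) := by
        ext t; simp [and_comm]
      rw [this]; ring
    simp_rw [h3]
    rw [h]
    have hP : Fintype.piFinset (fun i : Fin n => univ.filter (fun t => cand t = i ∧ t ∉ S))
        = (profiles cand).filter (fun p => ¬ ∃ i, p i ∈ S) := by
      ext p; simp [profiles, forall_and]
    rw [hP, Finset.sum_filter]
    refine Finset.sum_congr rfl fun p _ => ?_
    by_cases hh : ∃ i, p i ∈ S <;> simp [hh]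
  rw [← e2, eq_sub_iff_add_eq, ← Finset.sum_add_distrib]
  refine Eq.trans ?_ e1
  refine Finset.sum_congr rfl fun p _ => ?_
  split_ifs <;> ring

lemma cond_one (cand : T → Fin n) (f : T → ℝ)
    (hf1 : ∀ i : Fin n, ∑ t ∈ Finset.univ.filter (fun t => cand t = i), f t = 1) (t : T) :
    ∑ p ∈ (profiles cand).filter (fun p => p (cand t) = t),
      (∏ j ∈ Finset.univ.erase (cand t), f (p j)) = 1 := by
  have h := Finset.prod_univ_sum
    (fun i : Fin n => if i = cand t then {t} else univ.filter (fun s => cand s = i))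
    (fun i s => if i = cand t then 1 else f s)
  have hP : Fintype.piFinset
      (fun i : Fin n => if i = cand t then {t} else univ.filter (fun s => cand s = i))
      = (profiles cand).filter (fun p => p (cand t) = t) := by
    ext p
    simp only [Fintype.mem_piFinset, profiles, Finset.mem_filter, Finset.mem_univ, true_and]
    constructor
    · intro hh
      have h0 : p (cand t) = t := by simpa using hh (cand t)
      refine ⟨fun i => ?_, h0⟩
      by_cases hi : i = cand t
      · rw [hi, h0]
      · simpa [hi] using hh i
    · rintro ⟨h1, h2⟩ i
      by_cases hi : i = cand t
      · subst hi; simp [h2]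
      · simp [hi, h1]
  rw [hP] at h
  have hl : ∏ i : Fin n, ∑ s ∈ (if i = cand t then {t} else univ.filter (fun s => cand s = i)),
      (if i = cand t then 1 else f s) = 1 := by
    refine Finset.prod_eq_one fun i _ => ?_
    by_cases hi : i = cand t
    · simp [hi]
    · simp [hi, hf1]
  rw [hl] at h
  rw [h]
  refine Finset.sum_congr rfl fun p _ => ?_
  rw [← Finset.mul_prod_erase univ _ (Finset.mem_univ (cand t))]
  simp only [if_true, one_mul]
  refine Finset.prod_congr rfl fun j hj => ?_
  simp [Finset.ne_of_mem_erase hj]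

/-- layer cake -/
lemma layer (P : Finset (Fin n → T)) (F : (Fin n → T) → ℝ) (y : T → ℝ)
    (hy : ∀ S : Finset T, ∑ t ∈ S, y t ≤ ∑ p ∈ P, F p * (if ∃ i, p i ∈ S then 1 else 0))
    (hF : ∀ p, 0 ≤ F p) :
    ∀ (k : ℕ) (w : T → ℝ) (M : (Fin n → T) → ℝ), (univ.filter (fun t => w t ≠ 0)).card ≤ k →
      (∀ t, 0 ≤ w t) → (∀ p, 0 ≤ M p) → (∀ p i, w (p i) ≤ M p) →
      ∑ t, w t * y t ≤ ∑ p ∈ P, F p * M p := by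
  intro k
  induction k with
  | zero =>
    intro w M hc hw hM hwM
    have h0 : ∀ t, w t = 0 := by
      simpa [Finset.filter_eq_empty_iff] using hc
    simp only [h0, zero_mul, Finset.sum_const_zero]
    exact Finset.sum_nonneg fun p _ => mul_nonneg (hF p) (hM p)
  | succ k ih =>
    intro w M hc hw hM hwM
    set S := univ.filter (fun t => w t ≠ 0) with hS
    rcases S.eq_empty_or_nonempty with hE | hne
    · exact ih w M (by rw [← hS, hE]; simp) hw hM hwM
    obtain ⟨t0, ht0, hmin⟩ := Finset.exists_min_image S w hne
    have hS' : ∀ t, t ∈ S ↔ w t ≠ 0 := by intro t; simp [hS]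
    have hm : 0 ≤ w t0 := hw t0
    have := ih (fun t => w t - if t ∈ S then w t0 else 0)
      (fun p => M p - w t0 * if ∃ i, p i ∈ S then 1 else 0) ?_ ?_ ?_ ?_
    · have e1 : ∑ t, w t * y t = ∑ t, (w t - if t ∈ S then w t0 else 0) * y t
          + w t0 * ∑ t ∈ S, y t := by
        rw [Finset.mul_sum, ← Finset.sum_filter_add_sum_filter_not univ (fun t => t ∈ S)
          (fun t => w t * y t), ← Finset.sum_filter_add_sum_filter_not univ (fun t => t ∈ S)
          (fun t => (w t - if t ∈ S then w t0 else 0) * y t)]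
        have a1 : ∑ t ∈ univ.filter (fun t => t ∈ S), (w t - if t ∈ S then w t0 else 0) * y t
            = ∑ t ∈ univ.filter (fun t => t ∈ S), w t * y t - ∑ t ∈ S, w t0 * y t := by
          simp only [Finset.filter_univ_mem]
          rw [← Finset.sum_sub_distrib]
          refine Finset.sum_congr rfl fun t ht => ?_
          simp only [ht, if_true]; ring
        have a2 : ∑ t ∈ univ.filter (fun t => ¬ t ∈ S), (w t - if t ∈ S then w t0 else 0) * y t
            = ∑ t ∈ univ.filter (fun t => ¬ t ∈ S), w t * y t := by
          refine Finset.sum_congr rfl fun t ht => ?_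
          have : t ∉ S := (Finset.mem_filter.1 ht).2
          simp [this]
        rw [a1, a2]; ring
      have e2 : ∑ p ∈ P, F p * M p
          = ∑ p ∈ P, F p * (M p - w t0 * if ∃ i, p i ∈ S then 1 else 0)
          + w t0 * ∑ p ∈ P, F p * (if ∃ i, p i ∈ S then 1 else 0) := by
        rw [Finset.mul_sum, ← Finset.sum_add_distrib]
        refine Finset.sum_congr rfl fun p _ => ?_
        ring
      rw [e1, e2]
      exact add_le_add this (mul_le_mul_of_nonneg_left (hy S) hm)
    · have : univ.filter (fun t => (w t - if t ∈ S then w t0 else 0) ≠ 0) ⊆ S.erase t0 := by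
        intro t ht
        have ht' := (Finset.mem_filter.1 ht).2
        rw [Finset.mem_erase]
        by_cases h : t ∈ S
        · refine ⟨?_, h⟩
          rintro rfl
          simp [h] at ht'
        · exfalso
          have : w t = 0 := by by_contra hh; exact h ((hS' t).2 hh)
          simp [h, this] at ht'
      have h2 := Finset.card_le_card this
      rw [Finset.card_erase_of_mem ht0] at h2
      omega
    · intro t
      by_cases h : t ∈ S
      · simpa [h] using hmin t h
      · simpa [h] using hw t
    · intro p
      by_cases h : ∃ i, p i ∈ S
      · obtain ⟨i, hi⟩ := h
        have := hmin _ hi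
        have := hwM p i
        have hh : ∃ i, p i ∈ S := ⟨i, hi⟩
        simp only [hh, if_true]; linarith
      · simpa only [h, if_false, mul_zero, sub_zero] using hM p
    · intro p i
      by_cases h : p i ∈ S
      · have hh : ∃ i, p i ∈ S := ⟨i, h⟩
        simp only [hh, h, if_true]; linarith [hwM p i]
      · have h0 : w (p i) = 0 := by by_contra hh; exact h ((hS' _).2 hh)
        simp only [h, if_false, h0]
        by_cases h : ∃ i, p i ∈ S
        · obtain ⟨i, hi⟩ := h
          have := hmin _ hi
          have := hwM p i
          have hh : ∃ i, p i ∈ S := ⟨i, hi⟩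
          simp only [hh, if_true]; linarith
        · simpa only [h, if_false, mul_zero, sub_zero] using hM p

lemma best (v : Fin n → ℝ) : ∃ b : Fin n → ℝ, (∀ i, 0 ≤ b i) ∧ ∑ i, b i ≤ 1 ∧
    0 ≤ ∑ i, v i * b i ∧ ∀ j, v j ≤ ∑ i, v i * b i := by
  by_cases h : ∃ i, 0 ≤ v i
  · obtain ⟨i0, h0⟩ := h
    obtain ⟨m, _, hm⟩ := Finset.exists_max_image univ v ⟨i0, Finset.mem_univ _⟩
    refine ⟨fun i => if i = m then 1 else 0, fun i => by dsimp only; split_ifs <;> norm_num, by simp, ?_, ?_⟩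
    · simpa using h0.trans (hm i0 (Finset.mem_univ _))
    · intro j; simpa using hm j (Finset.mem_univ _)
  · push Not at h
    exact ⟨fun _ => 0, by simp, by simp, by simp, fun j => by simpa using (h j).le⟩

lemma exists_alloc (cand : T → Fin n) (F : (Fin n → T) → ℝ) (hF : ∀ p, 0 ≤ F p)
    (y : T → ℝ) (hy0 : ∀ t, 0 ≤ y t)
    (hy : ∀ S : Finset T, ∑ t ∈ S, y t ≤
      ∑ p ∈ profiles cand, F p * (if ∃ i, p i ∈ S then 1 else 0)) :
    ∃ a : (Fin n → T) → Fin n → ℝ, (∀ p i, 0 ≤ a p i) ∧ (∀ p, ∑ i, a p i ≤ 1) ∧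
      ∀ t, ∑ p ∈ (profiles cand).filter (fun p => p (cand t) = t), F p * a p (cand t) = y t := by
  let K : Set ((Fin n → T) → Fin n → ℝ) := {a | (∀ p i, 0 ≤ a p i) ∧ (∀ p, ∑ i, a p i ≤ 1)}
  let L : ((Fin n → T) → Fin n → ℝ) →ₗ[ℝ] (T → ℝ) :=
    { toFun := fun a t =>
        ∑ p ∈ (profiles cand).filter (fun p => p (cand t) = t), F p * a p (cand t)
      map_add' := by
        intro a b; ext t; simp [mul_add, Finset.sum_add_distrib]
      map_smul' := by
        intro c a; ext t
        simp only [Pi.smul_apply, smul_eq_mul, RingHom.id_apply, Finset.mul_sum]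
        refine Finset.sum_congr rfl fun p _ => ?_
        ring }
  have hLc : Continuous L := L.continuous_of_finiteDimensional
  have hKc : IsCompact K := by
    have hcl : IsClosed K := by
      have : K = (⋂ p, ⋂ i, {a | 0 ≤ a p i}) ∩ ⋂ p, {a | ∑ i, a p i ≤ 1} := by
        ext a; simp [K]
      rw [this]
      refine IsClosed.inter (isClosed_iInter fun p => isClosed_iInter fun i => ?_)
        (isClosed_iInter fun p => ?_)
      · exact isClosed_le (by fun_prop) (by fun_prop)
      · exact isClosed_le (by fun_prop) (by fun_prop)
    refine (isCompact_Icc (a := (0 : (Fin n → T) → Fin n → ℝ)) (b := 1)).of_isClosed_subset hcl ?_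
    rintro a ⟨h1, h2⟩
    refine ⟨fun p i => h1 p i, fun p i => ?_⟩
    exact (Finset.single_le_sum (f := a p) (fun j _ => h1 p j) (Finset.mem_univ i)).trans (h2 p)
  have hKv : Convex ℝ K := by
    rintro a ⟨a1, a2⟩ b ⟨b1, b2⟩ c d hc hd hcd
    refine ⟨fun p i => ?_, fun p => ?_⟩
    · simp only [Pi.add_apply, Pi.smul_apply, smul_eq_mul]
      exact add_nonneg (mul_nonneg hc (a1 p i)) (mul_nonneg hd (b1 p i))
    · simp only [Pi.add_apply, Pi.smul_apply, smul_eq_mul, Finset.sum_add_distrib,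
        ← Finset.mul_sum]
      nlinarith [mul_le_mul_of_nonneg_left (a2 p) hc, mul_le_mul_of_nonneg_left (b2 p) hd]
  suffices h : y ∈ L '' K by
    obtain ⟨a, ha, hay⟩ := h
    exact ⟨a, ha.1, ha.2, fun t => congrFun hay t⟩
  by_contra hn
  obtain ⟨g, u, h1, h2⟩ := geometric_hahn_banach_closed_point (hKv.linear_image L)
    (hKc.image hLc).isClosed hn
  let w : T → ℝ := fun t => g (Pi.single t 1)
  have hg : ∀ z : T → ℝ, g z = ∑ t, w t * z t := by
    intro z
    conv_lhs => rw [← Finset.univ_sum_single z]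
    rw [map_sum]
    refine Finset.sum_congr rfl fun t _ => ?_
    have : (Pi.single t (z t) : T → ℝ) = z t • Pi.single t 1 := by
      rw [← Pi.single_smul]; simp
    rw [this, map_smul, smul_eq_mul, mul_comm]
  choose b hb0 hb1 hbn hbm using fun p : Fin n → T => best (fun i => w (p i))
  have hK := h1 _ ⟨b, ⟨hb0, hb1⟩, rfl⟩
  have e : g (L b) = ∑ p ∈ profiles cand, F p * ∑ i, w (p i) * b p i := by
    rw [hg, ← key]; rfl
  have hl := layer (profiles cand) F y hy hF _ (fun t => max (w t) 0)
    (fun p => ∑ i, w (p i) * b p i) le_rfl (fun t => le_max_right _ _) hbn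
    (fun p i => max_le (hbm p i) (hbn p))
  have h3 : g y ≤ ∑ t, max (w t) 0 * y t := by
    rw [hg]
    exact Finset.sum_le_sum fun t _ => mul_le_mul_of_nonneg_right (le_max_left _ _) (hy0 t)
  linarith

lemma exists_rule (a : (Fin n → T) → Fin n → ℝ) (h0 : ∀ p i, 0 ≤ a p i)
    (h1 : ∀ p, ∑ i, a p i ≤ 1) :
    ∃ A : (Fin n → T) → Finset (Fin n) → ℝ, (∀ p S, 0 ≤ A p S) ∧
      (∀ p, ∑ S : Finset (Fin n), A p S = 1) ∧ (∀ p S, A p S ≠ 0 → S.card ≤ 1) ∧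
      ∀ p k, ∑ S ∈ Finset.univ.filter (fun S : Finset (Fin n) => k ∈ S), A p S = a p k := by
  refine ⟨fun p S => (if S = ∅ then 1 - ∑ i, a p i else 0) + ∑ i, if S = {i} then a p i else 0,
    ?_, ?_, ?_, ?_⟩
  · intro p S
    refine add_nonneg ?_ (Finset.sum_nonneg fun i _ => ?_)
    · split_ifs
      · linarith [h1 p]
      · exact le_rfl
    · split_ifs
      · exact h0 p i
      · exact le_rfl
  · intro p
    rw [Finset.sum_add_distrib, Finset.sum_comm]
    simp
  · intro p S h
    by_contra hc
    apply h
    have e1 : S ≠ ∅ := by rintro rfl; simp at hc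
    have e2 : ∀ i, S ≠ {i} := by rintro i rfl; simp at hc
    simp [e1, e2]
  · intro p k
    rw [Finset.sum_add_distrib, Finset.sum_comm]
    have e1 : ∑ S ∈ Finset.univ.filter (fun S : Finset (Fin n) => k ∈ S),
        (if S = ∅ then 1 - ∑ i, a p i else 0) = 0 := by
      refine Finset.sum_eq_zero fun S hS => ?_
      have : S ≠ ∅ := by rintro rfl; simp at hS
      simp [this]
    rw [e1, zero_add]
    simp

theorem border
    (n : ℕ) (T : Type) [Fintype T] [DecidableEq T]
    (cand : T → Fin n) (f : T → ℝ)
    (hf0 : ∀ t, 0 ≤ f t)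
    (hf1 : ∀ i : Fin n, ∑ t ∈ Finset.univ.filter (fun t => cand t = i), f t = 1)
    (x : T → ℝ) (hx : ∀ t, 0 ≤ x t ∧ x t ≤ 1) :
    (∃ A, ImplementsRule cand f (fun S => S.card ≤ 1) A x) ↔
      ∀ S : Finset T,
        ∑ t ∈ S, f t * x t ≤
          1 - ∏ i : Fin n, (1 - ∑ t ∈ S.filter (fun t => cand t = i), f t) := by
  have hF : ∀ p : Fin n → T, 0 ≤ ∏ j, f (p j) := fun p => Finset.prod_nonneg fun j _ => hf0 _
  have hfac : ∀ (t : T) (a : (Fin n → T) → Fin n → ℝ),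
      ∑ p ∈ (profiles cand).filter (fun p => p (cand t) = t), (∏ j, f (p j)) * a p (cand t)
      = f t * ∑ p ∈ (profiles cand).filter (fun p => p (cand t) = t),
        (∏ j ∈ Finset.univ.erase (cand t), f (p j)) * a p (cand t) := by
    intro t a
    rw [Finset.mul_sum]
    refine Finset.sum_congr rfl fun p hp => ?_
    have h2 : p (cand t) = t := (Finset.mem_filter.1 hp).2
    rw [← Finset.mul_prod_erase univ _ (Finset.mem_univ (cand t)), h2, mul_assoc]
  constructor
  · rintro ⟨A, hA0, hA1, hAF, hAx⟩ S
    rw [← hit cand f hf1 S]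
    let a : (Fin n → T) → Fin n → ℝ := fun p k =>
      ∑ S ∈ Finset.univ.filter (fun S : Finset (Fin n) => k ∈ S), A p S
    have ha0 : ∀ p k, 0 ≤ a p k := fun p k => Finset.sum_nonneg fun S _ => hA0 p S
    have ha1 : ∀ p, ∑ k, a p k ≤ 1 := by
      intro p
      rw [← hA1 p]
      simp only [a, Finset.sum_filter]
      rw [Finset.sum_comm]
      refine Finset.sum_le_sum fun S _ => ?_
      rw [← Finset.sum_filter, Finset.filter_univ_mem, Finset.sum_const, nsmul_eq_mul]
      by_cases h : A p S = 0
      · simp [h]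
      · have : (S.card : ℝ) ≤ 1 := by exact_mod_cast hAF p S h
        nlinarith [hA0 p S]
    have e : ∑ t ∈ S, f t * x t = ∑ t, (if t ∈ S then 1 else 0) *
        (∑ p ∈ (profiles cand).filter (fun p => p (cand t) = t),
          (∏ j, f (p j)) * a p (cand t)) := by
      simp only [ite_mul, one_mul, zero_mul]
      rw [← Finset.sum_filter, Finset.filter_univ_mem]
      refine Finset.sum_congr rfl fun t _ => ?_
      rw [hfac, ← hAx t]
    rw [e, key cand (fun p => ∏ j, f (p j)) (fun t => if t ∈ S then 1 else 0)]
    refine Finset.sum_le_sum fun p _ => mul_le_mul_of_nonneg_left ?_ (hF p)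
    by_cases h : ∃ i, p i ∈ S
    · rw [if_pos h]
      refine le_trans (Finset.sum_le_sum fun i _ => ?_) (ha1 p)
      split_ifs
      · simp
      · simpa using ha0 p i
    · rw [if_neg h]
      push Not at h
      simp [h]
  · intro H
    obtain ⟨a, ha0, ha1, hay⟩ := exists_alloc cand (fun p => ∏ j, f (p j)) hF
      (fun t => f t * x t) (fun t => mul_nonneg (hf0 t) (hx t).1)
      (fun S => by rw [hit cand f hf1 S]; exact H S)
    classical
    let a' : (Fin n → T) → Fin n → ℝ := fun p i =>
      if ∃ j, j ≠ i ∧ f (p j) = 0 then 0 else if f (p i) = 0 then x (p i) else a p i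
    have ha'0 : ∀ p i, 0 ≤ a' p i := by
      intro p i
      simp only [a']
      split_ifs
      · exact le_rfl
      · exact (hx _).1
      · exact ha0 p i
    have ha'1 : ∀ p, ∑ i, a' p i ≤ 1 := by
      intro p
      by_cases h : ∃ k, f (p k) = 0
      · obtain ⟨k, hk⟩ := h
        rw [Finset.sum_eq_single k]
        · simp only [a', hk, if_true]
          split_ifs
          · exact zero_le_one
          · exact (hx _).2
        · intro i _ hi
          exact if_pos ⟨k, hi.symm, hk⟩
        · simp
      · push Not at h
        simpa [a', h] using ha1 p
    obtain ⟨A, hA0, hA1, hAF, hAa⟩ := exists_rule a' ha'0 ha'1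
    refine ⟨A, hA0, hA1, hAF, fun t => ?_⟩
    simp_rw [hAa]
    have hz : ∀ p ∈ (profiles cand).filter (fun p => p (cand t) = t),
        (∏ j ∈ Finset.univ.erase (cand t), f (p j)) * a' p (cand t)
        = (∏ j ∈ Finset.univ.erase (cand t), f (p j)) *
          (if f t = 0 then x t else a p (cand t)) := by
      intro p hp
      have h2 : p (cand t) = t := (Finset.mem_filter.1 hp).2
      by_cases h : ∃ j, j ≠ cand t ∧ f (p j) = 0
      · obtain ⟨j, hj, hj0⟩ := h
        rw [Finset.prod_eq_zero (Finset.mem_erase.2 ⟨hj, Finset.mem_univ j⟩) hj0]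
        simp
      · simp only [a', if_neg h, h2]
    rw [Finset.sum_congr rfl hz]
    by_cases h : f t = 0
    · simp only [h, if_true]
      rw [← Finset.sum_mul, cond_one cand f hf1, one_mul]
    · simp only [h, if_false]
      have := hay t
      rw [hfac] at this
      exact mul_left_cancel₀ h this

end Stmt7
end

section
/- In a single-winner environment with n ≥ 1 candidates whose types are drawn i.i.d. from a distribution f on a common finite type set T, a symmetric interim rule x : T → [0,1] is feasible if and only if for every subset S ⊆ T: n · Σ_{t∈S} f(t)·x(t) ≤ 1 − (1 − Σ_{t∈S} f(t))^n. -/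
/-!
Statement 8 (symmetric Border's theorem): In a single-winner environment with `n ≥ 1`
candidates whose types are drawn i.i.d. from a distribution `f` on a common finite type
set `T`, a symmetric interim rule `x : T → [0,1]` is feasible if and only if for every
subset `S ⊆ T`:
  `n * Σ_{t ∈ S} f t * x t ≤ 1 − (1 − Σ_{t ∈ S} f t) ^ n`.

Formalization conventions: a winner-selection rule is a randomized map
`A : (Fin n → T) → Finset (Fin n) → ℝ` from type profiles to distributions over feasible
sets (sets of at most one winner); it implements the symmetric rule `x` if for every
candidate `i` and type `t`, the conditional probability that `i` wins given `t_i = t`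
equals `x t`, where the other candidates' types are drawn i.i.d. from `f`.
-/

open Finset

namespace Stmt8

variable {n : ℕ} {T : Type} [Fintype T] [DecidableEq T]

/-- `A` is a single-winner rule implementing the symmetric interim rule `x` in the
i.i.d. environment with common prior `f`. -/
def ImplementsSym (n : ℕ) (f : T → ℝ)
    (A : (Fin n → T) → Finset (Fin n) → ℝ) (x : T → ℝ) : Prop :=
  (∀ p S, 0 ≤ A p S) ∧ (∀ p, ∑ S : Finset (Fin n), A p S = 1) ∧
  (∀ p S, A p S ≠ 0 → S.card ≤ 1) ∧
  ∀ (i : Fin n) (t : T),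
    ∑ p ∈ Finset.univ.filter (fun p : Fin n → T => p i = t),
      (∏ j ∈ Finset.univ.erase i, f (p j)) *
        (∑ S ∈ Finset.univ.filter (fun S : Finset (Fin n) => i ∈ S), A p S) = x t

/-- Feasible allocation probabilities. -/
def Feas (n : ℕ) (T : Type) (q : (Fin n → T) → Fin n → ℝ) : Prop :=
  (∀ p i, 0 ≤ q p i) ∧ ∀ p, ∑ i, q p i ≤ 1

lemma exists_rule_iff (n : ℕ) (T : Type) [Fintype T] [DecidableEq T] (f : T → ℝ) (x : T → ℝ) :
    (∃ A, ImplementsSym n f A x) ↔ ∃ q, Feas n T q ∧ ∀ (i : Fin n) (t : T),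
      ∑ p ∈ Finset.univ.filter (fun p : Fin n → T => p i = t),
        (∏ j ∈ Finset.univ.erase i, f (p j)) * q p i = x t := by
  constructor
  · rintro ⟨A, h0, h1, hc, h⟩
    refine ⟨fun p i => ∑ S ∈ Finset.univ.filter (fun S : Finset (Fin n) => i ∈ S), A p S,
      ⟨fun p i => Finset.sum_nonneg fun S _ => h0 p S, fun p => ?_⟩, h⟩
    simp only [Finset.sum_filter]
    rw [Finset.sum_comm, ← h1 p]
    refine Finset.sum_le_sum fun S _ => ?_
    rw [← Finset.sum_filter, Finset.sum_const, nsmul_eq_mul]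
    by_cases hA : A p S = 0
    · simp [hA]
    · have := hc p S hA
      have h2 : ((Finset.univ.filter (fun i => i ∈ S)).card : ℝ) ≤ 1 := by
        simpa using this
      nlinarith [h0 p S]
  · rintro ⟨q, ⟨h0, h1⟩, h⟩
    refine ⟨fun p S => (if S = ∅ then 1 - ∑ i, q p i else 0) + ∑ i, if S = {i} then q p i else 0,
      ?_, ?_, ?_, ?_⟩
    · intro p S
      have := h1 p
      refine add_nonneg ?_ (Finset.sum_nonneg fun i _ => ?_)
      · split_ifs <;> linarith
      · split_ifs
        · exact h0 p i
        · exact le_rfl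
    · intro p
      rw [Finset.sum_add_distrib, Finset.sum_comm]
      simp
    · intro p S hS
      by_contra hc
      apply hS
      beta_reduce
      rw [if_neg (by rintro rfl; simp at hc), zero_add]
      refine Finset.sum_eq_zero fun i _ => ?_
      rw [if_neg (by rintro rfl; simp at hc)]
    · intro i t
      rw [← h i t]
      refine Finset.sum_congr rfl fun p _ => ?_
      congr 1
      rw [Finset.sum_add_distrib, Finset.sum_comm]
      simp [Finset.sum_filter]

lemma prob_hit (n : ℕ) {T : Type} [Fintype T] [DecidableEq T] (f : T → ℝ)
    (hf1 : ∑ t : T, f t = 1) (S : Finset T) :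
    ∑ p : Fin n → T, (∏ j, f (p j)) * (if ∃ i, p i ∈ S then 1 else 0)
      = 1 - (1 - ∑ t ∈ S, f t) ^ n := by
  have e1 : ∑ p : Fin n → T, ∏ j, f (p j) = 1 := by
    have := Finset.prod_univ_sum (fun _ : Fin n => (Finset.univ : Finset T)) (fun _ t => f t)
    simp only [hf1, Fintype.piFinset_univ] at this
    simpa using this.symm
  have e2 : ∑ p : Fin n → T, (∏ j, f (p j)) * (if ∃ i, p i ∈ S then 0 else 1)
      = (1 - ∑ t ∈ S, f t) ^ n := by
    have h := Finset.prod_univ_sum (fun _ : Fin n => Sᶜ) (fun _ t => f t)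
    have h' : ∑ t ∈ Sᶜ, f t = 1 - ∑ t ∈ S, f t := by
      rw [← hf1, ← Finset.sum_add_sum_compl S f]; ring
    simp only [h', Finset.prod_const, Finset.card_univ, Fintype.card_fin] at h
    rw [h, ← Finset.sum_subset (Finset.subset_univ (Fintype.piFinset fun _ : Fin n => Sᶜ))]
    · refine Finset.sum_congr rfl fun p hp => ?_
      rw [Fintype.mem_piFinset] at hp
      rw [if_neg, mul_one]
      rintro ⟨i, hi⟩
      exact (Finset.mem_compl.1 (hp i)) hi
    · intro p _ hp
      rw [Fintype.mem_piFinset] at hp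
      push Not at hp
      obtain ⟨i, hi⟩ := hp
      rw [if_pos ⟨i, by simpa using hi⟩, mul_zero]
  rw [← e2, eq_sub_iff_add_eq, ← Finset.sum_add_distrib]
  conv_rhs => rw [← e1]
  refine Finset.sum_congr rfl fun p _ => ?_
  split_ifs <;> ring

lemma f_mul_interim (n : ℕ) {T : Type} [Fintype T] [DecidableEq T] (f : T → ℝ)
    (q : (Fin n → T) → Fin n → ℝ) (i : Fin n) (t : T) :
    f t * ∑ p ∈ Finset.univ.filter (fun p : Fin n → T => p i = t),
        (∏ j ∈ Finset.univ.erase i, f (p j)) * q p i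
      = ∑ p : Fin n → T, (∏ j, f (p j)) * (if p i = t then q p i else 0) := by
  rw [Finset.mul_sum, Finset.sum_filter]
  refine Finset.sum_congr rfl fun p _ => ?_
  split_ifs with h
  · rw [← Finset.mul_prod_erase Finset.univ (fun j => f (p j)) (Finset.mem_univ i), h]; ring
  · simp

lemma necessity (n : ℕ) {T : Type} [Fintype T] [DecidableEq T] (f : T → ℝ)
    (hf0 : ∀ t, 0 ≤ f t) (x : T → ℝ) (q : (Fin n → T) → Fin n → ℝ) (hq : Feas n T q)
    (h : ∀ (i : Fin n) (t : T), ∑ p ∈ Finset.univ.filter (fun p : Fin n → T => p i = t),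
        (∏ j ∈ Finset.univ.erase i, f (p j)) * q p i = x t) (S : Finset T) :
    (n : ℝ) * ∑ t ∈ S, f t * x t ≤
      ∑ p : Fin n → T, (∏ j, f (p j)) * (if ∃ i, p i ∈ S then 1 else 0) := by
  have e : (n : ℝ) * ∑ t ∈ S, f t * x t = ∑ _i : Fin n, ∑ t ∈ S, f t * x t := by simp
  have e2 : ∀ i : Fin n, ∑ t ∈ S, f t * x t
      = ∑ p : Fin n → T, (∏ j, f (p j)) * (if p i ∈ S then q p i else 0) := by
    intro i
    simp_rw [← h i, f_mul_interim]
    rw [Finset.sum_comm]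
    refine Finset.sum_congr rfl fun p _ => ?_
    rw [← Finset.mul_sum]
    simp
  rw [e, Finset.sum_congr rfl fun i _ => e2 i, Finset.sum_comm]
  refine Finset.sum_le_sum fun p _ => ?_
  rw [← Finset.mul_sum]
  refine mul_le_mul_of_nonneg_left ?_ (Finset.prod_nonneg fun j _ => hf0 _)
  split_ifs with hS
  · refine le_trans (Finset.sum_le_sum fun i _ => ?_) (hq.2 p)
    split_ifs
    · exact le_rfl
    · exact hq.1 p i
  · push Not at hS
    simp [hS]

lemma layer {P T : Type} [Fintype P] [Fintype T] [DecidableEq T] (μ : P → ℝ) (hμ : ∀ p, 0 ≤ μ p)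
    (y : T → ℝ) (hy : ∀ t, 0 ≤ y t) {n : ℕ} (g : P → Fin n → T)
    (hB : ∀ S : Finset T, ∑ t ∈ S, y t ≤ ∑ p, μ p * (if ∃ i, g p i ∈ S then 1 else 0)) :
    ∀ (k : ℕ) (w : T → ℝ) (M : P → ℝ), (Finset.univ.filter (fun t => 0 < w t)).card ≤ k →
      (∀ p, 0 ≤ M p) → (∀ p i, w (g p i) ≤ M p) → ∑ t, w t * y t ≤ ∑ p, μ p * M p := by
  intro k
  induction k with
  | zero =>
    intro w M hk hM hw
    have h1 : ∑ t, w t * y t ≤ 0 := by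
      refine Finset.sum_nonpos fun t _ => mul_nonpos_of_nonpos_of_nonneg ?_ (hy t)
      by_contra hc
      push Not at hc
      have : t ∈ Finset.univ.filter (fun t => 0 < w t) := by simp [hc]
      have := Finset.card_pos.2 ⟨t, this⟩
      omega
    exact h1.trans (Finset.sum_nonneg fun p _ => mul_nonneg (hμ p) (hM p))
  | succ k ih =>
    intro w M hk hM hw
    set S := Finset.univ.filter (fun t => 0 < w t) with hS
    rcases S.eq_empty_or_nonempty with he | hne
    · exact ih w M (by rw [← hS, he]; simp) hM hw
    obtain ⟨s, hs, hmin⟩ := Finset.exists_min_image S w hne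
    have hm : 0 < w s := by simpa [hS] using hs
    have key := ih (fun t => w t - w s * (if t ∈ S then 1 else 0))
      (fun p => M p - w s * (if ∃ i, g p i ∈ S then 1 else 0)) ?_ ?_ ?_
    · have hb := mul_le_mul_of_nonneg_left (hB S) hm.le
      have e1 : ∑ t, (w t - w s * (if t ∈ S then 1 else 0)) * y t
          = ∑ t, w t * y t - w s * ∑ t ∈ S, y t := by
        simp only [sub_mul, Finset.sum_sub_distrib, Finset.mul_sum]
        simp [mul_assoc]
      have e2 : ∑ p, μ p * (M p - w s * (if ∃ i, g p i ∈ S then 1 else 0))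
          = ∑ p, μ p * M p - w s * ∑ p, μ p * (if ∃ i, g p i ∈ S then 1 else 0) := by
        rw [Finset.mul_sum, ← Finset.sum_sub_distrib]
        exact Finset.sum_congr rfl fun p _ => by ring
      rw [e1, e2] at key
      linarith
    · refine Nat.le_of_lt_succ (lt_of_lt_of_le (Finset.card_lt_card ?_) hk)
      rw [Finset.ssubset_iff_of_subset]
      · exact ⟨s, hs, by simp [hs]⟩
      · intro t ht
        by_contra hc
        have h2 : 0 < w t := by simpa [hc] using ht
        exact hc (by simp [hS, h2])
    · intro p
      by_cases hp : ∃ i, g p i ∈ S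
      · obtain ⟨i, hi⟩ := hp
        have := hmin _ hi
        have := hw p i
        simp only [show ∃ i, g p i ∈ S from ⟨i, hi⟩, if_true]
        linarith
      · simp only [hp, if_false]
        linarith [hM p]
    · intro p i
      by_cases hi : g p i ∈ S
      · simp only [show ∃ i, g p i ∈ S from ⟨i, hi⟩, hi, if_true]
        linarith [hw p i]
      · have h0 : w (g p i) ≤ 0 := by
          by_contra hc
          exact hi (by simp [hS, not_le.1 hc])
        by_cases hp : ∃ i, g p i ∈ S
        · obtain ⟨j, hj⟩ := hp
          have := hmin _ hj
          have := hw p j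
          simp only [show ∃ i, g p i ∈ S from ⟨j, hj⟩, hi, if_true, if_false]
          linarith
        · simp only [hp, hi, if_false]
          linarith [hw p i]

lemma exists_anon (n : ℕ) {T : Type} [Fintype T] [DecidableEq T] (f : T → ℝ)
    (hf0 : ∀ t, 0 ≤ f t) (y : T → ℝ) (hy : ∀ t, 0 ≤ y t)
    (hB : ∀ S : Finset T, ∑ t ∈ S, y t ≤
      ∑ p : Fin n → T, (∏ j, f (p j)) * (if ∃ i, p i ∈ S then 1 else 0)) :
    ∃ q, Feas n T q ∧ ∀ t, ∑ p : Fin n → T, (∏ j, f (p j)) *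
      (∑ i, if p i = t then q p i else 0) = y t := by
  let Y : ((Fin n → T) → Fin n → ℝ) → T → ℝ := fun q t =>
    ∑ p : Fin n → T, (∏ j, f (p j)) * (∑ i, if p i = t then q p i else 0)
  let Q : Set ((Fin n → T) → Fin n → ℝ) := {q | Feas n T q}
  have hYc : Continuous Y := by
    refine continuous_pi fun t => continuous_finsetSum _ fun p _ =>
      continuous_const.mul (continuous_finsetSum _ fun i _ => ?_)
    split_ifs
    · fun_prop
    · fun_prop
  have hYadd : ∀ (a b : ℝ) q r, Y (a • q + b • r) = a • Y q + b • Y r := by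
    intro a b q r
    ext t
    simp only [Y, Pi.add_apply, Pi.smul_apply, smul_eq_mul, Finset.mul_sum, ← Finset.sum_add_distrib]
    refine Finset.sum_congr rfl fun p _ => Finset.sum_congr rfl fun i _ => ?_
    split_ifs <;> ring
  have hQcl : IsClosed Q := by
    have : Q = (⋂ p, ⋂ i, {q | 0 ≤ q p i}) ∩ ⋂ p, {q | ∑ i, q p i ≤ 1} := by
      ext q; simp [Q, Feas]
    rw [this]
    refine IsClosed.inter (isClosed_iInter fun p => isClosed_iInter fun i => ?_)
      (isClosed_iInter fun p => ?_)
    · exact isClosed_le continuous_const (by fun_prop)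
    · exact isClosed_le (by fun_prop) continuous_const
  have hQc : IsCompact Q := by
    refine IsCompact.of_isClosed_subset (isCompact_Icc (a := fun _ _ => (0:ℝ)) (b := fun _ _ => 1)) hQcl ?_
    intro q hq
    refine ⟨fun p i => hq.1 p i, fun p i => ?_⟩
    exact (Finset.single_le_sum (fun i _ => hq.1 p i) (Finset.mem_univ i)).trans (hq.2 p)
  have hQconv : Convex ℝ Q := by
    intro q hq r hr a b ha hb hab
    refine ⟨fun p i => ?_, fun p => ?_⟩
    · have := hq.1 p i
      have := hr.1 p i
      simp only [Pi.add_apply, Pi.smul_apply, smul_eq_mul]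
      positivity
    · simp only [Pi.add_apply, Pi.smul_apply, smul_eq_mul, Finset.sum_add_distrib, ← Finset.mul_sum]
      nlinarith [hq.2 p, hr.2 p]
  have hKconv : Convex ℝ (Y '' Q) := by
    rintro _ ⟨q, hq, rfl⟩ _ ⟨r, hr, rfl⟩ a b ha hb hab
    exact ⟨a • q + b • r, hQconv hq hr ha hb hab, hYadd a b q r⟩
  by_cases hmem : y ∈ Y '' Q
  · obtain ⟨q, hq, h⟩ := hmem
    exact ⟨q, hq, fun t => congrFun h t⟩
  exfalso
  obtain ⟨L, u, h1, h2⟩ := geometric_hahn_banach_closed_point hKconv (hQc.image hYc).isClosed hmem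
  let w : T → ℝ := fun t => L (Pi.single t 1)
  have hL : ∀ z : T → ℝ, L z = ∑ t, w t * z t := by
    intro z
    conv_lhs => rw [pi_eq_sum_univ' z]
    rw [map_sum]
    refine Finset.sum_congr rfl fun t _ => ?_
    rw [map_smul, smul_eq_mul, mul_comm]
  have hsel : ∀ p : Fin n → T, ∃ r : Fin n → ℝ, (∀ i, 0 ≤ r i) ∧ ∑ i, r i ≤ 1 ∧
      0 ≤ ∑ i, w (p i) * r i ∧ ∀ k, w (p k) ≤ ∑ i, w (p i) * r i := by
    intro p
    by_cases hp : ∃ i, 0 < w (p i)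
    · obtain ⟨i0, hi0⟩ := hp
      obtain ⟨m, _, hm⟩ := Finset.exists_max_image Finset.univ (fun i => w (p i)) ⟨i0, Finset.mem_univ _⟩
      refine ⟨fun i => if i = m then 1 else 0, fun i => by positivity, by simp, ?_, ?_⟩
      · simpa using hi0.le.trans (hm i0 (Finset.mem_univ _))
      · intro k; simpa using hm k (Finset.mem_univ _)
    · push Not at hp
      exact ⟨fun _ => 0, by simp, by simp, by simp, by simpa using hp⟩
  choose r hr0 hr1 hr2 hr3 using hsel
  have hfin := layer (fun p : Fin n → T => ∏ j, f (p j))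
    (fun p => Finset.prod_nonneg fun j _ => hf0 _) y hy (fun p => p) hB _ w
    (fun p => ∑ i, w (p i) * r p i) le_rfl hr2 hr3
  have h3 := h1 _ ⟨r, ⟨hr0, hr1⟩, rfl⟩
  rw [hL] at h2 h3
  have e : ∑ t, w t * Y r t = ∑ p : Fin n → T, (∏ j, f (p j)) * ∑ i, w (p i) * r p i := by
    simp only [Y, Finset.mul_sum]
    rw [Finset.sum_comm]
    refine Finset.sum_congr rfl fun p _ => ?_
    rw [Finset.sum_comm]
    refine Finset.sum_congr rfl fun i _ => ?_
    simp
    ring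
  linarith

lemma symmetrize (n : ℕ) (hn : 1 ≤ n) {T : Type} [Fintype T] [DecidableEq T] (f : T → ℝ)
    (z : T → ℝ) (q : (Fin n → T) → Fin n → ℝ) (hq : Feas n T q)
    (h : ∀ t, ∑ p : Fin n → T, (∏ j, f (p j)) * (∑ i, if p i = t then q p i else 0) = n * z t) :
    ∃ q, Feas n T q ∧ ∀ i t, ∑ p : Fin n → T, (∏ j, f (p j)) * (if p i = t then q p i else 0)
      = z t := by
  haveI : NeZero n := ⟨by omega⟩
  have hn0 : (0:ℝ) < n := by exact_mod_cast hn
  refine ⟨fun p i => (n:ℝ)⁻¹ * ∑ k : Fin n, q (fun j => p (j + k)) (i - k), ⟨?_, ?_⟩, ?_⟩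
  · intro p i
    exact mul_nonneg (by positivity) (Finset.sum_nonneg fun k _ => hq.1 _ _)
  · intro p
    rw [← Finset.mul_sum, Finset.sum_comm]
    have : ∑ k : Fin n, ∑ i, q (fun j => p (j + k)) (i - k) ≤ ∑ k : Fin n, (1:ℝ) := by
      refine Finset.sum_le_sum fun k _ => ?_
      exact (Equiv.sum_comp (Equiv.subRight k) (fun i => q (fun j => p (j + k)) i)).trans_le (hq.2 _)
    rw [inv_mul_le_iff₀ hn0]
    simpa using this
  · intro i t
    have e : ∀ k : Fin n, ∑ p : Fin n → T, (∏ j, f (p j)) *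
        (if p i = t then q (fun j => p (j + k)) (i - k) else 0)
        = ∑ p : Fin n → T, (∏ j, f (p j)) * (if p (i - k) = t then q p (i - k) else 0) := by
      intro k
      refine Fintype.sum_equiv ((Equiv.subRight k).arrowCongr (Equiv.refl T)) _ _ fun p => ?_
      have e1 : ((Equiv.subRight k).arrowCongr (Equiv.refl T)) p = fun j => p (j + k) := by
        ext j; simp [Equiv.arrowCongr]
      rw [e1, Equiv.prod_comp (Equiv.addRight k) (fun j => f (p j)) |>.symm]
      simp
    have e3 : ∑ k : Fin n, ∑ p : Fin n → T, (∏ j, f (p j)) *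
        (if p (i - k) = t then q p (i - k) else 0) = n * z t := by
      refine (Equiv.sum_comp (Equiv.subLeft i) (fun m => ∑ p : Fin n → T, (∏ j, f (p j)) *
        (if p m = t then q p m else 0))).trans ?_
      rw [Finset.sum_comm, ← h t]
      exact Finset.sum_congr rfl fun p _ => by rw [Finset.mul_sum]
    rw [← Finset.sum_congr rfl fun k _ => e k, Finset.sum_comm] at e3
    have e4 : z t = (n:ℝ)⁻¹ * (n * z t) := by field_simp
    rw [e4, ← e3, Finset.mul_sum]
    refine Finset.sum_congr rfl fun p _ => ?_
    split_ifs
    · rw [← Finset.mul_sum]; ring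
    · simp

lemma cond_total (n : ℕ) {T : Type} [Fintype T] [DecidableEq T] (f : T → ℝ)
    (hf1 : ∑ t : T, f t = 1) (i : Fin n) (t : T) :
    ∑ p ∈ Finset.univ.filter (fun p : Fin n → T => p i = t),
        (∏ j ∈ Finset.univ.erase i, f (p j)) = 1 := by
  have h := Finset.prod_univ_sum (fun j : Fin n => if j = i then {t} else (Finset.univ : Finset T))
    (fun j s => if j = i then 1 else f s)
  have h1 : ∏ j : Fin n, ∑ s ∈ (if j = i then {t} else (Finset.univ : Finset T)),
      (if j = i then 1 else f s) = 1 := by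
    refine Finset.prod_eq_one fun j _ => ?_
    by_cases hj : j = i <;> simp [hj, hf1]
  rw [← h1, h]
  refine Finset.sum_congr ?_ fun p _ => ?_
  · ext p
    simp only [Finset.mem_filter, Finset.mem_univ, true_and, Fintype.mem_piFinset]
    constructor
    · intro hp j
      by_cases hj : j = i
      · subst hj; simp [hp]
      · simp [hj]
    · intro hp
      simpa using hp i
  · rw [← Finset.mul_prod_erase Finset.univ _ (Finset.mem_univ i)]
    simp only [if_true, one_mul]
    refine Finset.prod_congr rfl fun j hj => ?_
    rw [if_neg (Finset.ne_of_mem_erase hj)]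

open Classical in
lemma sufficiency (n : ℕ) (hn : 1 ≤ n) {T : Type} [Fintype T] [DecidableEq T] (f : T → ℝ)
    (hf0 : ∀ t, 0 ≤ f t) (hf1 : ∑ t : T, f t = 1) (x : T → ℝ) (hx : ∀ t, 0 ≤ x t ∧ x t ≤ 1)
    (hB : ∀ S : Finset T, (n : ℝ) * ∑ t ∈ S, f t * x t ≤
      ∑ p : Fin n → T, (∏ j, f (p j)) * (if ∃ i, p i ∈ S then 1 else 0)) :
    ∃ q, Feas n T q ∧ ∀ (i : Fin n) (t : T),
      ∑ p ∈ Finset.univ.filter (fun p : Fin n → T => p i = t),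
        (∏ j ∈ Finset.univ.erase i, f (p j)) * q p i = x t := by
  obtain ⟨q0, hq0, h0⟩ := exists_anon n f hf0 (fun t => n * (f t * x t))
    (fun t => mul_nonneg (Nat.cast_nonneg n) (mul_nonneg (hf0 t) (hx t).1))
    (fun S => by rw [← Finset.mul_sum]; convert hB S)
  obtain ⟨q, hq, h⟩ := symmetrize n hn f (fun t => f t * x t) q0 hq0 h0
  refine ⟨fun p i => if f (p i) = 0 then (if ∀ j, j ≠ i → f (p j) ≠ 0 then x (p i) else 0)
    else if ∀ j, f (p j) ≠ 0 then q p i else 0, ⟨?_, ?_⟩, ?_⟩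
  · intro p i
    have := hq.1 p i
    have := (hx (p i)).1
    dsimp only
    split_ifs <;> first | assumption | exact le_rfl
  · intro p
    by_cases hp : ∀ j, f (p j) ≠ 0
    · simpa [hp] using hq.2 p
    · have hp' := hp
      push Not at hp'
      obtain ⟨k, hk⟩ := hp'
      rw [Finset.sum_eq_single k]
      · beta_reduce
        rw [if_pos hk]
        split_ifs
        · exact (hx _).2
        · exact zero_le_one
      · intro i _ hik
        beta_reduce
        rw [if_neg hp]
        have hc : ¬ ∀ j, j ≠ i → f (p j) ≠ 0 := fun hc => hc k (Ne.symm hik) hk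
        rw [if_neg hc, ite_self]
      · simp
  · intro i t
    by_cases ht : f t = 0
    · rw [← one_mul (x t), ← cond_total n f hf1 i t, Finset.sum_mul]
      refine Finset.sum_congr rfl fun p hp => ?_
      have hpi : p i = t := (Finset.mem_filter.1 hp).2
      beta_reduce
      rw [if_pos (by rw [hpi, ht]), hpi]
      split_ifs with hc
      · rfl
      · push Not at hc
        obtain ⟨j, hj, hj0⟩ := hc
        rw [Finset.prod_eq_zero (Finset.mem_erase.2 ⟨hj, Finset.mem_univ j⟩) hj0]
        simp
    · have e := h i t
      rw [← f_mul_interim] at e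
      rw [← mul_left_cancel₀ ht e]
      refine Finset.sum_congr rfl fun p hp => ?_
      have hpi : p i = t := (Finset.mem_filter.1 hp).2
      beta_reduce
      rw [if_neg (by rw [hpi]; exact ht)]
      split_ifs with hc
      · rfl
      · push Not at hc
        obtain ⟨j, hj0⟩ := hc
        have hj : j ≠ i := by rintro rfl; exact ht (hpi ▸ hj0)
        rw [Finset.prod_eq_zero (Finset.mem_erase.2 ⟨hj, Finset.mem_univ j⟩) hj0]
        simp

theorem symmetric_border
    (n : ℕ) (hn : 1 ≤ n) (T : Type) [Fintype T] [DecidableEq T]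
    (f : T → ℝ) (hf0 : ∀ t, 0 ≤ f t) (hf1 : ∑ t : T, f t = 1)
    (x : T → ℝ) (hx : ∀ t, 0 ≤ x t ∧ x t ≤ 1) :
    (∃ A, ImplementsSym n f A x) ↔
      ∀ S : Finset T,
        (n : ℝ) * ∑ t ∈ S, f t * x t ≤ 1 - (1 - ∑ t ∈ S, f t) ^ n := by
  rw [exists_rule_iff]
  constructor
  · rintro ⟨q, hq, h⟩ S
    rw [← prob_hit n f hf1 S]
    exact necessity n f hf0 x q hq h S
  · intro h
    refine sufficiency n hn f hf0 hf1 x hx (fun S => ?_)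
    rw [prob_hit n f hf1 S]
    exact h S

end Stmt8
end

section
/- In a single-winner environment, let f be the independent prior and x a feasible interim rule. If there are two or more barrier sets for (f, x), then there is a single candidate i* such that every barrier set is a singleton {t} with t ∈ T_{i*}. -/
/-!
Statement 10: In a single-winner environment with independent prior `f` and feasible
interim rule `x`, if there are two or more barrier sets for `(f, x)`, then there is a
single candidate `i*` such that every barrier set is a singleton `{t}` with `t` a type
of candidate `i*`.

Formalization conventions: candidates are `Fin n`; all types form the finite type `T`
with owner map `cand`; `f : T → ℝ` restricts to a probability distribution on each
candidate's type set.  For a set of types `S`,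
`fset S = 1 − Π_i (1 − Σ_{t ∈ S, cand t = i} f t)`, the slack is
`σ(S) = fset S − Σ_{t ∈ S} f t * x t`, `S` is tight if `σ(S) = 0`; the active types are
`T⁺ = {t : f t * x t > 0}`, and barrier sets are the inclusion-minimal nonempty tight
subsets of `T⁺` if a nonempty tight subset of `T⁺` exists, and `T⁺` itself otherwise.
-/

open Finset

namespace Stmt10

variable {n : ℕ} {T : Type} [Fintype T] [DecidableEq T]

/-- Valid type profiles. -/
def profiles (cand : T → Fin n) : Finset (Fin n → T) :=
  Finset.univ.filter fun p => ∀ i, cand (p i) = i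

/-- `A` is a winner-selection rule with feasible sets `Feas` implementing `x` for `f`. -/
def ImplementsRule (cand : T → Fin n) (f : T → ℝ) (Feas : Finset (Fin n) → Prop)
    (A : (Fin n → T) → Finset (Fin n) → ℝ) (x : T → ℝ) : Prop :=
  (∀ p S, 0 ≤ A p S) ∧ (∀ p, ∑ S : Finset (Fin n), A p S = 1) ∧
  (∀ p S, A p S ≠ 0 → Feas S) ∧
  ∀ t : T, ∑ p ∈ (profiles cand).filter (fun p => p (cand t) = t),
      (∏ j ∈ Finset.univ.erase (cand t), f (p j)) *
        (∑ S ∈ Finset.univ.filter (fun S : Finset (Fin n) => cand t ∈ S), A p S) = x t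

/-- The probability that at least one type in `S` shows up. -/
def fset (cand : T → Fin n) (f : T → ℝ) (S : Finset T) : ℝ :=
  1 - ∏ i : Fin n, (1 - ∑ t ∈ S.filter (fun t => cand t = i), f t)

/-- The slack of the Border constraint for `S`. -/
def slack (cand : T → Fin n) (f : T → ℝ) (x : T → ℝ) (S : Finset T) : ℝ :=
  fset cand f S - ∑ t ∈ S, f t * x t

/-- `S` is tight for `(f, x)`. -/
def Tight (cand : T → Fin n) (f : T → ℝ) (x : T → ℝ) (S : Finset T) : Prop :=
  slack cand f x S = 0

/-- The active types. -/
noncomputable def Tplus (f : T → ℝ) (x : T → ℝ) : Finset T :=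
  Finset.univ.filter fun t => 0 < f t * x t

/-- Barrier sets. -/
def IsBarrier (cand : T → Fin n) (f : T → ℝ) (x : T → ℝ) (S : Finset T) : Prop :=
  ((∃ C, C ⊆ Tplus f x ∧ C.Nonempty ∧ Tight cand f x C) ∧
    (S ⊆ Tplus f x ∧ S.Nonempty ∧ Tight cand f x S ∧
      ∀ C, C ⊆ Tplus f x → C.Nonempty → Tight cand f x C → C ⊆ S → C = S))
  ∨ ((¬ ∃ C, C ⊆ Tplus f x ∧ C.Nonempty ∧ Tight cand f x C) ∧ S = Tplus f x)

lemma compl_sum (cand : T → Fin n) (f : T → ℝ)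
    (hf1 : ∀ i : Fin n, ∑ t ∈ Finset.univ.filter (fun t => cand t = i), f t = 1)
    (S : Finset T) (i : Fin n) :
    1 - ∑ t ∈ S.filter (fun t => cand t = i), f t
      = ∑ t ∈ Finset.univ.filter (fun t => cand t = i ∧ t ∉ S), f t := by
  have h := Finset.sum_filter_add_sum_filter_not
    (Finset.univ.filter (fun t => cand t = i)) (fun t => t ∈ S) f
  rw [hf1 i, Finset.filter_filter, Finset.filter_filter] at h
  have e : S.filter (fun t => cand t = i)
      = Finset.univ.filter (fun t => cand t = i ∧ t ∈ S) := by
    ext t; simp [and_comm]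
  rw [e]; linarith

lemma profiles_eq (cand : T → Fin n) :
    profiles cand = Fintype.piFinset
      (fun i => Finset.univ.filter (fun t => cand t = i)) := by
  ext p; simp [profiles]

lemma fset_eq (cand : T → Fin n) (f : T → ℝ)
    (hf1 : ∀ i : Fin n, ∑ t ∈ Finset.univ.filter (fun t => cand t = i), f t = 1)
    (S : Finset T) :
    fset cand f S = ∑ p ∈ profiles cand,
      (∏ i, f (p i)) * (if ∃ i, p i ∈ S then (1 : ℝ) else 0) := by
  have h1 : ∑ p ∈ profiles cand, ∏ i, f (p i) = 1 := by
    rw [profiles_eq, ← Finset.prod_univ_sum]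
    simp [hf1]
  have h2 : ∏ i : Fin n, (1 - ∑ t ∈ S.filter (fun t => cand t = i), f t)
      = ∑ p ∈ profiles cand, (∏ i, f (p i)) * (if ∃ i, p i ∈ S then (0 : ℝ) else 1) := by
    simp_rw [compl_sum cand f hf1 S]
    rw [Finset.prod_univ_sum]
    have e : Fintype.piFinset
        (fun i => Finset.univ.filter (fun t => cand t = i ∧ t ∉ S))
        = (profiles cand).filter (fun p => ¬ ∃ i, p i ∈ S) := by
      ext p; simp [profiles, forall_and]
    rw [e, Finset.sum_filter]
    refine Finset.sum_congr rfl fun p _ => ?_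
    by_cases h : ∃ i, p i ∈ S
    · rw [if_neg (not_not.2 h), if_pos h, mul_zero]
    · rw [if_pos h, if_neg h, mul_one]
  unfold fset
  rw [h2]
  nth_rewrite 1 [← h1]
  rw [← Finset.sum_sub_distrib]
  refine Finset.sum_congr rfl fun p _ => ?_
  by_cases h : ∃ i, p i ∈ S
  · rw [if_pos h, if_pos h]; ring
  · rw [if_neg h, if_neg h]; ring

lemma interim_eq (cand : T → Fin n) (f : T → ℝ) (x : T → ℝ)
    (w : (Fin n → T) → Fin n → ℝ)
    (hw : ∀ t : T, ∑ p ∈ (profiles cand).filter (fun p => p (cand t) = t),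
      (∏ j ∈ Finset.univ.erase (cand t), f (p j)) * w p (cand t) = x t)
    (S : Finset T) :
    ∑ t ∈ S, f t * x t = ∑ p ∈ profiles cand,
      (∏ i, f (p i)) * ∑ i ∈ Finset.univ.filter (fun i => p i ∈ S), w p i := by
  have h1 : ∀ t ∈ S, f t * x t = ∑ p ∈ profiles cand,
      if p (cand t) = t then (∏ i, f (p i)) * w p (cand t) else 0 := by
    intro t _
    rw [← hw t, Finset.mul_sum, Finset.sum_filter]
    refine Finset.sum_congr rfl fun p _ => ?_
    split_ifs with h
    · rw [← Finset.mul_prod_erase Finset.univ (fun i => f (p i)) (Finset.mem_univ (cand t)), h]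
      ring
    · rfl
  rw [Finset.sum_congr rfl h1, Finset.sum_comm]
  refine Finset.sum_congr rfl fun p hp => ?_
  have hp' : ∀ i, cand (p i) = i := by simpa [profiles] using hp
  rw [Finset.mul_sum, ← Finset.sum_filter]
  refine Finset.sum_bij' (fun t _ => cand t) (fun i _ => p i) ?_ ?_ ?_ ?_ ?_
  · intro t ht
    simp only [Finset.mem_filter] at ht
    simp [ht.2, ht.1]
  · intro i hi
    simp only [Finset.mem_filter] at hi
    simp [hi.2, hp']
  · intro t ht
    simp only [Finset.mem_filter] at ht
    exact ht.2
  · intro i _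
    exact hp' i
  · intro t _; rfl

lemma tight_iff (cand : T → Fin n) (f : T → ℝ)
    (hf0 : ∀ t, 0 ≤ f t)
    (hf1 : ∀ i : Fin n, ∑ t ∈ Finset.univ.filter (fun t => cand t = i), f t = 1)
    (x : T → ℝ)
    (w : (Fin n → T) → Fin n → ℝ) (hw0 : ∀ p i, 0 ≤ w p i) (hw1 : ∀ p, ∑ i, w p i ≤ 1)
    (hw : ∀ t : T, ∑ p ∈ (profiles cand).filter (fun p => p (cand t) = t),
      (∏ j ∈ Finset.univ.erase (cand t), f (p j)) * w p (cand t) = x t)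
    (S : Finset T) :
    Tight cand f x S ↔ ∀ p ∈ profiles cand, (∏ i, f (p i)) ≠ 0 → (∃ i, p i ∈ S) →
      1 ≤ ∑ i ∈ Finset.univ.filter (fun i => p i ∈ S), w p i := by
  have hle : ∀ p, ∑ i ∈ Finset.univ.filter (fun i => p i ∈ S), w p i ≤ 1 := fun p =>
    (Finset.sum_le_sum_of_subset_of_nonneg (Finset.filter_subset _ _)
      (fun i _ _ => hw0 p i)).trans (hw1 p)
  unfold Tight slack
  rw [fset_eq cand f hf1, interim_eq cand f x w hw, ← Finset.sum_sub_distrib,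
    Finset.sum_eq_zero_iff_of_nonneg]
  · refine forall₂_congr fun p _ => ?_
    rw [← mul_sub, mul_eq_zero]
    by_cases h : ∃ i, p i ∈ S
    · rw [if_pos h]
      constructor
      · rintro (h0 | h0) h1 _
        · exact absurd h0 h1
        · linarith
      · intro H
        by_cases h1 : ∏ i, f (p i) = 0
        · exact Or.inl h1
        · have := H h1 h
          have := hle p
          right; linarith
    · rw [if_neg h]
      have : Finset.univ.filter (fun i => p i ∈ S) = ∅ := by
        ext i; simp only [Finset.mem_filter, Finset.notMem_empty, iff_false]
        exact fun hi => h ⟨i, hi.2⟩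
      simp [this, h]
  · intro p _
    rw [← mul_sub]
    refine mul_nonneg (Finset.prod_nonneg fun i _ => hf0 _) ?_
    by_cases h : ∃ i, p i ∈ S
    · rw [if_pos h]; linarith [hle p]
    · rw [if_neg h]
      have : Finset.univ.filter (fun i => p i ∈ S) = ∅ := by
        ext i; simp only [Finset.mem_filter, Finset.notMem_empty, iff_false]
        exact fun hi => h ⟨i, hi.2⟩
      simp [this]

lemma exists_w (cand : T → Fin n) (f : T → ℝ) (x : T → ℝ)
    (hfeas : ∃ A, ImplementsRule cand f (fun S => S.card ≤ 1) A x) :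
    ∃ w : (Fin n → T) → Fin n → ℝ, (∀ p i, 0 ≤ w p i) ∧ (∀ p, ∑ i, w p i ≤ 1) ∧
      ∀ t : T, ∑ p ∈ (profiles cand).filter (fun p => p (cand t) = t),
      (∏ j ∈ Finset.univ.erase (cand t), f (p j)) * w p (cand t) = x t := by
  obtain ⟨A, h0, h1, h2, h3⟩ := hfeas
  refine ⟨fun p i => ∑ S ∈ Finset.univ.filter (fun S : Finset (Fin n) => i ∈ S), A p S,
    fun p i => Finset.sum_nonneg fun S _ => h0 p S, fun p => ?_, h3⟩
  rw [← h1 p]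
  simp_rw [Finset.sum_filter]
  rw [Finset.sum_comm]
  refine Finset.sum_le_sum fun S _ => ?_
  rw [← Finset.sum_filter, Finset.sum_const, nsmul_eq_mul]
  have e : Finset.univ.filter (fun i => i ∈ S) = S := by ext; simp
  rw [e]
  by_cases h : A p S = 0
  · simp [h]
  · have : (S.card : ℝ) ≤ 1 := by exact_mod_cast h2 p S h
    nlinarith [h0 p S]

lemma pair (cand : T → Fin n) (f : T → ℝ)
    (hf0 : ∀ t, 0 ≤ f t)
    (hf1 : ∀ i : Fin n, ∑ t ∈ Finset.univ.filter (fun t => cand t = i), f t = 1)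
    (x : T → ℝ)
    (hfeas : ∃ A, ImplementsRule cand f (fun S => S.card ≤ 1) A x)
    (B₁ B₂ : Finset T) (hB₁ : IsBarrier cand f x B₁) (hB₂ : IsBarrier cand f x B₂)
    (hne : B₁ ≠ B₂) :
    ∃ t s : T, cand t = cand s ∧ B₁ = {t} ∧ B₂ = {s} := by
  obtain ⟨w, hw0, hw1, hw⟩ := exists_w cand f x hfeas
  have key := tight_iff cand f hf0 hf1 x w hw0 hw1 hw
  rcases hB₁ with ⟨hC, s1, n1, t1, m1⟩ | ⟨hC, e1⟩
  swap
  · rcases hB₂ with ⟨hC', -⟩ | ⟨-, e2⟩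
    · exact absurd hC' hC
    · exact absurd (e1.trans e2.symm) hne
  rcases hB₂ with ⟨-, s2, n2, t2, m2⟩ | ⟨hC', -⟩
  swap
  · exact absurd hC hC'
  have k1 := (key B₁).1 t1
  have k2 := (key B₂).1 t2
  have hui : ∀ p : Fin n → T, ∑ i ∈ Finset.univ.filter (fun i => p i ∈ B₁), w p i
      + ∑ i ∈ Finset.univ.filter (fun i => p i ∈ B₂), w p i
      ≤ 1 + ∑ i ∈ Finset.univ.filter (fun i => p i ∈ B₁ ∩ B₂), w p i := by
    intro p
    rw [← Finset.sum_union_inter]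
    have e : Finset.univ.filter (fun i => p i ∈ B₁) ∩ Finset.univ.filter (fun i => p i ∈ B₂)
        = Finset.univ.filter (fun i => p i ∈ B₁ ∩ B₂) := by
      ext i; simp
    rw [e]
    have := (Finset.sum_le_sum_of_subset_of_nonneg (Finset.subset_univ
      (Finset.univ.filter (fun i => p i ∈ B₁) ∪ Finset.univ.filter (fun i => p i ∈ B₂)))
      (fun i _ _ => hw0 p i)).trans (hw1 p)
    linarith
  have hdisj : B₁ ∩ B₂ = ∅ := by
    by_contra hn
    have hn' := Finset.nonempty_iff_ne_empty.2 hn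
    have ht : Tight cand f x (B₁ ∩ B₂) := by
      rw [key]
      rintro p hp hP ⟨i, hi⟩
      rw [Finset.mem_inter] at hi
      have a := k1 p hp hP ⟨i, hi.1⟩
      have b := k2 p hp hP ⟨i, hi.2⟩
      linarith [hui p]
    have a := m1 _ (Finset.inter_subset_left.trans s1) hn' ht Finset.inter_subset_left
    have b := m2 _ (Finset.inter_subset_left.trans s1) hn' ht Finset.inter_subset_right
    exact hne (a.symm.trans b)
  have hpos : ∀ t ∈ Tplus f x, f t ≠ 0 := by
    intro t ht h
    simp [Tplus, h] at ht
  have hq : ∀ i : Fin n, ∃ t, cand t = i ∧ f t ≠ 0 := by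
    intro i
    obtain ⟨t, ht, h⟩ := Finset.exists_ne_zero_of_sum_ne_zero
      (by rw [hf1 i]; exact one_ne_zero :
        ∑ t ∈ Finset.univ.filter (fun t => cand t = i), f t ≠ 0)
    exact ⟨t, by simpa using ht, h⟩
  choose q hq1 hq2 using hq
  have hsame : ∀ a ∈ B₁, ∀ b ∈ B₂, cand a = cand b := by
    intro a ha b hb
    by_contra hab
    let p : Fin n → T := fun i => if i = cand a then a else if i = cand b then b else q i
    have pa : p (cand a) = a := by simp [p]
    have pb : p (cand b) = b := by simp [p, Ne.symm hab]
    have hp : p ∈ profiles cand := by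
      simp only [profiles, Finset.mem_filter, Finset.mem_univ, true_and]
      intro i
      simp only [p]
      split_ifs with h h'
      · exact h.symm
      · exact h'.symm
      · exact hq1 i
    have hP : ∏ i, f (p i) ≠ 0 := by
      refine Finset.prod_ne_zero_iff.2 fun i _ => ?_
      simp only [p]
      split_ifs with h h'
      · exact hpos a (s1 ha)
      · exact hpos b (s2 hb)
      · exact hq2 i
    have u := k1 p hp hP ⟨cand a, by rwa [pa]⟩
    have v := k2 p hp hP ⟨cand b, by rwa [pb]⟩
    have := hui p
    rw [hdisj] at this
    simp only [Finset.notMem_empty, Finset.filter_false, Finset.sum_empty] at this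
    linarith
  have hsing : ∀ (B : Finset T) (c : Fin n), (∀ t ∈ B, cand t = c) → Tight cand f x B →
      ∀ t ∈ B, Tight cand f x {t} := by
    intro B c hc hB t ht
    rw [key]
    rintro p hp hP ⟨i, hi⟩
    have hp' : ∀ i, cand (p i) = i := by simpa [profiles] using hp
    have hi' : p i = t := by simpa using hi
    have := (key B).1 hB p hp hP ⟨i, by rwa [hi']⟩
    refine this.trans (Finset.sum_le_sum_of_subset_of_nonneg ?_ fun i _ _ => hw0 p i)
    intro j hj
    have hj' : p j ∈ B := by simpa using hj
    have : j = i := by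
      rw [← hp' j, hc _ hj', ← hp' i, hi', hc _ ht]
    subst this
    simp [hi']
  obtain ⟨a, ha⟩ := n1
  obtain ⟨b, hb⟩ := n2
  refine ⟨a, b, hsame a ha b hb, ?_, ?_⟩
  · have a1 : ({a} : Finset T) ⊆ B₁ := by simpa using ha
    exact (m1 {a} (a1.trans s1) (by simp)
      (hsing B₁ (cand b) (fun t ht => hsame t ht b hb) t1 a ha) a1).symm
  · have a1 : ({b} : Finset T) ⊆ B₂ := by simpa using hb
    exact (m2 {b} (a1.trans s2) (by simp)
      (hsing B₂ (cand a) (fun t ht => (hsame a ha t ht).symm) t2 b hb) a1).symm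

theorem multiple_barrier_sets_are_singletons
    (n : ℕ) (T : Type) [Fintype T] [DecidableEq T]
    (cand : T → Fin n) (f : T → ℝ)
    (hf0 : ∀ t, 0 ≤ f t)
    (hf1 : ∀ i : Fin n, ∑ t ∈ Finset.univ.filter (fun t => cand t = i), f t = 1)
    (x : T → ℝ) (hx : ∀ t, 0 ≤ x t ∧ x t ≤ 1)
    (hfeas : ∃ A, ImplementsRule cand f (fun S => S.card ≤ 1) A x)
    (B₁ B₂ : Finset T) (hB₁ : IsBarrier cand f x B₁) (hB₂ : IsBarrier cand f x B₂)
    (hne : B₁ ≠ B₂) :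
    ∃ istar : Fin n, ∀ B : Finset T, IsBarrier cand f x B →
      ∃ t : T, cand t = istar ∧ B = {t} := by
  obtain ⟨t, s, hts, e1, e2⟩ := pair cand f hf0 hf1 x hfeas B₁ B₂ hB₁ hB₂ hne
  refine ⟨cand t, fun B hB => ?_⟩
  by_cases h : B = B₁
  · exact ⟨t, rfl, h.trans e1⟩
  · obtain ⟨u, v, huv, e3, e4⟩ := pair cand f hf0 hf1 x hfeas B B₁ hB hB₁ h
    have : t = v := Finset.singleton_injective (e1.symm.trans e4)
    exact ⟨u, by rw [huv, this], e3⟩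

end Stmt10
end

section
/- In a single-winner environment, let f be the prior, x an interim rule, t* a type of candidate i* with f(t*)x(t*) < 1, and 0 ≤ q ≤ f(t*)x(t*). Let (f', x') = Decrement(f, x, t*, q). Then for every set of types S containing t*: σ_{f',x'}(S) = σ_{f,x}(S)/(1 − q). Consequently, the Border constraint for S is satisfied (respectively, tight) for (f', x') if and only if it is satisfied (respectively, tight) for (f, x). -/
/-!
Statement 11: In a single-winner environment, let `f` be the prior, `x` an interim rule,
`t*` a type of candidate `i* = cand t*` with `f t* * x t* < 1`, and `0 ≤ q ≤ f t* * x t*`.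
Let `(f', x') = Decrement(f, x, t*, q)`.  Then for every set of types `S` containing `t*`:
`σ_{f',x'}(S) = σ_{f,x}(S) / (1 − q)`.  Consequently, the Border constraint for `S` is
satisfied (resp. tight) for `(f', x')` iff it is satisfied (resp. tight) for `(f, x)`.

Formalization conventions: candidates `Fin n`, all types form the finite type `T` with
owner map `cand`; for `S : Finset T`,
`fset S = 1 − Π_i (1 − Σ_{t ∈ S, cand t = i} f t)` and
`σ_{f,x}(S) = fset S − Σ_{t ∈ S} f t * x t`.
-/

open Finset

namespace Stmt11

variable {n : ℕ} {T : Type} [Fintype T] [DecidableEq T]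

/-- The probability that at least one type in `S` shows up. -/
def fset (cand : T → Fin n) (f : T → ℝ) (S : Finset T) : ℝ :=
  1 - ∏ i : Fin n, (1 - ∑ t ∈ S.filter (fun t => cand t = i), f t)

/-- The slack of the Border constraint for `S`. -/
def slack (cand : T → Fin n) (f : T → ℝ) (x : T → ℝ) (S : Finset T) : ℝ :=
  fset cand f S - ∑ t ∈ S, f t * x t

/-- The prior produced by `Decrement(f, x, t*, q)`. -/
noncomputable def decF (cand : T → Fin n) (f : T → ℝ) (tstar : T) (q : ℝ) : T → ℝ :=
  fun t =>
    if t = tstar then (if q = f tstar then 0 else (f tstar - q) / (1 - q))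
    else if cand t = cand tstar then f t / (1 - q) else f t

/-- The interim rule produced by `Decrement(f, x, t*, q)`. -/
noncomputable def decX (cand : T → Fin n) (f : T → ℝ) (x : T → ℝ) (tstar : T) (q : ℝ) :
    T → ℝ := fun t =>
  if t = tstar then
    (if q = f tstar then 0 else (f tstar * x tstar - q) / (f tstar - q))
  else if cand t = cand tstar then x t else x t / (1 - q)

theorem decrement_slack
    (n : ℕ) (T : Type) [Fintype T] [DecidableEq T]
    (cand : T → Fin n) (f : T → ℝ)
    (hf0 : ∀ t, 0 ≤ f t)
    (hf1 : ∀ i : Fin n, ∑ t ∈ Finset.univ.filter (fun t => cand t = i), f t = 1)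
    (x : T → ℝ) (hx : ∀ t, 0 ≤ x t ∧ x t ≤ 1)
    (tstar : T) (hlt : f tstar * x tstar < 1)
    (q : ℝ) (hq0 : 0 ≤ q) (hq1 : q ≤ f tstar * x tstar) :
    ∀ S : Finset T, tstar ∈ S →
      (slack cand (decF cand f tstar q) (decX cand f x tstar q) S
          = slack cand f x S / (1 - q)) ∧
      ((0 ≤ slack cand (decF cand f tstar q) (decX cand f x tstar q) S
          ↔ 0 ≤ slack cand f x S) ∧
        (slack cand (decF cand f tstar q) (decX cand f x tstar q) S = 0
          ↔ slack cand f x S = 0)) := by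
  intro S hS
  have h1q : 0 < 1 - q := by linarith
  have hne : (1 - q) ≠ 0 := h1q.ne'
  have hF : ∀ t, cand t = cand tstar →
      decF cand f tstar q t = (f t - if t = tstar then q else 0) / (1 - q) := by
    intro t ht
    unfold decF
    by_cases h : t = tstar
    · subst h
      by_cases h2 : q = f t
      · simp [← h2]
      · simp [h2]
    · simp [h, ht]
  have hFX : ∀ t, decF cand f tstar q t * decX cand f x tstar q t
      = (f t * x t - if t = tstar then q else 0) / (1 - q) := by
    intro t
    unfold decF decX
    by_cases h : t = tstar
    · subst h
      by_cases h2 : q = f t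
      · have h3 : f t * x t = q := by
          have := mul_le_mul_of_nonneg_left (hx t).2 (hf0 t)
          linarith
        rw [h3]
        simp [h2]
      · have h3 : f t - q ≠ 0 := fun h => h2 (by linarith)
        simp only [if_true, if_neg h2]
        field_simp
    · by_cases h2 : cand t = cand tstar
      · simp [h, h2]; ring
      · simp [h, h2]; ring
  have hsum : ∑ t ∈ S, decF cand f tstar q t * decX cand f x tstar q t
      = (∑ t ∈ S, f t * x t - q) / (1 - q) := by
    rw [Finset.sum_congr rfl (fun t _ => hFX t), ← Finset.sum_div, Finset.sum_sub_distrib]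
    simp [hS]
  have hfac : ∀ i : Fin n,
      1 - ∑ t ∈ S.filter (fun t => cand t = i), decF cand f tstar q t
      = (1 - ∑ t ∈ S.filter (fun t => cand t = i), f t)
        * (if i = cand tstar then (1 - q)⁻¹ else 1) := by
    intro i
    by_cases hi : i = cand tstar
    · subst hi
      have hm : tstar ∈ S.filter (fun t => cand t = cand tstar) := by simp [hS]
      rw [Finset.sum_congr rfl (fun t ht => hF t (Finset.mem_filter.mp ht).2),
        ← Finset.sum_div, Finset.sum_sub_distrib, Finset.sum_ite_eq', if_pos hm, if_pos rfl]
      field_simp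
      ring
    · rw [if_neg hi, mul_one]
      congr 1
      apply Finset.sum_congr rfl
      intro t ht
      have h2 : cand t = i := (Finset.mem_filter.mp ht).2
      have h3 : cand t ≠ cand tstar := by rw [h2]; exact hi
      have h4 : t ≠ tstar := fun h => h3 (by rw [h])
      simp [decF, h3, h4]
  have key : slack cand (decF cand f tstar q) (decX cand f x tstar q) S
          = slack cand f x S / (1 - q) := by
    unfold slack fset
    rw [hsum, Finset.prod_congr rfl (fun i _ => hfac i), Finset.prod_mul_distrib,
      Finset.prod_ite_eq', if_pos (Finset.mem_univ _)]
    field_simp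
    ring
  refine ⟨key, ?_, ?_⟩
  · rw [key]
    rw [le_div_iff₀ h1q, zero_mul]
  · rw [key, div_eq_zero_iff]
    simp [hne]

end Stmt11
end

section
/- In a single-winner environment, let f be the prior, x an interim rule, t* a type of candidate i* with f(t*)x(t*) < 1, and 0 ≤ q ≤ f(t*)x(t*). Let (f_q, x_q) = Decrement(f, x, t*, q). Then for every set of types S not containing t*, writing S_i = S ∩ T_i: σ_{f_q,x_q}(S) = ( σ_{f,x}(S) − q·(1 − Π_{i≠i*}(1 − Σ_{t∈S_i} f(t))) ) / (1 − q). In particular, σ_{f_q,x_q}(S) ≥ 0 if and only if q ≤ σ_{f,x}(S) / (1 − Π_{i≠i*}(1 − Σ_{t∈S_i} f(t))) whenever the denominator is positive. -/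
/-!
Statement 12: In a single-winner environment, let `f` be the prior, `x` an interim rule,
`t*` a type of candidate `i* = cand t*` with `f t* * x t* < 1`, and `0 ≤ q ≤ f t* * x t*`.
Let `(f_q, x_q) = Decrement(f, x, t*, q)`.  Then for every set of types `S` not
containing `t*`:
`σ_{f_q,x_q}(S) = (σ_{f,x}(S) − q * (1 − Π_{i ≠ i*} (1 − Σ_{t ∈ S_i} f t))) / (1 − q)`.
In particular, `σ_{f_q,x_q}(S) ≥ 0` iff
`q ≤ σ_{f,x}(S) / (1 − Π_{i ≠ i*} (1 − Σ_{t ∈ S_i} f t))` whenever that denominator is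
positive.

Formalization conventions: candidates `Fin n`, all types form the finite type `T` with
owner map `cand`; for `S : Finset T`,
`fset S = 1 − Π_i (1 − Σ_{t ∈ S, cand t = i} f t)` and
`σ_{f,x}(S) = fset S − Σ_{t ∈ S} f t * x t`.
-/

open Finset

namespace Stmt12

variable {n : ℕ} {T : Type} [Fintype T] [DecidableEq T]

/-- The probability that at least one type in `S` shows up. -/
def fset (cand : T → Fin n) (f : T → ℝ) (S : Finset T) : ℝ :=
  1 - ∏ i : Fin n, (1 - ∑ t ∈ S.filter (fun t => cand t = i), f t)

/-- The slack of the Border constraint for `S`. -/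
def slack (cand : T → Fin n) (f : T → ℝ) (x : T → ℝ) (S : Finset T) : ℝ :=
  fset cand f S - ∑ t ∈ S, f t * x t

/-- The prior produced by `Decrement(f, x, t*, q)`. -/
noncomputable def decF (cand : T → Fin n) (f : T → ℝ) (tstar : T) (q : ℝ) : T → ℝ :=
  fun t =>
    if t = tstar then (if q = f tstar then 0 else (f tstar - q) / (1 - q))
    else if cand t = cand tstar then f t / (1 - q) else f t

/-- The interim rule produced by `Decrement(f, x, t*, q)`. -/
noncomputable def decX (cand : T → Fin n) (f : T → ℝ) (x : T → ℝ) (tstar : T) (q : ℝ) :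
    T → ℝ := fun t =>
  if t = tstar then
    (if q = f tstar then 0 else (f tstar * x tstar - q) / (f tstar - q))
  else if cand t = cand tstar then x t else x t / (1 - q)

theorem decrement_slack_not_containing
    (n : ℕ) (T : Type) [Fintype T] [DecidableEq T]
    (cand : T → Fin n) (f : T → ℝ)
    (hf0 : ∀ t, 0 ≤ f t)
    (hf1 : ∀ i : Fin n, ∑ t ∈ Finset.univ.filter (fun t => cand t = i), f t = 1)
    (x : T → ℝ) (hx : ∀ t, 0 ≤ x t ∧ x t ≤ 1)
    (tstar : T) (hlt : f tstar * x tstar < 1)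
    (q : ℝ) (hq0 : 0 ≤ q) (hq1 : q ≤ f tstar * x tstar) :
    ∀ S : Finset T, tstar ∉ S →
      (slack cand (decF cand f tstar q) (decX cand f x tstar q) S
          = (slack cand f x S -
              q * (1 - ∏ i ∈ Finset.univ.erase (cand tstar),
                    (1 - ∑ t ∈ S.filter (fun t => cand t = i), f t))) / (1 - q)) ∧
      (0 < (1 - ∏ i ∈ Finset.univ.erase (cand tstar),
              (1 - ∑ t ∈ S.filter (fun t => cand t = i), f t)) →
        (0 ≤ slack cand (decF cand f tstar q) (decX cand f x tstar q) S ↔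
          q ≤ slack cand f x S /
              (1 - ∏ i ∈ Finset.univ.erase (cand tstar),
                    (1 - ∑ t ∈ S.filter (fun t => cand t = i), f t)))) := by
  intro S hS
  have hq : 0 < 1 - q := by linarith
  have key : slack cand (decF cand f tstar q) (decX cand f x tstar q) S
          = (slack cand f x S -
              q * (1 - ∏ i ∈ Finset.univ.erase (cand tstar),
                    (1 - ∑ t ∈ S.filter (fun t => cand t = i), f t))) / (1 - q) := by
    have hne : ∀ t ∈ S, t ≠ tstar := fun t ht h => hS (h ▸ ht)
    have h1 : ∑ t ∈ S, decF cand f tstar q t * decX cand f x tstar q t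
        = (∑ t ∈ S, f t * x t) / (1 - q) := by
      rw [Finset.sum_div]
      refine Finset.sum_congr rfl fun t ht => ?_
      unfold decF decX
      rw [if_neg (hne t ht), if_neg (hne t ht)]
      split_ifs <;> ring
    have h2 : ∏ i ∈ Finset.univ.erase (cand tstar),
          (1 - ∑ t ∈ S.filter (fun t => cand t = i), decF cand f tstar q t)
        = ∏ i ∈ Finset.univ.erase (cand tstar),
          (1 - ∑ t ∈ S.filter (fun t => cand t = i), f t) := by
      refine Finset.prod_congr rfl fun i hi => ?_
      congr 1
      refine Finset.sum_congr rfl fun t ht => ?_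
      rw [Finset.mem_filter] at ht
      unfold decF
      rw [if_neg (hne t ht.1), if_neg]
      rw [ht.2]
      exact Finset.ne_of_mem_erase hi
    have h3 : ∑ t ∈ S.filter (fun t => cand t = cand tstar), decF cand f tstar q t
        = (∑ t ∈ S.filter (fun t => cand t = cand tstar), f t) / (1 - q) := by
      rw [Finset.sum_div]
      refine Finset.sum_congr rfl fun t ht => ?_
      rw [Finset.mem_filter] at ht
      unfold decF
      rw [if_neg (hne t ht.1), if_pos ht.2]
    unfold slack fset
    rw [h1, ← Finset.mul_prod_erase Finset.univ _ (Finset.mem_univ (cand tstar)), h2, h3,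
      ← Finset.mul_prod_erase Finset.univ
        (fun i => 1 - ∑ t ∈ S.filter (fun t => cand t = i), f t)
        (Finset.mem_univ (cand tstar))]
    field_simp
    ring
  refine ⟨key, fun hpos => ?_⟩
  rw [key, le_div_iff₀ hpos, le_div_iff₀ hq, zero_mul, sub_nonneg]

end Stmt12
end

section
/- In a single-winner environment, let f be the prior and x a feasible interim rule, and let t* be a type of candidate i* with x(t*) = 1 and f(t*) < 1. Let (f̂, x̂) = Decrement(f, x, t*, f(t*)). Then for every set of types S not containing t*: σ_{f̂,x̂}(S) = σ_{f,x}(S ∪ {t*}) / (1 − f(t*)), which is nonnegative. Consequently, q = f(t*) is a feasible choice of decrement probability: x̂ satisfies all Border constraints for f̂. -/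
/-!
Statement 13: In a single-winner environment, let `f` be the prior, `x` a feasible
interim rule (all Border constraints hold), and `t*` a type of candidate `i* = cand t*`
with `x t* = 1` and `f t* < 1`.  Let `(f̂, x̂) = Decrement(f, x, t*, f t*)`.  Then for
every set of types `S` not containing `t*`:
`σ_{f̂,x̂}(S) = σ_{f,x}(S ∪ {t*}) / (1 − f t*) ≥ 0`.  Consequently, `q = f t*` is a
feasible decrement probability: `x̂` satisfies all Border constraints for `f̂`.

Formalization conventions: candidates `Fin n`, all types form the finite type `T` with
owner map `cand`; for `S : Finset T`,
`fset S = 1 − Π_i (1 − Σ_{t ∈ S, cand t = i} f t)` and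
`σ_{f,x}(S) = fset S − Σ_{t ∈ S} f t * x t`.
-/

open Finset

namespace Stmt13

variable {n : ℕ} {T : Type} [Fintype T] [DecidableEq T]

/-- The probability that at least one type in `S` shows up. -/
def fset (cand : T → Fin n) (f : T → ℝ) (S : Finset T) : ℝ :=
  1 - ∏ i : Fin n, (1 - ∑ t ∈ S.filter (fun t => cand t = i), f t)

/-- The slack of the Border constraint for `S`. -/
def slack (cand : T → Fin n) (f : T → ℝ) (x : T → ℝ) (S : Finset T) : ℝ :=
  fset cand f S - ∑ t ∈ S, f t * x t

/-- The prior produced by `Decrement(f, x, t*, q)`. -/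
noncomputable def decF (cand : T → Fin n) (f : T → ℝ) (tstar : T) (q : ℝ) : T → ℝ :=
  fun t =>
    if t = tstar then (if q = f tstar then 0 else (f tstar - q) / (1 - q))
    else if cand t = cand tstar then f t / (1 - q) else f t

/-- The interim rule produced by `Decrement(f, x, t*, q)`. -/
noncomputable def decX (cand : T → Fin n) (f : T → ℝ) (x : T → ℝ) (tstar : T) (q : ℝ) :
    T → ℝ := fun t =>
  if t = tstar then
    (if q = f tstar then 0 else (f tstar * x tstar - q) / (f tstar - q))
  else if cand t = cand tstar then x t else x t / (1 - q)

theorem decrement_full_probability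
    (n : ℕ) (T : Type) [Fintype T] [DecidableEq T]
    (cand : T → Fin n) (f : T → ℝ)
    (hf0 : ∀ t, 0 ≤ f t)
    (hf1 : ∀ i : Fin n, ∑ t ∈ Finset.univ.filter (fun t => cand t = i), f t = 1)
    (x : T → ℝ) (hx : ∀ t, 0 ≤ x t ∧ x t ≤ 1)
    (hfeas : ∀ S : Finset T, 0 ≤ slack cand f x S)
    (tstar : T) (hx1 : x tstar = 1) (hflt : f tstar < 1) :
    (∀ S : Finset T, tstar ∉ S →
      slack cand (decF cand f tstar (f tstar)) (decX cand f x tstar (f tstar)) S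
        = slack cand f x (S ∪ {tstar}) / (1 - f tstar) ∧
      0 ≤ slack cand (decF cand f tstar (f tstar)) (decX cand f x tstar (f tstar)) S) ∧
    ∀ S : Finset T,
      0 ≤ slack cand (decF cand f tstar (f tstar)) (decX cand f x tstar (f tstar)) S := by
  have hq : (1 - f tstar) ≠ 0 := by linarith
  have hq0 : 0 < 1 - f tstar := by linarith
  have key : ∀ S : Finset T, tstar ∉ S →
      slack cand (decF cand f tstar (f tstar)) (decX cand f x tstar (f tstar)) S
        = slack cand f x (S ∪ {tstar}) / (1 - f tstar) := by
    intro S hS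
    have hU : S ∪ {tstar} = insert tstar S := by
      ext t; simp [or_comm]
    have hsum : ∑ t ∈ S, decF cand f tstar (f tstar) t * decX cand f x tstar (f tstar) t
        = (∑ t ∈ S, f t * x t) / (1 - f tstar) := by
      rw [Finset.sum_div]
      refine Finset.sum_congr rfl fun t ht => ?_
      have hne : t ≠ tstar := fun h => hS (h ▸ ht)
      by_cases hc : cand t = cand tstar
      · simp only [decF, decX, hne, hc, if_true, if_false]; ring
      · simp only [decF, decX, hne, hc, if_false]; ring
    have hfac : ∀ i : Fin n,
        (1 - ∑ t ∈ S.filter (fun t => cand t = i), decF cand f tstar (f tstar) t)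
        = (1 - ∑ t ∈ (insert tstar S).filter (fun t => cand t = i), f t)
          * (if i = cand tstar then (1 - f tstar)⁻¹ else 1) := by
      intro i
      by_cases hi : i = cand tstar
      · subst hi
        have h1 : ∑ t ∈ S.filter (fun t => cand t = cand tstar), decF cand f tstar (f tstar) t
            = (∑ t ∈ S.filter (fun t => cand t = cand tstar), f t) / (1 - f tstar) := by
          rw [Finset.sum_div]
          refine Finset.sum_congr rfl fun t ht => ?_
          rw [Finset.mem_filter] at ht
          have hne : t ≠ tstar := fun h => hS (h ▸ ht.1)
          simp only [decF, hne, ht.2, if_true, if_false]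
        rw [h1, Finset.filter_insert, if_pos rfl, Finset.sum_insert (by simp [hS]), if_pos rfl]
        field_simp
        ring
      · rw [Finset.filter_insert, if_neg (fun h => hi h.symm), if_neg hi, mul_one]
        congr 1
        refine Finset.sum_congr rfl fun t ht => ?_
        rw [Finset.mem_filter] at ht
        have hne : t ≠ tstar := fun h => hS (h ▸ ht.1)
        have hc : cand t ≠ cand tstar := fun h => hi (ht.2 ▸ h)
        simp only [decF, hne, hc, if_false]
    rw [hU]
    unfold slack fset
    rw [hsum, Finset.prod_congr rfl (fun i _ => hfac i), Finset.prod_mul_distrib,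
      Finset.prod_ite_eq' Finset.univ (cand tstar), if_pos (Finset.mem_univ _),
      Finset.sum_insert hS, hx1]
    field_simp
    ring
  have hnn : ∀ S : Finset T, tstar ∉ S →
      0 ≤ slack cand (decF cand f tstar (f tstar)) (decX cand f x tstar (f tstar)) S := by
    intro S hS
    rw [key S hS]
    exact div_nonneg (hfeas _) hq0.le
  refine ⟨fun S hS => ⟨key S hS, hnn S hS⟩, fun S => ?_⟩
  have h0 : decF cand f tstar (f tstar) tstar = 0 := by simp [decF]
  have he : slack cand (decF cand f tstar (f tstar)) (decX cand f x tstar (f tstar)) S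
      = slack cand (decF cand f tstar (f tstar)) (decX cand f x tstar (f tstar))
        (S.erase tstar) := by
    unfold slack fset
    congr 1
    · congr 1
      refine Finset.prod_congr rfl fun i _ => ?_
      congr 1
      rw [Finset.filter_erase, Finset.sum_erase _ h0]
    · rw [Finset.sum_erase]
      rw [h0, zero_mul]
  rw [he]
  exact hnn _ (by simp)

end Stmt13
end

section
/- Consider a single-winner environment with n ≥ 2 candidates whose types are drawn i.i.d. from a distribution f on a common finite type set T. If x : T → [0,1] is a feasible symmetric interim rule, then x admits a symmetric dice-based implementation: there exist dice (D_t)_{t∈T}, the same for all candidates, such that the single-winner dice-based rule (each candidate rolls the die of its realized type; the candidate with the highest positive score wins, ties broken uniformly at random; no one wins if all scores are negative) gives every candidate conditional winning probability x(t) given that its type is t. -/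
/-!
Statement 14: In a single-winner environment with `n ≥ 2` candidates whose types are
drawn i.i.d. from a distribution `f` on a common finite type set `T`, every feasible
symmetric interim rule `x : T → [0,1]` admits a symmetric dice-based implementation:
there exist dice `(D_t)_{t ∈ T}` (the same for all candidates) such that the
single-winner dice-based rule — each candidate independently rolls the die of its
realized type; the candidate with the highest positive score wins, ties broken uniformly
at random (realized by averaging over a uniformly random tie-breaking permutation);
nobody wins if all scores are negative — gives every candidate conditional winning
probability `x t` given that its type is `t`.
-/

open MeasureTheory Finset

namespace Stmt14

variable {n : ℕ} {T : Type} [Fintype T] [DecidableEq T]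

/-- `A` is a single-winner rule implementing the symmetric interim rule `x` in the
i.i.d. environment with common prior `f`. -/
def ImplementsSym (n : ℕ) (f : T → ℝ)
    (A : (Fin n → T) → Finset (Fin n) → ℝ) (x : T → ℝ) : Prop :=
  (∀ p S, 0 ≤ A p S) ∧ (∀ p, ∑ S : Finset (Fin n), A p S = 1) ∧
  (∀ p S, A p S ≠ 0 → S.card ≤ 1) ∧
  ∀ (i : Fin n) (t : T),
    ∑ p ∈ Finset.univ.filter (fun p : Fin n → T => p i = t),
      (∏ j ∈ Finset.univ.erase i, f (p j)) *
        (∑ S ∈ Finset.univ.filter (fun S : Finset (Fin n) => i ∈ S), A p S) = x t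

/-- Single-winner winning predicate with permutation tie-breaking: `i` wins iff its score
is positive and it beats every other candidate (higher score, or equal score and higher
tie-breaking rank). -/
def WinsSW (s : Fin n → ℝ) (π : Equiv.Perm (Fin n)) (i : Fin n) : Prop :=
  0 < s i ∧ ∀ j, j ≠ i → (s j < s i ∨ (s j = s i ∧ π j < π i))

/-- Probability that candidate `i` wins under independent die rolls `d` with uniform
tie-breaking. -/
noncomputable def winProbSW (d : Fin n → Measure ℝ) (i : Fin n) : ℝ :=
  (∑ π : Equiv.Perm (Fin n), ((Measure.pi d) {s | WinsSW s π i}).toReal) / (Nat.factorial n)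

/-- Conditional winning probability of candidate `i` given that its type is `t`, under
the symmetric dice `D` in the i.i.d. environment with common prior `f`. -/
noncomputable def diceInterimSym (n : ℕ) (f : T → ℝ) (D : T → Measure ℝ)
    (i : Fin n) (t : T) : ℝ :=
  ∑ p ∈ Finset.univ.filter (fun p : Fin n → T => p i = t),
    (∏ j ∈ Finset.univ.erase i, f (p j)) * winProbSW (fun j => D (p j)) i

lemma win_measure {k : ℕ} (d : Fin (k+1) → Measure ℝ) [∀ j, IsProbabilityMeasure (d j)]
    (i : Fin (k+1)) (hd : ∀ j, j ≠ i → ∀ a, d j {a} = 0) (π : Equiv.Perm (Fin (k+1))) :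
    ((Measure.pi d) {s | WinsSW s π i}).toReal =
      ∫ s, (if 0 < s then ∏ j ∈ Finset.univ.erase i, (d j).real (Set.Iio s) else 0) ∂(d i) := by
  have hmp := measurePreserving_piFinSuccAbove (α := fun _ => ℝ) (fun j => d j) i
  have key : ∀ s : ℝ, (Measure.pi (fun j => d (i.succAbove j)))
      {r : Fin k → ℝ | WinsSW (i.insertNth s r : Fin (k+1) → ℝ) π i} =
      ENNReal.ofReal (if 0 < s then ∏ j ∈ Finset.univ.erase i, (d j).real (Set.Iio s) else 0) := by
    intro s
    by_cases hs : 0 < s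
    · have h1 : (Measure.pi (fun j => d (i.succAbove j)))
          {r : Fin k → ℝ | WinsSW (i.insertNth s r : Fin (k+1) → ℝ) π i} =
          (Measure.pi (fun j => d (i.succAbove j))) (Set.univ.pi fun _ => Set.Iio s) := by
        apply measure_congr
        have hae : ∀ j : Fin k, ∀ᵐ r ∂(Measure.pi (fun j => d (i.succAbove j))), r j ≠ s := by
          intro j
          have hq := (measurePreserving_eval (fun j => d (i.succAbove j)) j)
          have := hq.quasiMeasurePreserving.ae (p := fun y => y ≠ s) (by
            rw [ae_iff]; simpa using hd _ (Fin.succAbove_ne i j) s)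
          exact this
        filter_upwards [ae_all_iff.2 hae] with r hr
        apply propext
        change WinsSW (i.insertNth s r : Fin (k+1) → ℝ) π i ↔ r ∈ (Set.univ.pi fun _ => Set.Iio s)
        simp only [WinsSW, Fin.insertNth_apply_same, hs, true_and, Set.mem_pi, Set.mem_univ,
          Set.mem_Iio, forall_true_left]
        constructor
        · intro h j
          have := h (i.succAbove j) (Fin.succAbove_ne i j)
          simp only [Fin.insertNth_apply_succAbove] at this
          rcases this with h | h
          · exact h
          · exact absurd h.1 (hr j)
        · intro h j hj
          obtain ⟨l, rfl⟩ := Fin.exists_succAbove_eq hj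
          left
          simpa using h l
      rw [h1, Measure.pi_pi, if_pos hs]
      have h2 : (Finset.univ.erase i) = Finset.univ.map i.succAboveEmb := by
        ext j; simp only [mem_erase, mem_univ, and_true, mem_map, true_and, Fin.succAboveEmb_apply]
        constructor
        · intro h; exact Fin.exists_succAbove_eq h
        · rintro ⟨a, rfl⟩; exact Fin.succAbove_ne i a
      rw [h2, Finset.prod_map, ENNReal.ofReal_prod_of_nonneg (fun _ _ => measureReal_nonneg)]
      refine Finset.prod_congr rfl fun j _ => ?_
      simp
    · rw [if_neg hs]
      have : {r : Fin k → ℝ | WinsSW (i.insertNth s r : Fin (k+1) → ℝ) π i} = ∅ := by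
        ext r; simp [WinsSW, hs]
      simp [this]
  have hmeas : MeasurableSet {s : Fin (k+1) → ℝ | WinsSW s π i} := by
    unfold WinsSW
    refine MeasurableSet.inter (measurableSet_lt measurable_const (measurable_pi_apply i)) ?_
    have : {s : Fin (k+1) → ℝ | ∀ j, j ≠ i → (s j < s i ∨ (s j = s i ∧ π j < π i))} =
      ⋂ j, ⋂ (_ : j ≠ i), ({s | s j < s i} ∪ ({s | s j = s i} ∩ {_s | π j < π i})) := by
      ext s; simp
    change MeasurableSet {s : Fin (k+1) → ℝ | ∀ j, j ≠ i → (s j < s i ∨ (s j = s i ∧ π j < π i))}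
    rw [this]
    refine MeasurableSet.iInter fun j => MeasurableSet.iInter fun _ => ?_
    exact (measurableSet_lt (measurable_pi_apply j) (measurable_pi_apply i)).union
      ((measurableSet_eq_fun (measurable_pi_apply j) (measurable_pi_apply i)).inter
        (MeasurableSet.const _))
  have hmeas2 := (MeasurableEquiv.piFinSuccAbove (fun _ => ℝ) i).symm.measurable hmeas
  have h3 : Measure.pi d {s | WinsSW s π i} = ∫⁻ s, ENNReal.ofReal
      (if 0 < s then ∏ j ∈ Finset.univ.erase i, (d j).real (Set.Iio s) else 0) ∂(d i) := by
    have h4 := hmp.symm.measure_preimage hmeas.nullMeasurableSet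
    rw [← h4, Measure.prod_apply hmeas2]
    refine lintegral_congr fun s => ?_
    rw [← key s]
    rfl
  have hm : Measurable fun s : ℝ => (if 0 < s then ∏ j ∈ Finset.univ.erase i, (d j).real (Set.Iio s) else 0) := by
    refine Measurable.ite (measurableSet_lt measurable_const measurable_id) ?_ measurable_const
    refine Finset.measurable_prod _ fun j _ => ?_
    refine Monotone.measurable fun a b hab => ?_
    exact measureReal_mono (Set.Iio_subset_Iio hab)
  rw [h3, integral_eq_lintegral_of_nonneg_ae _ hm.aestronglyMeasurable]
  refine Filter.Eventually.of_forall fun s => ?_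
  dsimp only [Pi.zero_apply]
  split_ifs
  · exact Finset.prod_nonneg fun _ _ => measureReal_nonneg
  · exact le_rfl

lemma winProb_eq {k : ℕ} (d : Fin (k+1) → Measure ℝ) [∀ j, IsProbabilityMeasure (d j)]
    (i : Fin (k+1)) (hd : ∀ j, j ≠ i → ∀ a, d j {a} = 0) :
    winProbSW d i =
      ∫ s, (if 0 < s then ∏ j ∈ Finset.univ.erase i, (d j).real (Set.Iio s) else 0) ∂(d i) := by
  unfold winProbSW
  simp only [win_measure d i hd]
  rw [Finset.sum_const, Finset.card_univ, Fintype.card_perm, Fintype.card_fin, nsmul_eq_mul]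
  rw [mul_comm, mul_div_assoc, div_self (by positivity), mul_one]

lemma sum_fix {n : ℕ} {T : Type} [Fintype T] [DecidableEq T] (h : T → ℝ) (i : Fin n) (t : T) :
    ∑ p ∈ Finset.univ.filter (fun p : Fin n → T => p i = t),
      ∏ j ∈ Finset.univ.erase i, h (p j) = (∑ s, h s) ^ (n - 1) := by
  have h1 : Finset.univ.filter (fun p : Fin n → T => p i = t) =
      Fintype.piFinset (fun j => if j = i then {t} else Finset.univ) := by
    ext p
    simp only [mem_filter, mem_univ, true_and, Fintype.mem_piFinset]
    constructor
    · intro hp j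
      by_cases hj : j = i
      · subst hj; simp [hp]
      · simp [hj]
    · intro hp; simpa using hp i
  have h2 : ∀ p : Fin n → T, ∏ j ∈ Finset.univ.erase i, h (p j) =
      ∏ j, (if j = i then 1 else h (p j)) := by
    intro p
    rw [← Finset.mul_prod_erase Finset.univ _ (Finset.mem_univ i), if_pos rfl, one_mul]
    refine Finset.prod_congr rfl fun j hj => ?_
    rw [if_neg (Finset.ne_of_mem_erase hj)]
  simp only [h2]
  rw [h1, ← Finset.prod_univ_sum (fun j => if j = i then {t} else Finset.univ)
    (fun j s => if j = i then 1 else h s)]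
  rw [← Finset.mul_prod_erase Finset.univ _ (Finset.mem_univ i)]
  simp only [if_true, Finset.sum_singleton, one_mul]
  rw [Finset.prod_congr rfl (g := fun _ => ∑ s, h s)]
  · simp
  · intro j hj
    simp [Finset.ne_of_mem_erase hj]

lemma interim_eq {k : ℕ} {T : Type} [Fintype T] [DecidableEq T] (f : T → ℝ)
    (D : T → Measure ℝ) [∀ t, IsProbabilityMeasure (D t)]
    (hD : ∀ t, f t ≠ 0 → ∀ a, D t {a} = 0) (i : Fin (k+1)) (t : T) :
    diceInterimSym (k+1) f D i t =
      ∫ s, (if 0 < s then (∑ r, f r * (D r).real (Set.Iio s)) ^ k else 0) ∂(D t) := by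
  unfold diceInterimSym
  have h1 : ∀ p ∈ Finset.univ.filter (fun p : Fin (k+1) → T => p i = t),
      (∏ j ∈ Finset.univ.erase i, f (p j)) * winProbSW (fun j => D (p j)) i =
      ∫ s, (if 0 < s then ∏ j ∈ Finset.univ.erase i, (f (p j) * (D (p j)).real (Set.Iio s)) else 0)
        ∂(D t) := by
    intro p hp
    have hpt : p i = t := by simpa using hp
    by_cases h0 : ∏ j ∈ Finset.univ.erase i, f (p j) = 0
    · simp [Finset.prod_mul_distrib, h0]
    · rw [winProb_eq, ← integral_const_mul, hpt]
      · refine integral_congr_ae (Filter.Eventually.of_forall fun s => ?_)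
        simp only [Finset.prod_mul_distrib]
        split_ifs <;> simp
      · intro j hj
        exact hD _ (fun h => h0 (Finset.prod_eq_zero (Finset.mem_erase.2 ⟨hj, Finset.mem_univ _⟩) h))
  rw [Finset.sum_congr rfl h1, ← integral_finsetSum]
  · refine integral_congr_ae (Filter.Eventually.of_forall fun s => ?_)
    by_cases hs : 0 < s
    · simp only [hs, if_true]
      rw [sum_fix (fun r => f r * (D r).real (Set.Iio s)) i t]
      simp
    · simp [hs]
  · intro p _
    have hm : Measurable fun s : ℝ => (if 0 < s then
        ∏ j ∈ Finset.univ.erase i, (f (p j) * (D (p j)).real (Set.Iio s)) else 0) := by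
      refine Measurable.ite (measurableSet_lt measurable_const measurable_id) ?_ measurable_const
      refine Finset.measurable_prod _ fun j _ => Measurable.const_mul ?_ _
      refine Monotone.measurable fun a b hab => ?_
      exact measureReal_mono (Set.Iio_subset_Iio hab)
    refine Integrable.of_bound hm.aestronglyMeasurable
      (∏ j ∈ Finset.univ.erase i, |f (p j)|) (Filter.Eventually.of_forall fun s => ?_)
    split_ifs
    · rw [Real.norm_eq_abs, Finset.abs_prod]
      refine Finset.prod_le_prod (fun _ _ => abs_nonneg _) fun j _ => ?_
      rw [abs_mul, abs_of_nonneg (measureReal_nonneg (μ := D (p j)))]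
      exact mul_le_of_le_one_right (abs_nonneg _) measureReal_le_one
    · simpa using Finset.prod_nonneg fun _ _ => abs_nonneg _

lemma border {n : ℕ} {T : Type} [Fintype T] [DecidableEq T] (f : T → ℝ)
    (hf0 : ∀ t, 0 ≤ f t) (hf1 : ∑ t : T, f t = 1) (x : T → ℝ)
    (A : (Fin n → T) → Finset (Fin n) → ℝ) (hA : ImplementsSym n f A x) (S : Finset T) :
    n * ∑ t ∈ S, f t * x t ≤ 1 - (1 - ∑ t ∈ S, f t) ^ n := by
  obtain ⟨hA0, hA1, hAc, hAx⟩ := hA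
  set a : (Fin n → T) → Fin n → ℝ :=
    fun p i => ∑ R ∈ Finset.univ.filter (fun R : Finset (Fin n) => i ∈ R), A p R with ha
  have ha0 : ∀ p i, 0 ≤ a p i := fun p i => Finset.sum_nonneg fun _ _ => hA0 _ _
  have ha1 : ∀ p, ∑ i, a p i ≤ 1 := by
    intro p
    simp only [ha, Finset.sum_filter]
    rw [Finset.sum_comm, ← hA1 p]
    refine Finset.sum_le_sum fun R _ => ?_
    rw [← Finset.sum_filter, Finset.sum_const]
    by_cases h : A p R = 0
    · simp [h]
    · have := hAc p R h
      have h2 : (Finset.univ.filter (fun i => i ∈ R)) = R := by ext; simp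
      rw [h2, nsmul_eq_mul]
      have : (R.card : ℝ) ≤ 1 := by exact_mod_cast this
      nlinarith [hA0 p R]
  have hone : ∀ i, ∑ t ∈ S, f t * x t =
      ∑ p : Fin n → T, (∏ j, f (p j)) * (if p i ∈ S then a p i else 0) := by
    intro i
    have : ∀ t, f t * x t = ∑ p : Fin n → T, if p i = t then (∏ j, f (p j)) * a p i else 0 := by
      intro t
      rw [← hAx i t, Finset.mul_sum, ← Finset.sum_filter]
      refine Finset.sum_congr rfl fun p hp => ?_
      have hpt : p i = t := by simpa using hp
      rw [← Finset.mul_prod_erase Finset.univ _ (Finset.mem_univ i), hpt, mul_assoc]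
    simp only [this]
    rw [Finset.sum_comm]
    refine Finset.sum_congr rfl fun p _ => ?_
    rw [Finset.sum_ite_eq]
    split_ifs <;> simp
  have htot : n * ∑ t ∈ S, f t * x t = ∑ i : Fin n, ∑ t ∈ S, f t * x t := by simp
  rw [htot, Finset.sum_congr rfl (fun i _ => hone i), Finset.sum_comm]
  have hpt : ∀ g : T → ℝ, ∑ p : Fin n → T, ∏ j, g (p j) = (∑ t, g t) ^ n := by
    intro g
    have := (Finset.prod_univ_sum (fun _ : Fin n => (Finset.univ : Finset T)) (fun _ s => g s))
    simp only [Fintype.piFinset_univ] at this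
    rw [← this]; simp
  have hr : 1 - (1 - ∑ t ∈ S, f t) ^ n = ∑ p : Fin n → T,
      ((∏ j, f (p j)) - ∏ j, (if p j ∈ S then 0 else f (p j))) := by
    rw [Finset.sum_sub_distrib, hpt f, hpt (fun t => if t ∈ S then 0 else f t), hf1, one_pow]
    congr 2
    rw [← hf1, sub_eq_iff_eq_add, ← Finset.sum_filter_not_add_sum_filter Finset.univ (fun t => t ∈ S)]
    congr 1
    · rw [Finset.sum_filter]; simp
    · congr 1; ext; simp
  rw [hr]
  refine Finset.sum_le_sum fun p _ => ?_
  have hP : 0 ≤ ∏ j, f (p j) := Finset.prod_nonneg fun _ _ => hf0 _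
  rw [← Finset.mul_sum]
  by_cases h : ∃ j, p j ∈ S
  · obtain ⟨j, hj⟩ := h
    rw [Finset.prod_eq_zero (Finset.mem_univ j) (f := fun j => if p j ∈ S then 0 else f (p j))
      (if_pos hj), sub_zero]
    refine mul_le_of_le_one_right hP (le_trans (Finset.sum_le_sum fun i _ => ?_) (ha1 p))
    split_ifs
    · exact le_rfl
    · exact ha0 p i
  · push Not at h
    simp [h]

lemma abel (Δ : ℕ → ℝ) (h0 : Δ 0 = 0) (hΔ : ∀ j, 0 ≤ Δ j) : ∀ (k : ℕ) (b : Fin k → ℝ)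
    (_ : Monotone b) (M : ℝ) (_ : ∀ i, b i ≤ M),
    ∑ i : Fin k, b i * (Δ (i + 1) - Δ i) ≤ M * Δ k := by
  intro k
  induction k with
  | zero => intro b _ M _; simp [h0]
  | succ k ih =>
    intro b hb M hM
    rw [Fin.sum_univ_castSucc]
    have := ih (fun i => b i.castSucc) (fun i j hij => hb (by simpa using hij)) (b (Fin.last k))
      (fun i => hb (Fin.le_last _))
    simp only [Fin.val_castSucc, Fin.val_last] at this ⊢
    nlinarith [mul_le_mul_of_nonneg_right (hM (Fin.last k)) (hΔ (k+1))]

lemma restrict_sum (c : ℕ → ℝ) (hc : Monotone c) (k : ℕ) :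
    ∑ i ∈ Finset.range k, (volume : Measure ℝ).restrict (Set.Ioc (c i) (c (i+1))) =
      (volume : Measure ℝ).restrict (Set.Ioc (c 0) (c k)) := by
  induction k with
  | zero => simp
  | succ k ih =>
    rw [Finset.sum_range_succ, ih, ← Set.Ioc_union_Ioc_eq_Ioc (hc (Nat.zero_le k)) (hc (Nat.le_succ k)),
      Measure.restrict_union _ measurableSet_Ioc]
    exact Set.Ioc_disjoint_Ioc_of_le le_rfl

noncomputable def wfun (m : ℝ) (k : ℕ) (q : ℝ) : ℝ := if m < q then (min q 1) ^ k else 0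

lemma wfun_meas (m : ℝ) (k : ℕ) : Measurable (wfun m k) := by
  unfold wfun
  refine Measurable.ite (measurableSet_lt measurable_const measurable_id) ?_ measurable_const
  fun_prop

lemma wfun_int (m : ℝ) (hm : 0 ≤ m) (k : ℕ) (μ : Measure ℝ) [IsFiniteMeasure μ] :
    Integrable (wfun m k) μ := by
  refine Integrable.of_bound (wfun_meas m k).aestronglyMeasurable 1
    (Filter.Eventually.of_forall fun q => ?_)
  unfold wfun
  split_ifs with h
  · have : 0 ≤ min q 1 := le_min (hm.trans h.le) zero_le_one
    rw [Real.norm_eq_abs, abs_of_nonneg (pow_nonneg this k)]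
    exact pow_le_one₀ this (min_le_right _ _)
  · simp

lemma wfun_integral (m : ℝ) (hm : 0 ≤ m) (k : ℕ) (a b : ℝ) (hab : a ≤ b) (hb : b ≤ 1) :
    ∫ q in Set.Ioc a b, wfun m k q =
      ((max b m) ^ (k+1) - (max a m) ^ (k+1)) / ((k : ℝ)+1) := by
  have h1 : ∫ q in Set.Ioc a b, wfun m k q =
      ∫ q in Set.Ioc a b, (Set.Ioi m).indicator (fun q => q ^ k) q := by
    refine setIntegral_congr_fun measurableSet_Ioc fun q hq => ?_
    simp only [wfun, Set.indicator, Set.mem_Ioi]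
    rw [min_eq_left (hq.2.trans hb)]
  have h2 : Set.Ioc a b ∩ Set.Ioi m = Set.Ioc (max a m) (max b m) := by
    ext q
    simp only [Set.mem_inter_iff, Set.mem_Ioc, Set.mem_Ioi, max_lt_iff, le_max_iff]
    constructor
    · rintro ⟨⟨h1, h2⟩, h3⟩; exact ⟨⟨h1, h3⟩, Or.inl h2⟩
    · rintro ⟨⟨h1, h2⟩, h3⟩
      refine ⟨⟨h1, ?_⟩, h2⟩
      rcases h3 with h | h
      · exact h
      · exact absurd h2 (not_lt.2 h)
  rw [h1, setIntegral_indicator measurableSet_Ioi, h2,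
    ← intervalIntegral.integral_of_le (max_le_max_right m hab), integral_pow]

def Kset {T : Type} [Fintype T] (f : T → ℝ) (m : ℝ) (k : ℕ) : Set (T → ℝ) :=
  {y | ∃ μ : T → Measure ℝ, ∑ t, μ t = (volume : Measure ℝ).restrict (Set.Ioc 0 1) ∧
    (∀ t, μ t Set.univ = ENNReal.ofReal (f t)) ∧ ∀ t, ∫ q, wfun m k q ∂(μ t) = y t}

lemma Kset_convex {T : Type} [Fintype T] (f : T → ℝ) (m : ℝ) (hm : 0 ≤ m) (k : ℕ) :
    Convex ℝ (Kset f m k) := by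
  rintro y₁ ⟨μ, h1, h2, h3⟩ y₂ ⟨ν, g1, g2, g3⟩ a b ha hb hab
  have hE : ENNReal.ofReal a + ENNReal.ofReal b = 1 := by
    rw [← ENNReal.ofReal_add ha hb, hab, ENNReal.ofReal_one]
  refine ⟨fun t => ENNReal.ofReal a • μ t + ENNReal.ofReal b • ν t, ?_, ?_, ?_⟩
  · rw [Finset.sum_add_distrib, ← Finset.smul_sum, ← Finset.smul_sum, h1, g1, ← add_smul, hE,
      one_smul]
  · intro t
    simp only [Measure.add_apply, Measure.smul_apply, smul_eq_mul, h2, g2]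
    rw [← add_mul, hE, one_mul]
  · intro t
    have i1 : IsFiniteMeasure (μ t) := ⟨by rw [h2]; exact ENNReal.ofReal_lt_top⟩
    have i2 : IsFiniteMeasure (ν t) := ⟨by rw [g2]; exact ENNReal.ofReal_lt_top⟩
    rw [integral_add_measure, integral_smul_measure, integral_smul_measure, h3, g3,
      ENNReal.toReal_ofReal ha, ENNReal.toReal_ofReal hb]
    · rfl
    · exact (wfun_int m hm k _).smul_measure ENNReal.ofReal_ne_top
    · exact (wfun_int m hm k _).smul_measure ENNReal.ofReal_ne_top

def cum {N : ℕ} (g : Fin N → ℝ) (j : ℕ) : ℝ := ∑ i ∈ Finset.univ.filter (fun i : Fin N => i.val < j), g i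

lemma cum_zero {N : ℕ} (g : Fin N → ℝ) : cum g 0 = 0 := by simp [cum]

lemma cum_top {N : ℕ} (g : Fin N → ℝ) : cum g N = ∑ i, g i := by simp [cum]

lemma cum_succ {N : ℕ} (g : Fin N → ℝ) (i : Fin N) : cum g (i + 1) = cum g i + g i := by
  unfold cum
  have : Finset.univ.filter (fun l : Fin N => l.val < i.val + 1) =
      insert i (Finset.univ.filter (fun l : Fin N => l.val < i.val)) := by
    ext l; simp [Fin.ext_iff]; omega
  rw [this, Finset.sum_insert (by simp), add_comm]

lemma cum_mono {N : ℕ} (g : Fin N → ℝ) (hg : ∀ i, 0 ≤ g i) : Monotone (cum g) := by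
  intro a b hab
  refine Finset.sum_le_sum_of_subset_of_nonneg ?_ fun _ _ _ => hg _
  intro i; simp; omega

noncomputable def Wf (m : ℝ) (k : ℕ) (q : ℝ) : ℝ := ((max q m) ^ (k+1) - m ^ (k+1)) / ((k : ℝ)+1)

noncomputable def vert {T : Type} {N : ℕ} (f : T → ℝ) (m : ℝ) (k : ℕ) (E : Fin N ≃ T) (t : T) : ℝ :=
  Wf m k (cum (f ∘ E) (E.symm t + 1)) - Wf m k (cum (f ∘ E) (E.symm t))

lemma vert_mem {T : Type} [Fintype T] {N : ℕ} (f : T → ℝ) (hf0 : ∀ t, 0 ≤ f t)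
    (hf1 : ∑ t : T, f t = 1) (m : ℝ) (hm : 0 ≤ m) (k : ℕ) (E : Fin N ≃ T) :
    vert f m k E ∈ Kset f m k := by
  have hmono := cum_mono (f ∘ E) (fun i => hf0 _)
  have htop : cum (f ∘ E) N = 1 := by
    rw [cum_top, ← hf1]; exact Equiv.sum_comp E f
  refine ⟨fun t => (volume : Measure ℝ).restrict
    (Set.Ioc (cum (f ∘ E) (E.symm t)) (cum (f ∘ E) (E.symm t + 1))), ?_, ?_, ?_⟩
  · rw [← Equiv.sum_comp E]
    simp only [Equiv.symm_apply_apply]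
    rw [Fin.sum_univ_eq_sum_range (fun i => (volume : Measure ℝ).restrict
      (Set.Ioc (cum (f ∘ E) i) (cum (f ∘ E) (i + 1)))) N, restrict_sum _ hmono, cum_zero, htop]
  · intro t
    rw [Measure.restrict_apply_univ, Real.volume_Ioc, cum_succ]
    simp
  · intro t
    rw [wfun_integral m hm k _ _ (hmono (Nat.le_succ _))
      ((hmono (E.symm t).isLt).trans htop.le)]
    unfold vert Wf
    ring

lemma mem_Kset {T : Type} [Fintype T] [DecidableEq T] (f : T → ℝ) (hf0 : ∀ t, 0 ≤ f t)
    (hf1 : ∑ t : T, f t = 1) (m : ℝ) (hm : 0 ≤ m) (hm1 : m ≤ 1) (k : ℕ) (y : T → ℝ)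
    (hy0 : ∀ t, 0 ≤ y t)
    (hy : ∀ S : Finset T, ((k : ℝ)+1) * ∑ t ∈ S, y t ≤ 1 - (1 - ∑ t ∈ S, f t) ^ (k+1))
    (hyt : ((k : ℝ)+1) * ∑ t, y t = 1 - m ^ (k+1)) : y ∈ Kset f m k := by
  have hk : (0 : ℝ) < (k : ℝ) + 1 := by positivity
  set N := Fintype.card T
  have hsub : convexHull ℝ (Set.range fun E : Fin N ≃ T => vert f m k E) ⊆ Kset f m k := by
    refine convexHull_min ?_ (Kset_convex f m hm k)
    rintro _ ⟨E, rfl⟩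
    exact vert_mem f hf0 hf1 m hm k E
  apply hsub
  by_contra hcon
  obtain ⟨φ, u, h1, h2⟩ := geometric_hahn_banach_closed_point (convex_convexHull ℝ _)
    ((Set.finite_range (fun E : Fin N ≃ T => vert f m k E)).isClosed_convexHull ℝ) hcon
  set b : T → ℝ := fun t => φ (Pi.single t 1) with hb
  have hφ : ∀ z : T → ℝ, φ z = ∑ t, b t * z t := by
    intro z
    conv_lhs => rw [pi_eq_sum_univ' z]
    rw [map_sum]
    refine Finset.sum_congr rfl fun t _ => ?_
    rw [map_smul, smul_eq_mul, mul_comm, hb]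
  let e0 : T ≃ Fin N := Fintype.equivFin T
  let E : Fin N ≃ T := (Tuple.sort (b ∘ e0.symm)).trans e0.symm
  have hE : Monotone (b ∘ E) := Tuple.monotone_sort (b ∘ e0.symm)
  have h3 := h1 _ (subset_convexHull ℝ _ ⟨E, rfl⟩)
  have h4 := h3.trans h2
  rw [hφ, hφ, ← Equiv.sum_comp E, ← Equiv.sum_comp E (fun t => b t * y t)] at h4
  let Δ : ℕ → ℝ := fun j => cum (y ∘ E) j - Wf m k (cum (f ∘ E) j)
  have htop : cum (f ∘ E) N = 1 := by
    rw [cum_top, ← hf1]; exact Equiv.sum_comp E f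
  have hΔ0 : Δ 0 = 0 := by simp [Δ, cum_zero, Wf, hm]
  have hΔN : Δ N = 0 := by
    have : cum (y ∘ E) N = ∑ t, y t := by rw [cum_top]; exact Equiv.sum_comp E y
    simp only [Δ, htop, this, Wf, max_eq_left hm1, one_pow]
    rw [← hyt]; field_simp; ring
  have hΔ : ∀ j, 0 ≤ Δ j := by
    intro j
    have hc0 : 0 ≤ cum (y ∘ E) j := Finset.sum_nonneg fun _ _ => hy0 _
    simp only [Δ, Wf]
    rw [sub_nonneg, div_le_iff₀ hk]
    rcases le_total (cum (f ∘ E) j) m with h | h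
    · rw [max_eq_right h, sub_self]; positivity
    · rw [max_eq_left h]
      let S : Finset T := (Finset.univ.filter (fun i : Fin N => i.val < j)).map E.toEmbedding
      have hS : ∀ g : T → ℝ, ∑ t ∈ S, g t = cum (g ∘ E) j := by
        intro g; simp [S, cum, Finset.sum_map]
      have hc : ∀ g : T → ℝ, ∑ t ∈ Sᶜ, g t = ∑ t, g t - cum (g ∘ E) j := by
        intro g
        rw [← hS, ← Finset.sum_add_sum_compl S]; ring
      have := hy Sᶜ
      rw [hc, hc, hf1] at this
      have h5 : 1 - (1 - cum (f ∘ E) j) = cum (f ∘ E) j := by ring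
      rw [h5] at this
      nlinarith
  obtain ⟨M, hM⟩ : ∃ M, ∀ i, (b ∘ E) i ≤ M := by
    obtain ⟨M, hM⟩ := (Set.finite_range (b ∘ E)).bddAbove
    exact ⟨M, fun i => hM ⟨i, rfl⟩⟩
  have h6 := abel Δ hΔ0 hΔ N (b ∘ E) hE M hM
  rw [hΔN, mul_zero] at h6
  have h7 : ∑ i : Fin N, (b ∘ E) i * (Δ (i + 1) - Δ i) =
      ∑ i, b (E i) * y (E i) - ∑ i, b (E i) * vert f m k E (E i) := by
    rw [← Finset.sum_sub_distrib]
    refine Finset.sum_congr rfl fun i _ => ?_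
    simp only [Δ, vert, Equiv.symm_apply_apply, cum_succ (y ∘ E), Function.comp]
    ring
  rw [h7] at h6
  linarith

lemma main_aux (k : ℕ) (T : Type) [Fintype T] [DecidableEq T]
    (f : T → ℝ) (hf0 : ∀ t, 0 ≤ f t) (hf1 : ∑ t : T, f t = 1)
    (x : T → ℝ) (hx : ∀ t, 0 ≤ x t ∧ x t ≤ 1)
    (hfeas : ∃ A, ImplementsSym (k+1) f A x) :
    ∃ D : T → Measure ℝ, (∀ t, IsProbabilityMeasure (D t)) ∧
      ∀ (i : Fin (k+1)) (t : T), diceInterimSym (k+1) f D i t = x t := by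
  obtain ⟨A, hA⟩ := hfeas
  have hB := border f hf0 hf1 x A hA
  push_cast at hB
  have hy0 : ∀ t, 0 ≤ f t * x t := fun t => mul_nonneg (hf0 t) (hx t).1
  obtain ⟨m, hm, hm1, hmk⟩ : ∃ m : ℝ, 0 ≤ m ∧ m ≤ 1 ∧
      m ^ (k+1) = 1 - ((k : ℝ)+1) * ∑ t, f t * x t := by
    have hz : 0 ≤ 1 - ((k : ℝ)+1) * ∑ t, f t * x t := by
      have := hB Finset.univ
      rw [hf1] at this
      simp at this
      linarith
    have hz1 : 1 - ((k : ℝ)+1) * ∑ t, f t * x t ≤ 1 := by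
      have : 0 ≤ ((k : ℝ)+1) * ∑ t, f t * x t :=
        mul_nonneg (by positivity) (Finset.sum_nonneg fun t _ => hy0 t)
      linarith
    refine ⟨(1 - ((k : ℝ)+1) * ∑ t, f t * x t) ^ (((k+1 : ℕ) : ℝ)⁻¹), Real.rpow_nonneg hz _,
      Real.rpow_le_one hz hz1 (by positivity), Real.rpow_inv_natCast_pow hz (by omega)⟩
  obtain ⟨μ, hμ1, hμ2, hμ3⟩ := mem_Kset f hf0 hf1 m hm hm1 k (fun t => f t * x t) hy0 hB
    (by rw [hmk]; ring)
  have hfin : ∀ t, IsFiniteMeasure (μ t) := fun t =>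
    ⟨by rw [hμ2]; exact ENNReal.ofReal_lt_top⟩
  have hsh : Measurable (fun q : ℝ => q - m) := by fun_prop
  have hatom : ∀ t a, μ t {a} = 0 := by
    intro t a
    have h1 : μ t {a} ≤ (∑ r, μ r) {a} := by
      rw [Measure.finsetSum_apply]
      exact Finset.single_le_sum (f := fun r => μ r {a}) (fun _ _ => zero_le) (Finset.mem_univ t)
    rw [hμ1] at h1
    simpa using h1
  let D : T → Measure ℝ := fun t => if f t = 0 then
      ENNReal.ofReal (x t) • Measure.dirac 2 + ENNReal.ofReal (1 - x t) • Measure.dirac (-1)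
    else (ENNReal.ofReal (f t))⁻¹ • (μ t).map (fun q => q - m)
  have hD0 : ∀ t, f t = 0 → D t = ENNReal.ofReal (x t) • Measure.dirac 2 +
      ENNReal.ofReal (1 - x t) • Measure.dirac (-1) := fun t h => if_pos h
  have hD1 : ∀ t, f t ≠ 0 → D t = (ENNReal.ofReal (f t))⁻¹ • (μ t).map (fun q => q - m) :=
    fun t h => if_neg h
  have hprob : ∀ t, IsProbabilityMeasure (D t) := by
    intro t
    constructor
    by_cases h : f t = 0
    · rw [hD0 t h]
      simp only [Measure.add_apply, Measure.smul_apply, smul_eq_mul, measure_univ, mul_one]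
      rw [← ENNReal.ofReal_add (hx t).1 (by linarith [(hx t).2])]
      simp
    · rw [hD1 t h, Measure.smul_apply, Measure.map_apply hsh MeasurableSet.univ, Set.preimage_univ,
        hμ2, smul_eq_mul]
      refine ENNReal.inv_mul_cancel ?_ ENNReal.ofReal_ne_top
      simpa using lt_of_le_of_ne (hf0 t) (Ne.symm h)
  have hDa : ∀ t, f t ≠ 0 → ∀ a, D t {a} = 0 := by
    intro t h a
    rw [hD1 t h, Measure.smul_apply, Measure.map_apply hsh (measurableSet_singleton a)]
    have : (fun q : ℝ => q - m) ⁻¹' {a} = {a + m} := by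
      ext q; simp [sub_eq_iff_eq_add]
    rw [this, hatom, smul_zero]
  refine ⟨D, hprob, fun i t => ?_⟩
  rw [interim_eq f D hDa i t]
  have hG : ∀ s, 0 < s → ∑ r, f r * (D r).real (Set.Iio s) = min (s + m) 1 := by
    intro s hs
    have h1 : ∀ r, f r * (D r).real (Set.Iio s) = (μ r).real (Set.Iio (s + m)) := by
      intro r
      by_cases h : f r = 0
      · have : μ r = 0 := by
          rw [← Measure.measure_univ_eq_zero, hμ2, h, ENNReal.ofReal_zero]
        simp [h, this]
      · have hpre : (fun q : ℝ => q - m) ⁻¹' (Set.Iio s) = Set.Iio (s + m) := by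
          ext q; simp [sub_lt_iff_lt_add]
        rw [hD1 r h, Measure.real, Measure.smul_apply, Measure.map_apply hsh measurableSet_Iio, hpre,
          smul_eq_mul, ENNReal.toReal_mul, ENNReal.toReal_inv, ENNReal.toReal_ofReal (hf0 r),
          ← mul_assoc, mul_inv_cancel₀ h, one_mul, Measure.real]
    simp only [h1]
    have h2 : ∑ r, (μ r).real (Set.Iio (s + m)) = (∑ r, μ r).real (Set.Iio (s+m)) := by
      simp only [Measure.real, Measure.finsetSum_apply]
      rw [ENNReal.toReal_sum]
      intro r _; exact measure_ne_top _ _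
    rw [h2, hμ1, Measure.real, Measure.restrict_apply measurableSet_Iio]
    have hsm : 0 < s + m := by linarith
    rcases le_or_gt (s + m) 1 with h | h
    · have : Set.Iio (s+m) ∩ Set.Ioc 0 1 = Set.Ioo 0 (s+m) := by
        ext q; simp only [Set.mem_inter_iff, Set.mem_Iio, Set.mem_Ioc, Set.mem_Ioo]
        constructor
        · rintro ⟨a, b, c⟩; exact ⟨b, a⟩
        · rintro ⟨a, b⟩; exact ⟨b, a, by linarith⟩
      rw [this, Real.volume_Ioo, sub_zero, ENNReal.toReal_ofReal hsm.le, min_eq_left h]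
    · have : Set.Iio (s+m) ∩ Set.Ioc 0 1 = Set.Ioc 0 1 := by
        refine Set.inter_eq_right.2 fun q hq => ?_
        exact lt_of_le_of_lt hq.2 h
      rw [this, Real.volume_Ioc, min_eq_right h.le]; simp
  have hG2 : ∀ s : ℝ, (if 0 < s then (∑ r, f r * (D r).real (Set.Iio s)) ^ k else 0) =
      wfun m k (s + m) := by
    intro s
    unfold wfun
    by_cases hs : 0 < s
    · rw [if_pos hs, if_pos (by linarith), hG s hs]
    · rw [if_neg hs, if_neg (by linarith)]
  simp only [hG2]
  have hwm : Measurable fun s => wfun m k (s + m) := (wfun_meas m k).comp (by fun_prop)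
  by_cases h : f t = 0
  · rw [hD0 t h, integral_add_measure, integral_smul_measure, integral_smul_measure,
      integral_dirac, integral_dirac, ENNReal.toReal_ofReal (hx t).1]
    · have e1 : wfun m k (2 + m) = 1 := by
        unfold wfun; rw [if_pos (by linarith), min_eq_right (by linarith), one_pow]
      have e2 : wfun m k (-1 + m) = 0 := by
        unfold wfun; rw [if_neg (by linarith)]
      rw [e1, e2]; simp
    · exact (integrable_dirac (by simp)).smul_measure ENNReal.ofReal_ne_top
    · exact (integrable_dirac (by simp)).smul_measure ENNReal.ofReal_ne_top
  · rw [hD1 t h, integral_smul_measure, integral_map hsh.aemeasurable hwm.aestronglyMeasurable]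
    simp only [sub_add_cancel]
    rw [hμ3, ENNReal.toReal_inv, ENNReal.toReal_ofReal (hf0 t), smul_eq_mul, ← mul_assoc,
      inv_mul_cancel₀ h, one_mul]

theorem symmetric_dice_exist
    (n : ℕ) (hn : 2 ≤ n) (T : Type) [Fintype T] [DecidableEq T]
    (f : T → ℝ) (hf0 : ∀ t, 0 ≤ f t) (hf1 : ∑ t : T, f t = 1)
    (x : T → ℝ) (hx : ∀ t, 0 ≤ x t ∧ x t ≤ 1)
    (hfeas : ∃ A, ImplementsSym n f A x) :
    ∃ D : T → Measure ℝ, (∀ t, IsProbabilityMeasure (D t)) ∧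
      ∀ (i : Fin n) (t : T), diceInterimSym n f D i t = x t := by
  obtain ⟨k, rfl⟩ : ∃ k, n = k + 1 := ⟨n - 1, by omega⟩
  exact main_aux k T f hf0 hf1 x hx hfeas


end Stmt14
end

section
/- Consider a single-winner environment with n ≥ 2 candidates whose types are drawn i.i.d. from a distribution f on a common finite type set T, and let x : T → [0,1] be a feasible symmetric interim rule. Then there is a unique barrier set for (n, f, x). -/
/-!
Statement 15: In a single-winner environment with `n ≥ 2` candidates whose types are
drawn i.i.d. from a distribution `f` on a common finite type set `T`, if `x : T → [0,1]`
is a feasible symmetric interim rule, then there is a unique barrier set for `(n, f, x)`.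

The symmetric slack of `S ⊆ T` is
`σ_{n,f,x}(S) = 1 − (1 − Σ_{t∈S} f t)^n − n · Σ_{t∈S} f t * x t`; `S` is tight if its
slack is `0`; the active types are `T⁺ = {t : f t * x t > 0}`; barrier sets are the
inclusion-minimal nonempty tight subsets of `T⁺` if a nonempty tight subset of `T⁺`
exists, and `T⁺` itself otherwise.
-/

open Finset

namespace Stmt15

variable {n : ℕ} {T : Type} [Fintype T] [DecidableEq T]

/-- `A` is a single-winner rule implementing the symmetric interim rule `x` in the
i.i.d. environment with common prior `f`. -/
def ImplementsSym (n : ℕ) (f : T → ℝ)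
    (A : (Fin n → T) → Finset (Fin n) → ℝ) (x : T → ℝ) : Prop :=
  (∀ p S, 0 ≤ A p S) ∧ (∀ p, ∑ S : Finset (Fin n), A p S = 1) ∧
  (∀ p S, A p S ≠ 0 → S.card ≤ 1) ∧
  ∀ (i : Fin n) (t : T),
    ∑ p ∈ Finset.univ.filter (fun p : Fin n → T => p i = t),
      (∏ j ∈ Finset.univ.erase i, f (p j)) *
        (∑ S ∈ Finset.univ.filter (fun S : Finset (Fin n) => i ∈ S), A p S) = x t

/-- The symmetric slack. -/
def slackSym (n : ℕ) (f : T → ℝ) (x : T → ℝ) (S : Finset T) : ℝ :=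
  1 - (1 - ∑ t ∈ S, f t) ^ n - (n : ℝ) * ∑ t ∈ S, f t * x t

/-- `S` is tight for `(n, f, x)`. -/
def Tight (n : ℕ) (f : T → ℝ) (x : T → ℝ) (S : Finset T) : Prop :=
  slackSym n f x S = 0

/-- The active types. -/
noncomputable def Tplus (f : T → ℝ) (x : T → ℝ) : Finset T :=
  Finset.univ.filter fun t => 0 < f t * x t

/-- Barrier sets. -/
def IsBarrier (n : ℕ) (f : T → ℝ) (x : T → ℝ) (S : Finset T) : Prop :=
  ((∃ C, C ⊆ Tplus f x ∧ C.Nonempty ∧ Tight n f x C) ∧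
    (S ⊆ Tplus f x ∧ S.Nonempty ∧ Tight n f x S ∧
      ∀ C, C ⊆ Tplus f x → C.Nonempty → Tight n f x C → C ⊆ S → C = S))
  ∨ ((¬ ∃ C, C ⊆ Tplus f x ∧ C.Nonempty ∧ Tight n f x C) ∧ S = Tplus f x)

lemma pow_super (u a b : ℝ) (hu : 0 ≤ u) (ha : 0 < a) (hb : 0 < b) (m : ℕ) :
    0 ≤ (u+a+b)^(m+1) - (u+a)^(m+1) - (u+b)^(m+1) + u^(m+1) ∧
    0 < (u+a+b)^(m+2) - (u+a)^(m+2) - (u+b)^(m+2) + u^(m+2) := by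
  have step : ∀ m : ℕ, 0 ≤ (u+a+b)^(m+1) - (u+a)^(m+1) - (u+b)^(m+1) + u^(m+1) →
      0 < (u+a+b)^(m+2) - (u+a)^(m+2) - (u+b)^(m+2) + u^(m+2) := by
    intro m h
    have h1 : (u+a)^(m+1) < (u+a+b)^(m+1) :=
      pow_lt_pow_left₀ (by linarith) (by linarith) (by omega)
    have h2 : (u+b)^(m+1) < (u+a+b)^(m+1) :=
      pow_lt_pow_left₀ (by linarith) (by linarith) (by omega)
    have h3 := mul_pos ha (sub_pos.2 h1)
    have h4 := mul_pos hb (sub_pos.2 h2)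
    have h5 := mul_nonneg hu h
    have e : (u+a+b)^(m+2) - (u+a)^(m+2) - (u+b)^(m+2) + u^(m+2)
      = u * ((u+a+b)^(m+1) - (u+a)^(m+1) - (u+b)^(m+1) + u^(m+1))
        + b * ((u+a+b)^(m+1) - (u+b)^(m+1)) + a * ((u+a+b)^(m+1) - (u+a)^(m+1)) := by
      ring
    linarith
  induction m with
  | zero =>
    have : 0 ≤ (u+a+b)^(0+1) - (u+a)^(0+1) - (u+b)^(0+1) + u^(0+1) := by
      apply le_of_eq; ring
    exact ⟨this, step 0 this⟩
  | succ k ih => exact ⟨ih.2.le, step (k+1) ih.2.le⟩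

lemma slack_nonneg (n : ℕ) (f : T → ℝ) (hf0 : ∀ t, 0 ≤ f t) (hf1 : ∑ t : T, f t = 1)
    (x : T → ℝ) (A : (Fin n → T) → Finset (Fin n) → ℝ) (hA : ImplementsSym n f A x)
    (S : Finset T) : 0 ≤ slackSym n f x S := by
  obtain ⟨h0, h1, hc, hx⟩ := hA
  set w : (Fin n → T) → Fin n → ℝ := fun p i =>
    ∑ C ∈ Finset.univ.filter (fun C : Finset (Fin n) => i ∈ C), A p C with hw
  have hw0 : ∀ p i, 0 ≤ w p i := fun p i => Finset.sum_nonneg fun C _ => h0 p C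
  have hw1 : ∀ p, ∑ i, w p i ≤ 1 := by
    intro p
    rw [← h1 p]
    simp only [hw, Finset.sum_filter]
    rw [Finset.sum_comm]
    apply Finset.sum_le_sum
    intro C _
    have : (∑ i : Fin n, if i ∈ C then A p C else 0) = (C.card : ℝ) * A p C := by
      simp
    rw [this]
    by_cases h : A p C = 0
    · simp [h]
    · have : (C.card : ℝ) ≤ 1 := by exact_mod_cast hc p C h
      nlinarith [h0 p C]
  have key : ∀ i : Fin n, ∑ t ∈ S, f t * x t =
      ∑ p : Fin n → T, (∏ j, f (p j)) * (if p i ∈ S then w p i else 0) := by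
    intro i
    have : ∀ p : Fin n → T, (∏ j, f (p j)) * (if p i ∈ S then w p i else 0) =
        ∑ t ∈ S, if p i = t then (∏ j, f (p j)) * w p i else 0 := by
      intro p
      rw [Finset.sum_ite_eq]
      split_ifs <;> simp
    simp_rw [this]
    rw [Finset.sum_comm]
    apply Finset.sum_congr rfl
    intro t _
    rw [← hx i t, Finset.mul_sum, ← Finset.sum_filter]
    apply Finset.sum_congr rfl
    intro p hp
    have hp : p i = t := by simpa using hp
    rw [← Finset.mul_prod_erase _ _ (Finset.mem_univ i), hp, mul_assoc]
  have hsum : (n : ℝ) * ∑ t ∈ S, f t * x t =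
      ∑ p : Fin n → T, (∏ j, f (p j)) * ∑ i, (if p i ∈ S then w p i else 0) := by
    have : (n : ℝ) * ∑ t ∈ S, f t * x t = ∑ i : Fin n, ∑ t ∈ S, f t * x t := by simp
    rw [this, Finset.sum_congr rfl (fun i _ => key i), Finset.sum_comm]
    simp_rw [Finset.mul_sum]
  have hc1 : 1 = ∑ p : Fin n → T, ∏ j, f (p j) := by
    rw [← Fintype.sum_pow, hf1, one_pow]
  have hc2 : (1 - ∑ t ∈ S, f t) ^ n =
      ∑ p : Fin n → T, ∏ j, (if p j ∈ S then 0 else f (p j)) := by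
    rw [← Fintype.sum_pow (fun t => if t ∈ S then 0 else f t) n]
    congr 1
    rw [← hf1, sub_eq_iff_eq_add]
    have : ∑ t ∈ S, f t = ∑ t, if t ∈ S then f t else 0 := by simp
    rw [this, ← Finset.sum_add_distrib]
    apply Finset.sum_congr rfl
    intro t _
    split_ifs <;> simp
  unfold slackSym
  rw [hsum, hc2, sub_nonneg]
  nth_rewrite 1 [hc1]
  rw [← Finset.sum_sub_distrib]
  apply Finset.sum_le_sum
  intro p _
  have hP : 0 ≤ ∏ j, f (p j) := Finset.prod_nonneg fun j _ => hf0 _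
  by_cases h : ∃ j, p j ∈ S
  · obtain ⟨j, hj⟩ := h
    have hz : (∏ j, (if p j ∈ S then 0 else f (p j))) = 0 :=
      Finset.prod_eq_zero (Finset.mem_univ j) (by simp [hj])
    rw [hz, sub_zero]
    apply mul_le_of_le_one_right hP
    refine le_trans (Finset.sum_le_sum fun i _ => ?_) (hw1 p)
    split_ifs
    · exact le_rfl
    · exact hw0 p i
  · push Not at h
    simp [h]

lemma tight_chain (n : ℕ) (hn : 2 ≤ n) (f : T → ℝ) (hf0 : ∀ t, 0 ≤ f t)
    (hf1 : ∑ t : T, f t = 1) (x : T → ℝ) (hs : ∀ S, 0 ≤ slackSym n f x S)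
    (B C : Finset T) (hB : ∀ t ∈ B, 0 < f t) (hC : ∀ t ∈ C, 0 < f t)
    (tB : Tight n f x B) (tC : Tight n f x C) : B ⊆ C ∨ C ⊆ B := by
  by_contra hcon
  push Not at hcon
  obtain ⟨h1, h2⟩ := hcon
  have pa : 0 < ∑ t ∈ B \ C, f t :=
    Finset.sum_pos (fun t ht => hB t (Finset.mem_sdiff.1 ht).1) (Finset.sdiff_nonempty.2 h1)
  have pb : 0 < ∑ t ∈ C \ B, f t :=
    Finset.sum_pos (fun t ht => hC t (Finset.mem_sdiff.1 ht).1) (Finset.sdiff_nonempty.2 h2)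
  have hu : ∑ t ∈ B ∪ C, f t ≤ 1 := by
    rw [← hf1]
    exact Finset.sum_le_sum_of_subset_of_nonneg (Finset.subset_univ _) (fun t _ _ => hf0 t)
  have e1 : ∑ t ∈ B ∪ C, f t = ∑ t ∈ C \ B, f t + ∑ t ∈ B, f t := by
    rw [← Finset.sum_sdiff (Finset.subset_union_left : B ⊆ B ∪ C), Finset.union_sdiff_left]
  have e2 : ∑ t ∈ B ∪ C, f t = ∑ t ∈ B \ C, f t + ∑ t ∈ C, f t := by
    rw [← Finset.sum_sdiff (Finset.subset_union_right : C ⊆ B ∪ C), Finset.union_sdiff_right]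
  have e3 := Finset.sum_union_inter (s₁ := B) (s₂ := C) (f := f)
  have e4 := Finset.sum_union_inter (s₁ := B) (s₂ := C) (f := fun t => f t * x t)
  obtain ⟨m, rfl⟩ : ∃ m, n = m + 2 := ⟨n - 2, by omega⟩
  have hp := (pow_super (1 - ∑ t ∈ B ∪ C, f t) _ _ (by linarith) pa pb m).2
  have s1 := hs (B ∪ C)
  have s2 := hs (B ∩ C)
  unfold Tight at tB tC
  unfold slackSym at *
  have q1 : 1 - ∑ t ∈ B ∪ C, f t + ∑ t ∈ B \ C, f t = 1 - ∑ t ∈ C, f t := by linarith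
  have q2 : 1 - ∑ t ∈ B ∪ C, f t + ∑ t ∈ C \ B, f t = 1 - ∑ t ∈ B, f t := by linarith
  have q3 : 1 - ∑ t ∈ C, f t + ∑ t ∈ C \ B, f t = 1 - ∑ t ∈ B ∩ C, f t := by linarith
  rw [q1, q2, q3] at hp
  have e5 := congrArg (fun z => ((m + 2 : ℕ) : ℝ) * z) e4
  simp only [mul_add] at e5
  linarith

theorem unique_barrier_set
    (n : ℕ) (hn : 2 ≤ n) (T : Type) [Fintype T] [DecidableEq T]
    (f : T → ℝ) (hf0 : ∀ t, 0 ≤ f t) (hf1 : ∑ t : T, f t = 1)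
    (x : T → ℝ) (hx : ∀ t, 0 ≤ x t ∧ x t ≤ 1)
    (hfeas : ∃ A, ImplementsSym n f A x) :
    ∃! B : Finset T, IsBarrier n f x B := by
  obtain ⟨A, hA⟩ := hfeas
  have hs := slack_nonneg n f hf0 hf1 x A hA
  have hpos : ∀ C, C ⊆ Tplus f x → ∀ t ∈ C, 0 < f t := by
    intro C hC t ht
    have h : 0 < f t * x t := by simpa [Tplus] using hC ht
    exact pos_of_mul_pos_left h (hx t).1
  by_cases hex : ∃ C, C ⊆ Tplus f x ∧ C.Nonempty ∧ Tight n f x C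
  · obtain ⟨B, hB, hmin⟩ := WellFounded.has_min (wellFounded_lt (α := Finset T))
      {C | C ⊆ Tplus f x ∧ C.Nonempty ∧ Tight n f x C} hex
    have hmin2 : ∀ C, C ⊆ Tplus f x → C.Nonempty → Tight n f x C → C ⊆ B → C = B := by
      intro C c1 c2 c3 c4
      by_contra hne
      exact hmin C ⟨c1, c2, c3⟩ (lt_of_le_of_ne c4 hne)
    refine ⟨B, Or.inl ⟨hex, hB.1, hB.2.1, hB.2.2, hmin2⟩, ?_⟩
    rintro C (⟨-, c1, c2, c3, c4⟩ | ⟨h, -⟩)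
    · rcases tight_chain n hn f hf0 hf1 x hs B C (hpos B hB.1) (hpos C c1) hB.2.2 c3 with h | h
      · exact (c4 B hB.1 hB.2.1 hB.2.2 h).symm
      · exact hmin2 C c1 c2 c3 h
    · exact absurd hex h
  · refine ⟨Tplus f x, Or.inr ⟨hex, rfl⟩, ?_⟩
    rintro C (⟨h, -⟩ | ⟨-, h⟩)
    · exact absurd h hex
    · exact h

end Stmt15
end
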